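/- For every ρ ∈ (0,∞), the Riemann–Liouville process X^ρ in L²([0,1], dt) satisfies e_n(X^ρ) ~ π^{−(ρ+1/2)} · (ρ+1/2)^ρ · ((2ρ+1)/(2ρ))^{1/2} · Γ(ρ+1/2) · (log n)^{−ρ} as n → ∞. -/

import Mathlib

open MeasureTheory ProbabilityTheory Filter Real
open scoped RealInnerProductSpace NNReal

/-- Lebesgue measure on `[0,1]`. -/
noncomputable def μ01 : MeasureTheory.Measure ℝ := MeasureTheory.volume.restrict (Set.Icc (0:ℝ) 1)

/-- The covariance kernel of the Riemann–Liouville process of index `ρ`: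
`K_ρ(s,t) = ∫₀^{s∧t} (t-r)^{ρ-1/2} (s-r)^{ρ-1/2} dr`. -/
noncomputable def rlKernel (ρ : ℝ) (s t : ℝ) : ℝ :=
  ∫ r in (0:ℝ)..(min s t), (t - r) ^ (ρ - 1/2) * (s - r) ^ (ρ - 1/2)

/-- The minimal `n`-th `L²`-quantization error of an `H`-valued random vector `X`. -/
noncomputable def quantErr {H : Type*} [NormedAddCommGroup H] [InnerProductSpace ℝ H]
    {Ω : Type*} [MeasurableSpace Ω] (P : Measure Ω) (X : Ω → H) (n : ℕ) : ℝ :=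
  sInf { r : ℝ | ∃ α : Finset H, α.Nonempty ∧ α.card ≤ n ∧
    r = (∫ ω, sInf ((fun a => ‖X ω - a‖ ^ 2) '' (α : Set H)) ∂P) ^ (1/2 : ℝ) }

/-- The integral of `exp (-x²/(2v))·exp(...)`-type functions against a centered Gaussian. -/
theorem integral_gaussianReal_zero {v : ℝ} (hv : 0 < v) (f : ℝ → ℝ) :
    ∫ x, f x ∂(gaussianReal 0 v.toNNReal)
      = (√(2 * π * v))⁻¹ * ∫ x, rexp (-x ^ 2 / (2 * v)) * f x := by
  rw [integral_gaussianReal_eq_integral_smul (by simpa using hv), ← integral_const_mul]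
  simp [gaussianPDFReal, hv.le, mul_assoc]

theorem integral_sq_gaussianReal (v : ℝ≥0) : ∫ x, x ^ 2 ∂(gaussianReal 0 v) = v := by
  have h := variance_fun_id_gaussianReal (μ := 0) (v := v)
  rw [variance_eq_integral (by fun_prop)] at h
  simpa using h

theorem integrable_pow_gaussianReal (m : ℝ) (v : ℝ≥0) (k : ℕ) :
    Integrable (fun x => x ^ k) (gaussianReal m v) := by
  have h := (memLp_id_gaussianReal (μ := m) (v := v) k).integrable_norm_pow'
  refine h.mono (by fun_prop) ?_
  filter_upwards with x
  simp

/-- The logarithm of the tilting weight of the Shannon lower bound for a coordinate of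
variance `v` at water level `θ`. -/
noncomputable def logTilt (θ v x : ℝ) : ℝ :=
  if θ < v then (Real.log (v / θ) + x ^ 2 / v) / 2 else x ^ 2 / (2 * θ)

/-- The water-filling function `min v θ + θ log⁺ (v/θ)`. -/
noncomputable def waterFill (θ v : ℝ) : ℝ :=
  if θ < v then θ + θ * Real.log (v / θ) else v

theorem measurable_logTilt (θ v : ℝ) : Measurable (logTilt θ v) := by
  unfold logTilt
  split_ifs <;> fun_prop

theorem integrable_logTilt (θ v : ℝ) (w : ℝ≥0) : Integrable (logTilt θ v) (gaussianReal 0 w) := by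
  unfold logTilt
  have h := integrable_pow_gaussianReal 0 w 2
  split_ifs
  · exact ((integrable_const _).add (h.div_const _)).div_const _
  · exact h.div_const _

theorem integral_logTilt {θ : ℝ} (hθ : 0 < θ) (v : ℝ≥0) :
    ∫ x, logTilt θ v x ∂(gaussianReal 0 v) = waterFill θ v / (2 * θ) := by
  unfold logTilt waterFill
  have h := integrable_pow_gaussianReal 0 v 2
  split_ifs with hv
  · rw [integral_div, integral_add (integrable_const _) (h.div_const _), integral_div,
      integral_sq_gaussianReal]
    have : (v : ℝ) ≠ 0 := (hθ.trans hv).ne'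
    simp
    field_simp
    ring
  · rw [integral_div, integral_sq_gaussianReal]

theorem tilt_integral_le_one {θ : ℝ} (hθ : 0 < θ) (v : ℝ≥0) (a : ℝ) :
    Integrable (fun x => rexp (logTilt θ v x - (x - a) ^ 2 / (2 * θ))) (gaussianReal 0 v) ∧
      ∫ x, rexp (logTilt θ v x - (x - a) ^ 2 / (2 * θ)) ∂(gaussianReal 0 v) ≤ 1 := by
  unfold logTilt
  split_ifs with hv
  · have hv0 : 0 < (v : ℝ) := hθ.trans hv
    have hval : ∫ x, rexp ((Real.log (v / θ) + x ^ 2 / v) / 2 - (x - a) ^ 2 / (2 * θ))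
        ∂(gaussianReal 0 v) = 1 := by
      have h := integral_gaussianReal_zero hv0
        (fun x => rexp ((Real.log (v / θ) + x ^ 2 / v) / 2 - (x - a) ^ 2 / (2 * θ)))
      rw [Real.toNNReal_coe] at h
      rw [h]
      have h2 : ∀ x : ℝ, rexp (-x ^ 2 / (2 * v)) *
          rexp ((Real.log (v / θ) + x ^ 2 / v) / 2 - (x - a) ^ 2 / (2 * θ))
          = √(v / θ) * rexp (-(1 / (2 * θ)) * (x - a) ^ 2) := by
        intro x
        have h3 : √(v / θ) = rexp (Real.log (v / θ) / 2) := by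
          rw [Real.sqrt_eq_rpow, Real.rpow_def_of_pos (by positivity)]
          ring_nf
        rw [h3, ← Real.exp_add, ← Real.exp_add]
        congr 1
        field_simp
        ring
      simp_rw [h2]
      rw [integral_const_mul, integral_sub_right_eq_self (fun x => rexp (-(1 / (2 * θ)) * x ^ 2)),
        integral_gaussian, ← Real.sqrt_inv, ← Real.sqrt_mul (by positivity),
        ← Real.sqrt_mul (by positivity), Real.sqrt_eq_one]
      have := Real.pi_pos.ne'
      field_simp
    refine ⟨?_, hval.le⟩
    by_contra hcon
    rw [integral_undef hcon] at hval
    exact zero_ne_one hval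
  · have h : ∀ x : ℝ, rexp (x ^ 2 / (2 * θ) - (x - a) ^ 2 / (2 * θ))
        = rexp (-a ^ 2 / (2 * θ)) * rexp (a / θ * x) := by
      intro x
      rw [← Real.exp_add]
      congr 1
      field_simp
      ring
    simp_rw [h]
    refine ⟨(integrable_exp_mul_gaussianReal _).const_mul _, ?_⟩
    rw [integral_const_mul]
    have h2 := congrFun (mgf_fun_id_gaussianReal (μ := 0) (v := v)) (a / θ)
    simp only [mgf] at h2
    rw [h2, ← Real.exp_add, Real.exp_le_one_iff]
    have : (v : ℝ) * (a / θ) ^ 2 ≤ θ * (a / θ) ^ 2 := by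
      gcongr
      exact not_lt.mp hv
    have h3 : θ * (a / θ) ^ 2 = a ^ 2 / θ := by field_simp
    have h4 : -a ^ 2 / (2 * θ) = - (a ^ 2 / θ) / 2 := by field_simp
    rw [h4]
    linarith

/-- Shannon-type lower bound for quantizing a Gaussian vector with independent coordinates. -/
theorem waterFill_le_integral {ι : Type*} [Fintype ι] (v : ι → ℝ≥0) {θ : ℝ} (hθ : 0 < θ)
    (α : Finset (ι → ℝ)) {n : ℕ} (hn : α.card ≤ n) (hα : α.Nonempty)
    {Z : (ι → ℝ) → ℝ} (hZi : Integrable Z (Measure.pi fun i => gaussianReal 0 (v i)))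
    (hZ : ∀ x, ∃ a ∈ α, ∑ i, (x i - a i) ^ 2 ≤ Z x) :
    ∑ i, waterFill θ (v i) - 2 * θ * Real.log n
      ≤ ∫ x, Z x ∂(Measure.pi fun i => gaussianReal 0 (v i)) := by
  set ν := Measure.pi fun i => gaussianReal 0 (v i) with hν
  have hn0 : 0 < (n : ℝ) := by exact_mod_cast (Finset.card_pos.mpr hα).trans_le hn
  let G : (ι → ℝ) → (ι → ℝ) → ℝ := fun a x =>
    ∏ i, rexp (logTilt θ (v i) (x i) - (x i - a i) ^ 2 / (2 * θ))
  have hGi : ∀ a, Integrable (G a) ν := fun a =>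
    Integrable.fintype_prod (μ := fun i => gaussianReal 0 (v i))
      (f := fun i x => rexp (logTilt θ (v i) x - (x - a i) ^ 2 / (2 * θ)))
      fun i => (tilt_integral_le_one hθ (v i) (a i)).1
  have hG1 : ∀ a, ∫ x, G a x ∂ν ≤ 1 := by
    intro a
    have h := integral_fintype_prod_eq_prod (𝕜 := ℝ) (μ := fun i => gaussianReal 0 (v i))
      (fun i x => rexp (logTilt θ (v i) x - (x - a i) ^ 2 / (2 * θ)))
    change ∫ x, ∏ i, rexp (logTilt θ (v i) (x i) - (x i - a i) ^ 2 / (2 * θ)) ∂ν ≤ 1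
    rw [hν, h]
    exact Finset.prod_le_one (fun i _ => integral_nonneg fun x => (Real.exp_pos _).le)
      fun i _ => (tilt_integral_le_one hθ (v i) (a i)).2
  have hLi : ∀ i, Integrable (fun x : ι → ℝ => logTilt θ (v i) (x i)) ν := fun i =>
    (measurePreserving_eval (fun i => gaussianReal 0 (v i)) i).integrable_comp_of_integrable
      (integrable_logTilt θ (v i) (v i))
  have hLv : ∀ i, ∫ x : ι → ℝ, logTilt θ (v i) (x i) ∂ν = waterFill θ (v i) / (2 * θ) := by
    intro i
    rw [← integral_logTilt hθ, ← (measurePreserving_eval (fun i => gaussianReal 0 (v i)) i).map_eq,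
      integral_map (measurable_pi_apply i).aemeasurable
        (measurable_logTilt _ _).aestronglyMeasurable]
  have hpt : ∀ x, (∑ i, logTilt θ (v i) (x i)) - Z x / (2 * θ) - Real.log n
      ≤ (∑ a ∈ α, G a x) / n - 1 := by
    intro x
    obtain ⟨a, ha, hle⟩ := hZ x
    have hGa : G a x = rexp ((∑ i, logTilt θ (v i) (x i)) - (∑ i, (x i - a i) ^ 2) / (2 * θ)) := by
      simp only [G]
      rw [← Real.exp_sum, Finset.sum_sub_distrib, Finset.sum_div]
    have hpos : 0 < G a x := by rw [hGa]; exact Real.exp_pos _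
    have h1 : G a x ≤ ∑ a ∈ α, G a x :=
      Finset.single_le_sum (f := fun a => G a x)
        (fun b _ => Finset.prod_nonneg fun i _ => (Real.exp_pos _).le) ha
    have h2 := Real.log_le_sub_one_of_pos (div_pos hpos hn0)
    rw [Real.log_div hpos.ne' hn0.ne', hGa, Real.log_exp, ← hGa] at h2
    have h3 : G a x / n ≤ (∑ a ∈ α, G a x) / n := by gcongr
    have h4 : (∑ i, (x i - a i) ^ 2) / (2 * θ) ≤ Z x / (2 * θ) := by gcongr
    linarith
  have hS : Integrable (fun x : ι → ℝ => ∑ i, logTilt θ (v i) (x i)) ν :=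
    integrable_finsetSum _ fun i _ => hLi i
  have hint := integral_mono (μ := ν) ((hS.sub (hZi.div_const _)).sub (integrable_const _))
    (((integrable_finsetSum α fun a _ => hGi a).div_const _).sub (integrable_const _)) hpt
  simp only [Pi.sub_apply] at hint
  rw [integral_sub (by exact hS.sub (hZi.div_const _)) (integrable_const _),
    integral_sub hS (hZi.div_const _),
    integral_sub ((integrable_finsetSum α fun a _ => hGi a).div_const _) (integrable_const _),
    integral_div, integral_div, integral_finsetSum _ fun i _ => hLi i,
    integral_finsetSum _ fun a _ => hGi a] at hint
  simp only [hLv, integral_const, probReal_univ, smul_eq_mul, one_mul] at hint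
  have h5 : (∑ a ∈ α, ∫ x, G a x ∂ν) / n ≤ 1 := by
    rw [div_le_one hn0]
    calc _ ≤ ∑ a ∈ α, (1 : ℝ) := Finset.sum_le_sum fun a _ => hG1 a
      _ ≤ n := by simpa using hn
  rw [← Finset.sum_div] at hint
  have h6 : (∑ i, waterFill θ (v i)) / (2 * θ) ≤ (∫ x, Z x ∂ν) / (2 * θ) + Real.log n := by linarith
  rw [div_add' _ _ _ (by positivity), div_le_div_iff_of_pos_right (by positivity)] at h6
  linarith

/-- Greedy covering: if a `Q`-random center covers every point of `G` with probability at least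
`p`, then `n` centers can be chosen that leave at most the fraction `(1 - p) ^ n` uncovered. -/
theorem exists_finset_cover {E : Type*} [MeasurableSpace E] (Q τ : Measure E)
    [IsProbabilityMeasure Q] [IsFiniteMeasure τ] {B : Set (E × E)} (hB : MeasurableSet B)
    {G : Set E} (hG : MeasurableSet G) {p : ENNReal} (hp : ∀ x ∈ G, p ≤ Q {y | (x, y) ∈ B})
    (n : ℕ) :
    ∃ α : Finset E, α.card ≤ n ∧
      τ (G ∩ {x | ∀ a ∈ α, (x, a) ∉ B}) ≤ (1 - p) ^ n * τ G := by
  classical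
  induction n with
  | zero => exact ⟨∅, by simp⟩
  | succ n ih =>
    obtain ⟨α, hα, hle⟩ := ih
    have hBy : ∀ y : E, MeasurableSet {x | (x, y) ∈ B} := fun y =>
      (measurable_id.prodMk measurable_const) hB
    set U := G ∩ {x | ∀ a ∈ α, (x, a) ∉ B} with hU
    have hUm : MeasurableSet U := by
      refine hG.inter ?_
      have : {x | ∀ a ∈ α, (x, a) ∉ B} = ⋂ a ∈ α, {x | (x, a) ∈ B}ᶜ := by ext; simp
      rw [this]
      exact Finset.measurableSet_biInter _ fun a _ => (hBy a).compl
    have h1 : ((τ.restrict U).prod Q) B = ∫⁻ y, τ ({x | (x, y) ∈ B} ∩ U) ∂Q := by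
      rw [Measure.prod_apply_symm hB]
      refine lintegral_congr fun y => ?_
      rw [Measure.restrict_apply' hUm]
      rfl
    have h2 : p * τ U ≤ ((τ.restrict U).prod Q) B := by
      rw [Measure.prod_apply hB]
      calc p * τ U = ∫⁻ x in U, p ∂τ := by simp
        _ ≤ ∫⁻ x in U, Q (Prod.mk x ⁻¹' B) ∂τ :=
          setLIntegral_mono' hUm fun x hx => hp x hx.1
    have h3 : ∫⁻ y, τ ({x | (x, y) ∈ B} ∩ U) ∂Q ≠ ⊤ := by
      rw [← h1]
      exact measure_ne_top _ _
    obtain ⟨y, hy⟩ := exists_lintegral_le h3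
    refine ⟨insert y α, (Finset.card_insert_le _ _).trans (by omega), ?_⟩
    have h4 : G ∩ {x | ∀ a ∈ insert y α, (x, a) ∉ B} = U \ ({x | (x, y) ∈ B} ∩ U) := by
      ext x
      simp only [hU, Set.mem_inter_iff, Set.mem_ofPred_eq, Finset.mem_insert, forall_eq_or_imp,
        Set.mem_sdiff]
      tauto
    rw [h4, measure_sdiff Set.inter_subset_right ((hBy y).inter hUm).nullMeasurableSet
      (measure_ne_top _ _)]
    calc τ U - τ ({x | (x, y) ∈ B} ∩ U) ≤ τ U - p * τ U :=
          tsub_le_tsub_left (h2.trans (h1.le.trans hy)) _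
      _ = (1 - p) * τ U := by
        rw [ENNReal.sub_mul (fun _ _ => measure_ne_top _ _), one_mul]
      _ ≤ (1 - p) * ((1 - p) ^ n * τ G) := by gcongr
      _ = (1 - p) ^ (n + 1) * τ G := by ring

theorem pi_withDensity_prod {ι : Type*} [Fintype ι] (ν : ι → Measure ℝ)
    [∀ i, IsProbabilityMeasure (ν i)] {f : ι → ℝ → ENNReal} (hf : ∀ i, Measurable (f i))
    [∀ i, SigmaFinite ((ν i).withDensity (f i))] :
    Measure.pi (fun i => (ν i).withDensity (f i))
      = (Measure.pi ν).withDensity (fun x => ∏ i, f i (x i)) := by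
  refine Measure.pi_eq fun s hs => ?_
  rw [withDensity_apply _ (MeasurableSet.univ_pi hs), ← lintegral_indicator (.univ_pi hs)]
  have h : ∀ x : ι → ℝ, (Set.univ.pi s).indicator (fun x => ∏ i, f i (x i)) x
      = ∏ i, (s i).indicator (f i) (x i) := by
    intro x
    by_cases hx : x ∈ Set.univ.pi s
    · rw [Set.indicator_of_mem hx]
      exact Finset.prod_congr rfl fun i _ => by rw [Set.indicator_of_mem (hx i trivial)]
    · rw [Set.indicator_of_notMem hx]
      simp only [Set.mem_pi, Set.mem_univ, true_imp_iff, not_forall] at hx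
      obtain ⟨i, hi⟩ := hx
      exact (Finset.prod_eq_zero (Finset.mem_univ i) (by simp [hi])).symm
  simp_rw [h]
  have hm : ∀ i, Measurable ((s i).indicator (f i)) := fun i => (hf i).indicator (hs i)
  have h2 := lintegral_prod_eq_prod_lintegral_of_indepFun (μ := Measure.pi ν) Finset.univ
    (fun i (x : ι → ℝ) => (s i).indicator (f i) (x i))
    (iIndepFun_pi (μ := ν) fun i => (hm i).aemeasurable)
    fun i => (hm i).comp (measurable_pi_apply i)
  rw [h2]
  refine Finset.prod_congr rfl fun i _ => ?_
  rw [withDensity_apply _ (hs i), ← lintegral_indicator (hs i)]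
  exact (measurePreserving_eval ν i).lintegral_comp (hm i)

/-- The fourth moment of the standard normal distribution. -/
noncomputable def gaussFour : ℝ := ∫ x, x ^ 4 ∂(gaussianReal 0 1)

theorem gaussFour_nonneg : 0 ≤ gaussFour := integral_nonneg fun x => by positivity

theorem gaussianReal_eq_map_standard (c : ℝ) {s : ℝ} (hs : 0 ≤ s) :
    gaussianReal c (s ^ 2).toNNReal = (gaussianReal 0 1).map (fun y => c + s * y) := by
  have h : (gaussianReal 0 1).map (fun y => c + s * y)
      = ((gaussianReal 0 1).map (fun y => s * y)).map (fun y => c + y) := by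
    rw [Measure.map_map (by fun_prop) (by fun_prop)]
    rfl
  rw [h, gaussianReal_map_const_mul, gaussianReal_map_const_add]
  congr 1
  · ring
  · ext
    simp [hs]

theorem integral_sq_sub_gaussianReal (x c : ℝ) {v : ℝ} (hv : 0 ≤ v) :
    ∫ y, (x - y) ^ 2 ∂(gaussianReal c v.toNNReal) = (x - c) ^ 2 + v := by
  have hs := gaussianReal_eq_map_standard c (Real.sqrt_nonneg v)
  rw [Real.sq_sqrt hv] at hs
  rw [hs, integral_map (by fun_prop) (by fun_prop)]
  have h : ∀ y : ℝ, (x - (c + √v * y)) ^ 2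
      = (x - c) ^ 2 + (-(2 * (x - c) * √v) * y + v * y ^ 2) := by
    intro y
    have := Real.sq_sqrt hv
    linear_combination y ^ 2 * this
  simp_rw [h]
  have h1 : Integrable (fun y : ℝ => y) (gaussianReal 0 1) := by
    simpa using integrable_pow_gaussianReal 0 1 1
  have h2 := integrable_pow_gaussianReal 0 1 2
  rw [integral_add (integrable_const _) (by exact (h1.const_mul _).add (h2.const_mul _)),
    integral_add (h1.const_mul _) (h2.const_mul _), integral_const_mul, integral_const_mul,
    integral_id_gaussianReal, integral_sq_gaussianReal]
  simp

theorem memLp_sq_sub_gaussianReal (x c : ℝ) (v : ℝ≥0) :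
    MemLp (fun y => (x - y) ^ 2) 2 (gaussianReal c v) := by
  rw [memLp_two_iff_integrable_sq (by fun_prop)]
  have h : ∀ y : ℝ, ((x - y) ^ 2) ^ 2 = x ^ 4 - 4 * x ^ 3 * y ^ 1 + 6 * x ^ 2 * y ^ 2
      - 4 * x * y ^ 3 + y ^ 4 := fun y => by ring
  simp_rw [h]
  have hk := fun k => integrable_pow_gaussianReal c v k
  exact ((((integrable_const _).sub ((hk 1).const_mul _)).add ((hk 2).const_mul _)).sub
    ((hk 3).const_mul _)).add (hk 4)

theorem variance_sq_sub_gaussianReal_le (x c : ℝ) {v : ℝ} (hv : 0 ≤ v) :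
    Var[fun y => (x - y) ^ 2; gaussianReal c v.toNNReal]
      ≤ 8 * (x - c) ^ 2 * v + 2 * gaussFour * v ^ 2 := by
  rw [variance_eq_integral (by fun_prop), integral_sq_sub_gaussianReal x c hv]
  have hs := gaussianReal_eq_map_standard c (Real.sqrt_nonneg v)
  rw [Real.sq_sqrt hv] at hs
  rw [hs, integral_map (by fun_prop) (by fun_prop)]
  have h2 := integrable_pow_gaussianReal 0 1 2
  have h4 := integrable_pow_gaussianReal 0 1 4
  have hle : ∀ y : ℝ, ((x - (c + √v * y)) ^ 2 - ((x - c) ^ 2 + v)) ^ 2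
      ≤ 8 * (x - c) ^ 2 * v * y ^ 2 + (2 * v ^ 2 * y ^ 4 + (- (4 * v ^ 2) * y ^ 2 + 2 * v ^ 2)) := by
    intro y
    have hq := Real.sq_sqrt hv
    have e1 : (x - (c + √v * y)) ^ 2 - ((x - c) ^ 2 + v)
        = -(2 * (x - c) * √v * y) + v * (y ^ 2 - 1) := by
      linear_combination y ^ 2 * hq
    have e2 : (2 * (x - c) * √v * y) ^ 2 = 4 * (x - c) ^ 2 * v * y ^ 2 := by
      linear_combination 4 * (x - c) ^ 2 * y ^ 2 * hq
    rw [e1]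
    nlinarith [sq_nonneg (2 * (x - c) * √v * y + v * (y ^ 2 - 1))]
  refine (integral_mono_of_nonneg (ae_of_all _ fun y => sq_nonneg _) ?_ (ae_of_all _ hle)).trans ?_
  · exact (h2.const_mul _).add ((h4.const_mul _).add ((h2.const_mul _).add (integrable_const _)))
  · rw [integral_add (h2.const_mul _)
        (by exact (h4.const_mul _).add ((h2.const_mul _).add (integrable_const _))),
      integral_add (h4.const_mul _) (by exact (h2.const_mul _).add (integrable_const _)),
      integral_add (h2.const_mul _) (integrable_const _), integral_const_mul, integral_const_mul,
      integral_const_mul, integral_sq_gaussianReal]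
    simp only [integral_const, probReal_univ, smul_eq_mul, one_mul, NNReal.coe_one, mul_one]
    change _ + (2 * v ^ 2 * gaussFour + _) ≤ _
    nlinarith [sq_nonneg v]

/-- Conditioning a Gaussian reproduction letter of variance `σ - θ` on the source letter `x`. -/
theorem gaussianReal_tilt_eq {θ σ : ℝ} (hθ : 0 < θ) (hσ : θ < σ) (x : ℝ) :
    gaussianReal ((1 - θ / σ) * x) (θ * (1 - θ / σ)).toNNReal
      = (gaussianReal 0 (σ - θ).toNNReal).withDensity (fun y => ENNReal.ofReal
          (rexp ((Real.log (σ / θ) + x ^ 2 / σ) / 2 - (x - y) ^ 2 / (2 * θ)))) := by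
  have hσ0 : 0 < σ := hθ.trans hσ
  have hd : 0 < σ - θ := sub_pos.mpr hσ
  have hw : 0 < 1 - θ / σ := by rw [sub_pos, div_lt_one hσ0]; exact hσ
  have hv : 0 < θ * (1 - θ / σ) := mul_pos hθ hw
  rw [gaussianReal_of_var_ne_zero _ (by simpa using hv),
    gaussianReal_of_var_ne_zero _ (by simpa using hd),
    ← withDensity_mul _ (by fun_prop) (by fun_prop)]
  congr 1
  funext y
  simp only [gaussianPDF, Pi.mul_apply, gaussianPDFReal]
  rw [← ENNReal.ofReal_mul (by positivity), Real.coe_toNNReal _ hv.le, Real.coe_toNNReal _ hd.le]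
  congr 1
  have h3 : √(σ / θ) = rexp (Real.log (σ / θ) / 2) := by
    rw [Real.sqrt_eq_rpow, Real.rpow_def_of_pos (by positivity)]
    ring_nf
  have h4 : rexp ((Real.log (σ / θ) + x ^ 2 / σ) / 2 - (x - y) ^ 2 / (2 * θ))
      = √(σ / θ) * rexp (x ^ 2 / (2 * σ) - (x - y) ^ 2 / (2 * θ)) := by
    rw [h3, ← Real.exp_add]
    congr 1
    field_simp
    ring
  have h5 : (√(2 * π * (θ * (1 - θ / σ))))⁻¹ = (√(2 * π * (σ - θ)))⁻¹ * √(σ / θ) := by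
    rw [← Real.sqrt_inv, ← Real.sqrt_inv, ← Real.sqrt_mul (by positivity)]
    congr 1
    have := Real.pi_pos.ne'
    have hwn : σ - θ ≠ 0 := hd.ne'
    field_simp
  rw [h4, h5]
  have h6 : rexp (-(y - (1 - θ / σ) * x) ^ 2 / (2 * (θ * (1 - θ / σ))))
      = rexp (-(y - 0) ^ 2 / (2 * (σ - θ))) * rexp (x ^ 2 / (2 * σ) - (x - y) ^ 2 / (2 * θ)) := by
    rw [← Real.exp_add]
    congr 1
    have hwn : σ - θ ≠ 0 := hd.ne'
    field_simp
    ring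
  rw [h6]
  ring

/-- A random Gaussian reproduction word lies close to a typical source word with probability
exponentially close to the rate. -/
theorem typical_ball_prob {ι : Type*} [Fintype ι] {θ δ m : ℝ} {σ : ι → ℝ} (hθ : 0 < θ)
    (hσ : ∀ i, θ < σ i) (hm : (Fintype.card ι : ℝ) ≤ m) (hm0 : 0 < m) (hδ : 0 < δ) (hδ1 : δ ≤ 1)
    (hmδ : 2 * (16 + 2 * gaussFour) ≤ m * δ ^ 2) (x : ι → ℝ)
    (h1 : ∑ i, θ / σ i * (x i ^ 2 / σ i - 1) ≤ δ * m)
    (h2 : ∑ i, (1 - θ / σ i) * (x i ^ 2 / σ i - 1) ≤ δ * m) :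
    ENNReal.ofReal (1 / 2 * rexp (-(∑ i, Real.log (σ i / θ) / 2 + δ * m)))
      ≤ (Measure.pi fun i => gaussianReal 0 (σ i - θ).toNNReal)
        {y | ∑ i, (x i - y i) ^ 2 ≤ θ * (Fintype.card ι + 2 * δ * m)} := by
  have hσ0 : ∀ i, 0 < σ i := fun i => hθ.trans (hσ i)
  have hw0 : ∀ i, 0 < θ / σ i := fun i => div_pos hθ (hσ0 i)
  have hw1 : ∀ i, θ / σ i < 1 := fun i => by rw [div_lt_one (hσ0 i)]; exact hσ i
  have hg := gaussFour_nonneg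
  set Q := Measure.pi fun i => gaussianReal 0 (σ i - θ).toNNReal with hQ
  set f : ι → ℝ → ENNReal := fun i y => ENNReal.ofReal
    (rexp ((Real.log (σ i / θ) + x i ^ 2 / σ i) / 2 - (x i - y) ^ 2 / (2 * θ))) with hf
  set κ : ι → Measure ℝ := fun i =>
    gaussianReal ((1 - θ / σ i) * x i) (θ * (1 - θ / σ i)).toNNReal with hκ
  have hκf : ∀ i, κ i = (gaussianReal 0 (σ i - θ).toNNReal).withDensity (f i) := fun i =>
    gaussianReal_tilt_eq hθ (hσ i) (x i)
  have hprob : ∀ i, IsProbabilityMeasure (κ i) := fun i => by rw [hκ]; infer_instance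
  have : ∀ i, SigmaFinite ((gaussianReal 0 (σ i - θ).toNNReal).withDensity (f i)) := fun i => by
    rw [← hκf]; infer_instance
  have hfm : ∀ i, Measurable (f i) := fun i => by rw [hf]; fun_prop
  have hpi : Measure.pi κ = Q.withDensity (fun y => ∏ i, f i (y i)) := by
    rw [hQ, ← pi_withDensity_prod _ hfm]
    congr 1
    funext i
    exact hκf i
  set S := θ * (Fintype.card ι + ∑ i, θ / σ i * (x i ^ 2 / σ i - 1)) with hS
  set D : ι → (ι → ℝ) → ℝ := fun i y => (x i - y i) ^ 2 with hD
  have hv : ∀ i, 0 ≤ θ * (1 - θ / σ i) := fun i => mul_nonneg hθ.le (by linarith [hw1 i])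
  have hmem : ∀ i, MemLp (D i) 2 (Measure.pi κ) := fun i =>
    (memLp_sq_sub_gaussianReal _ _ _).comp_measurePreserving (measurePreserving_eval κ i)
  have hmean : ∫ y, ∑ i, D i y ∂(Measure.pi κ) = S := by
    rw [integral_finsetSum _ fun i _ => (hmem i).integrable (by norm_num)]
    have : ∀ i, ∫ y, D i y ∂(Measure.pi κ) = θ * (1 + θ / σ i * (x i ^ 2 / σ i - 1)) := by
      intro i
      have := integral_comp_eval (μ := κ) (i := i) (f := fun y => (x i - y) ^ 2) (by fun_prop)
      rw [this, integral_sq_sub_gaussianReal _ _ (hv i)]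
      have := (hσ0 i).ne'
      field_simp
      ring
    simp_rw [this, hS, ← Finset.mul_sum, Finset.sum_add_distrib]
    simp
  have hvar : Var[fun y => ∑ i, D i y; Measure.pi κ] ≤ θ ^ 2 * m * (16 + 2 * gaussFour) := by
    have hsum := variance_sum_pi (μ := κ) (X := fun i y => (x i - y) ^ 2)
      fun i => memLp_sq_sub_gaussianReal _ _ _
    have heq : (fun y => ∑ i, D i y) = ∑ i, fun y : ι → ℝ => (x i - y i) ^ 2 := by
      funext y; simp [hD]
    rw [heq, hsum]
    have hi : ∀ i, Var[fun y => (x i - y) ^ 2; κ i]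
        ≤ θ ^ 2 * (8 * (θ / σ i * (x i ^ 2 / σ i - 1)) + 8 + 2 * gaussFour) := by
      intro i
      refine (variance_sq_sub_gaussianReal_le _ _ (hv i)).trans ?_
      have e : (x i - (1 - θ / σ i) * x i) ^ 2 = θ * (θ / σ i * (x i ^ 2 / σ i)) := by
        have := (hσ0 i).ne'
        field_simp
        ring
      rw [e]
      have a1 : 0 ≤ θ / σ i * (x i ^ 2 / σ i) := mul_nonneg (hw0 i).le
        (div_nonneg (sq_nonneg _) (hσ0 i).le)
      have a2 := hw0 i
      have a3 := hw1 i
      generalize θ / σ i = w at *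
      generalize x i ^ 2 / σ i = z at *
      have b1 : w * z * (1 - w) ≤ w * z := by nlinarith
      have b2 : (1 - w) ^ 2 ≤ 1 := by nlinarith
      have b3 : gaussFour * (1 - w) ^ 2 ≤ gaussFour := by nlinarith
      have : 8 * (θ * (w * z)) * (θ * (1 - w)) + 2 * gaussFour * (θ * (1 - w)) ^ 2
          = θ ^ 2 * (8 * (w * z * (1 - w)) + 2 * (gaussFour * (1 - w) ^ 2)) := by ring
      rw [this]
      gcongr
      nlinarith
    refine (Finset.sum_le_sum fun i _ => hi i).trans ?_
    rw [← Finset.mul_sum, Finset.sum_add_distrib, Finset.sum_add_distrib, ← Finset.mul_sum]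
    simp only [Finset.sum_const, Finset.card_univ, nsmul_eq_mul]
    rw [mul_assoc]
    gcongr
    have : (Fintype.card ι : ℝ) * (2 * gaussFour) ≤ m * (2 * gaussFour) := by gcongr
    nlinarith
  set T : Set (ι → ℝ) := {y | θ * δ * m ≤ |∑ i, D i y - S|} with hT
  have hTm : MeasurableSet T := by
    refine measurableSet_le measurable_const ?_
    simp only [hD]
    fun_prop
  have hdev : 0 < θ * δ * m := by positivity
  have hcheb : (Measure.pi κ) T ≤ ENNReal.ofReal (1 / 2) := by
    have := meas_ge_le_variance_div_sq (memLp_finsetSum Finset.univ fun i _ => hmem i) hdev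
    rw [hmean] at this
    refine this.trans (ENNReal.ofReal_le_ofReal ?_)
    rw [div_le_div_iff₀ (by positivity) (by norm_num)]
    nlinarith [mul_le_mul_of_nonneg_left hmδ (by positivity : 0 ≤ θ ^ 2 * m)]
  have hTc : ENNReal.ofReal (1 / 2) ≤ (Measure.pi κ) Tᶜ := by
    rw [prob_compl_eq_one_sub hTm]
    refine le_trans (le_of_eq ?_) (tsub_le_tsub_left hcheb 1)
    rw [← ENNReal.ofReal_one, ← ENNReal.ofReal_sub _ (by norm_num)]
    norm_num
  set r := ∑ i, Real.log (σ i / θ) / 2 + δ * m with hr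
  have hdens : ∀ y ∈ Tᶜ, ∏ i, f i (y i) ≤ ENNReal.ofReal (rexp r) := by
    intro y hy
    have hy' : |∑ i, D i y - S| < θ * δ * m := by simpa [hT] using hy
    have hlow := (abs_lt.mp hy').1
    simp only [hf]
    rw [← ENNReal.ofReal_prod_of_nonneg fun i _ => (Real.exp_pos _).le, ← Real.exp_sum]
    refine ENNReal.ofReal_le_ofReal (Real.exp_le_exp.mpr ?_)
    have e1 : ∑ i, ((Real.log (σ i / θ) + x i ^ 2 / σ i) / 2 - (x i - y i) ^ 2 / (2 * θ))
        = ∑ i, Real.log (σ i / θ) / 2 + (∑ i, x i ^ 2 / σ i) / 2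
          - (∑ i, D i y) / (2 * θ) := by
      rw [Finset.sum_sub_distrib, Finset.sum_div, Finset.sum_div, ← Finset.sum_add_distrib]
      congr 1
      exact Finset.sum_congr rfl fun i _ => by ring
    have e2 : (S - θ * δ * m) / (2 * θ) ≤ (∑ i, D i y) / (2 * θ) := by
      gcongr
      linarith
    have e3 : (S - θ * δ * m) / (2 * θ)
        = (Fintype.card ι + ∑ i, θ / σ i * (x i ^ 2 / σ i - 1)) / 2 - δ * m / 2 := by
      rw [hS]
      field_simp
    have e4 : ∑ i, (1 - θ / σ i) * (x i ^ 2 / σ i - 1)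
        = ∑ i, x i ^ 2 / σ i - Fintype.card ι - ∑ i, θ / σ i * (x i ^ 2 / σ i - 1) := by
      have : (Fintype.card ι : ℝ) = ∑ i : ι, 1 := by simp
      rw [this, ← Finset.sum_sub_distrib, ← Finset.sum_sub_distrib]
      exact Finset.sum_congr rfl fun i _ => by ring
    rw [e1, hr]
    linarith
  have hle : ENNReal.ofReal (1 / 2) ≤ ENNReal.ofReal (rexp r) * Q Tᶜ := by
    refine hTc.trans ?_
    rw [hpi, withDensity_apply _ hTm.compl]
    refine (setLIntegral_mono' hTm.compl hdens).trans ?_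
    simp
  have hsub : Tᶜ ⊆ {y | ∑ i, (x i - y i) ^ 2 ≤ θ * (Fintype.card ι + 2 * δ * m)} := by
    intro y hy
    have hy' : |∑ i, D i y - S| < θ * δ * m := by simpa [hT] using hy
    have hup := (abs_lt.mp hy').2
    change ∑ i, D i y ≤ _
    have : θ * ∑ i, θ / σ i * (x i ^ 2 / σ i - 1) ≤ θ * (δ * m) := by gcongr
    rw [hS] at hup
    nlinarith
  refine le_trans ?_ (measure_mono hsub)
  calc ENNReal.ofReal (1 / 2 * rexp (-r))
      = ENNReal.ofReal (rexp (-r)) * ENNReal.ofReal (1 / 2) := by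
        rw [mul_comm, ENNReal.ofReal_mul (Real.exp_pos _).le]
    _ ≤ ENNReal.ofReal (rexp (-r)) * (ENNReal.ofReal (rexp r) * Q Tᶜ) := by gcongr
    _ = Q Tᶜ := by
        rw [← mul_assoc, ← ENNReal.ofReal_mul (Real.exp_pos _).le, ← Real.exp_add]
        simp

theorem exp_sq_gaussianReal {σ u : ℝ} (hσ : 0 < σ) (hu0 : 0 ≤ u) (hu : u ≤ 1 / 4) :
    Integrable (fun x => rexp (u * (x ^ 2 / σ))) (gaussianReal 0 σ.toNNReal) ∧
      ∫ x, rexp (u * (x ^ 2 / σ)) ∂(gaussianReal 0 σ.toNNReal) ≤ rexp (u + 2 * u ^ 2) := by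
  have hu1 : 0 < 1 - 2 * u := by linarith
  have hval : ∫ x, rexp (u * (x ^ 2 / σ)) ∂(gaussianReal 0 σ.toNNReal) = √(1 / (1 - 2 * u)) := by
    rw [integral_gaussianReal_zero hσ]
    have : ∀ x : ℝ, rexp (-x ^ 2 / (2 * σ)) * rexp (u * (x ^ 2 / σ))
        = rexp (-((1 - 2 * u) / (2 * σ)) * x ^ 2) := by
      intro x
      rw [← Real.exp_add]
      congr 1
      field_simp
      ring
    simp_rw [this]
    rw [integral_gaussian, ← Real.sqrt_inv, ← Real.sqrt_mul (by positivity)]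
    congr 1
    have := Real.pi_pos.ne'
    field_simp
  refine ⟨?_, ?_⟩
  · by_contra h
    rw [integral_undef h] at hval
    have : 0 < √(1 / (1 - 2 * u)) := by positivity
    linarith
  · rw [hval, Real.sqrt_le_left (Real.exp_pos _).le, div_le_iff₀ hu1, ← Real.exp_nat_mul]
    have h := Real.quadratic_le_exp_of_nonneg (x := (2 : ℕ) * (u + 2 * u ^ 2)) (by positivity)
    refine le_trans ?_ (mul_le_mul_of_nonneg_right h hu1.le)
    push_cast
    have h1 : 0 ≤ u ^ 2 * ((1 / 4 - u) * (1 + 4 * u)) := by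
      have := sub_nonneg.mpr hu
      positivity
    have h2 : 0 ≤ u ^ 4 * (1 - 2 * u) := by positivity
    nlinarith

theorem integrable_sq_pi_gaussianReal {ι : Type*} [Fintype ι] (v : ι → ℝ≥0) (k : ι) :
    Integrable (fun x : ι → ℝ => x k ^ 2) (Measure.pi fun i => gaussianReal 0 (v i)) :=
  integrable_comp_eval (μ := fun i => gaussianReal 0 (v i)) (i := k) (f := fun y : ℝ => y ^ 2)
    (integrable_pow_gaussianReal 0 (v k) 2)

/-- Second moment of a coordinate on the event of a large deviation of a weighted chi-square. -/
theorem setIntegral_sq_chiSquare_le {ι : Type*} [Fintype ι] {δ m : ℝ} {σ c : ι → ℝ}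
    (hσ : ∀ i, 0 < σ i) (hm : (Fintype.card ι : ℝ) ≤ m) (hδ : 0 < δ) (hδ1 : δ ≤ 1)
    (hc0 : ∀ i, 0 ≤ c i) (hc1 : ∀ i, c i ≤ 1) (k : ι) :
    ∫ x in {x | δ * m < ∑ i, c i * (x i ^ 2 / σ i - 1)}, x k ^ 2
        ∂(Measure.pi fun i => gaussianReal 0 (σ i).toNNReal)
      ≤ 8 * σ k / δ * rexp (1 - 3 * δ ^ 2 * m / 32) := by
  classical
  set ν := Measure.pi fun i => gaussianReal 0 (σ i).toNNReal with hν
  set s := δ / 8 with hs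
  have hs0 : 0 < s := by positivity
  set u : ι → ℝ := fun i => s * c i + if i = k then s else 0 with hu
  have hu0 : ∀ i, 0 ≤ u i := fun i => by
    have := mul_nonneg hs0.le (hc0 i)
    simp only [hu]
    split_ifs <;> linarith
  have hu1 : ∀ i, u i ≤ 1 / 4 := fun i => by
    have := mul_le_mul_of_nonneg_left (hc1 i) hs0.le
    simp only [hu]
    split_ifs <;> linarith
  have husq : ∀ i, u i + 2 * u i ^ 2 - s * c i ≤ 2 * s ^ 2 + if i = k then s + 6 * s ^ 2 else 0 := by
    intro i
    have h0 := hc0 i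
    have h1 := hc1 i
    have h2 : s * c i ≤ s := by nlinarith
    have h3 : 0 ≤ s * c i := mul_nonneg hs0.le h0
    simp only [hu]
    split_ifs <;> nlinarith
  set F : (ι → ℝ) → ℝ := fun x => (8 * σ k / δ) * (rexp (-(s * δ * m)) *
    ∏ i, (rexp (-(s * c i)) * rexp (u i * (x i ^ 2 / σ i)))) with hF
  have hFi : Integrable F ν := by
    refine Integrable.const_mul (Integrable.const_mul ?_ _) _
    exact Integrable.fintype_prod fun i =>
      ((exp_sq_gaussianReal (hσ i) (hu0 i) (hu1 i)).1.const_mul _)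
  have hF0 : ∀ x, 0 ≤ F x := fun x => by
    have := hσ k
    simp only [hF]
    positivity
  have hS : MeasurableSet {x : ι → ℝ | δ * m < ∑ i, c i * (x i ^ 2 / σ i - 1)} :=
    measurableSet_lt measurable_const (by fun_prop)
  have hdom : ∀ x ∈ {x : ι → ℝ | δ * m < ∑ i, c i * (x i ^ 2 / σ i - 1)}, x k ^ 2 ≤ F x := by
    intro x hx
    have hx' : δ * m < ∑ i, c i * (x i ^ 2 / σ i - 1) := hx
    have hk := hσ k
    have e1 : F x = (8 * σ k / δ) * (rexp (s * (x k ^ 2 / σ k))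
        * rexp (s * (∑ i, c i * (x i ^ 2 / σ i - 1) - δ * m))) := by
      simp only [hF]
      simp_rw [← Real.exp_add]
      rw [← Real.exp_sum, ← Real.exp_add]
      congr 2
      have : ∀ i, -(s * c i) + u i * (x i ^ 2 / σ i) = s * (c i * (x i ^ 2 / σ i - 1))
          + if i = k then s * (x i ^ 2 / σ i) else 0 := by
        intro i
        simp only [hu]
        split_ifs <;> ring
      simp_rw [this]
      rw [Finset.sum_add_distrib, ← Finset.mul_sum]
      simp
      ring
    rw [e1]
    have e2 : s * (x k ^ 2 / σ k) ≤ rexp (s * (x k ^ 2 / σ k)) := by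
      linarith [Real.add_one_le_exp (s * (x k ^ 2 / σ k))]
    have e3 : 1 ≤ rexp (s * (∑ i, c i * (x i ^ 2 / σ i - 1) - δ * m)) :=
      Real.one_le_exp (mul_nonneg hs0.le (by linarith))
    have e4 : x k ^ 2 = 8 * σ k / δ * (s * (x k ^ 2 / σ k) * 1) := by
      rw [hs]
      field_simp
    nth_rewrite 1 [e4]
    gcongr
  have hxk : Integrable (fun x : ι → ℝ => x k ^ 2) ν :=
    integrable_sq_pi_gaussianReal _ k
  calc ∫ x in {x | δ * m < ∑ i, c i * (x i ^ 2 / σ i - 1)}, x k ^ 2 ∂ν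
      ≤ ∫ x in {x | δ * m < ∑ i, c i * (x i ^ 2 / σ i - 1)}, F x ∂ν :=
        setIntegral_mono_on hxk.integrableOn hFi.integrableOn hS hdom
    _ ≤ ∫ x, F x ∂ν := setIntegral_le_integral hFi (ae_of_all _ hF0)
    _ = (8 * σ k / δ) * (rexp (-(s * δ * m)) * ∏ i, (rexp (-(s * c i)) *
          ∫ x, rexp (u i * (x ^ 2 / σ i)) ∂(gaussianReal 0 (σ i).toNNReal))) := by
        simp only [hF]
        rw [integral_const_mul, integral_const_mul, hν,
          integral_fintype_prod_eq_prod (fun i y => rexp (-(s * c i)) * rexp (u i * (y ^ 2 / σ i)))]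
        simp_rw [integral_const_mul]
    _ ≤ (8 * σ k / δ) * (rexp (-(s * δ * m)) * ∏ i, rexp (2 * s ^ 2 + if i = k then s + 6 * s ^ 2
          else 0)) := by
        have hk := hσ k
        gcongr with i
        refine (mul_le_mul_of_nonneg_left (exp_sq_gaussianReal (hσ i) (hu0 i) (hu1 i)).2
          (Real.exp_pos _).le).trans ?_
        rw [← Real.exp_add]
        exact Real.exp_le_exp.mpr (by linarith [husq i])
    _ ≤ 8 * σ k / δ * rexp (1 - 3 * δ ^ 2 * m / 32) := by
        have hk := hσ k
        rw [← Real.exp_sum, ← Real.exp_add]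
        gcongr
        rw [Finset.sum_add_distrib]
        simp only [Finset.sum_const, Finset.card_univ, nsmul_eq_mul, Finset.sum_ite_eq',
          Finset.mem_univ, if_true]
        have : (Fintype.card ι : ℝ) * (2 * s ^ 2) ≤ m * (2 * s ^ 2) := by gcongr
        rw [hs] at *
        nlinarith

/-- Random coding bound for a Gaussian vector with independent coordinates of variance above the
water level `θ`. -/
theorem exists_codebook {ι : Type*} [Fintype ι] {θ δ m : ℝ} {σ : ι → ℝ} (hθ : 0 < θ)
    (hσ : ∀ i, θ < σ i) (hm : (Fintype.card ι : ℝ) ≤ m) (hm0 : 0 < m) (hδ : 0 < δ) (hδ1 : δ ≤ 1)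
    (hmδ : 2 * (16 + 2 * gaussFour) ≤ m * δ ^ 2) {n : ℕ}
    (hn : rexp (∑ i, Real.log (σ i / θ) / 2 + 2 * δ * m) ≤ n) :
    ∃ α : Finset (ι → ℝ), 0 ∈ α ∧ α.card ≤ n + 1 ∧ ∀ Z : (ι → ℝ) → ℝ, (∀ x, 0 ≤ Z x) →
      (∀ x, ∀ a ∈ α, Z x ≤ ∑ i, (x i - a i) ^ 2) →
      ∫ x, Z x ∂(Measure.pi fun i => gaussianReal 0 (σ i).toNNReal)
        ≤ θ * (Fintype.card ι + 2 * δ * m) + (∑ i, σ i) *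
          (2 * (8 / δ * rexp (1 - 3 * δ ^ 2 * m / 32)) + rexp (-(rexp (δ * m) / 2))) := by
  classical
  set ν := Measure.pi fun i => gaussianReal 0 (σ i).toNNReal with hν
  have hσ0 : ∀ i, 0 < σ i := fun i => hθ.trans (hσ i)
  have hw0 : ∀ i, 0 < θ / σ i := fun i => div_pos hθ (hσ0 i)
  have hw1 : ∀ i, θ / σ i < 1 := fun i => by rw [div_lt_one (hσ0 i)]; exact hσ i
  set S₁ : Set (ι → ℝ) := {x | δ * m < ∑ i, θ / σ i * (x i ^ 2 / σ i - 1)} with hS₁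
  set S₂ : Set (ι → ℝ) := {x | δ * m < ∑ i, (1 - θ / σ i) * (x i ^ 2 / σ i - 1)} with hS₂
  have hS₁m : MeasurableSet S₁ := measurableSet_lt measurable_const (by fun_prop)
  have hS₂m : MeasurableSet S₂ := measurableSet_lt measurable_const (by fun_prop)
  set N : (ι → ℝ) → ℝ := fun x => ∑ i, x i ^ 2 with hN
  have hN0 : ∀ x, 0 ≤ N x := fun x => Finset.sum_nonneg fun i _ => sq_nonneg _
  have hxi : ∀ i, Integrable (fun x : ι → ℝ => x i ^ 2) ν := fun i =>
    integrable_sq_pi_gaussianReal _ i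
  have hNi : Integrable N ν := integrable_finsetSum _ fun i _ => hxi i
  have hNint : ∫ x, N x ∂ν = ∑ i, σ i := by
    rw [integral_finsetSum _ fun i _ => hxi i]
    refine Finset.sum_congr rfl fun i _ => ?_
    have := integral_comp_eval (μ := fun i => gaussianReal 0 (σ i).toNNReal) (i := i)
      (f := fun y => y ^ 2) (by fun_prop)
    rw [hν, this, integral_sq_gaussianReal, Real.coe_toNNReal _ (hσ0 i).le]
  have hsum0 : 0 ≤ ∑ i, σ i := Finset.sum_nonneg fun i _ => (hσ0 i).le
  set τ := ν.withDensity (fun x => ENNReal.ofReal (N x)) with hτ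
  have hτfin : IsFiniteMeasure τ := isFiniteMeasure_withDensity_ofReal hNi.2
  have hτtoReal : ∀ s, MeasurableSet s → (τ s).toReal = ∫ x in s, N x ∂ν := by
    intro s hs
    rw [hτ, withDensity_apply _ hs,
      ← ofReal_integral_eq_lintegral_ofReal hNi.integrableOn (ae_of_all _ hN0),
      ENNReal.toReal_ofReal (integral_nonneg hN0)]
  set s₀ := θ * (Fintype.card ι + 2 * δ * m) with hs₀
  have hs₀0 : 0 ≤ s₀ := by positivity
  set B : Set ((ι → ℝ) × (ι → ℝ)) := {q | ∑ i, (q.1 i - q.2 i) ^ 2 ≤ s₀} with hB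
  have hBm : MeasurableSet B := measurableSet_le (by fun_prop) measurable_const
  set G : Set (ι → ℝ) := S₁ᶜ ∩ S₂ᶜ with hG
  have hGm : MeasurableSet G := hS₁m.compl.inter hS₂m.compl
  set R := ∑ i, Real.log (σ i / θ) / 2 with hR
  set p := 1 / 2 * rexp (-(R + δ * m)) with hp
  have hp0 : 0 < p := by positivity
  have hcov : ∀ x ∈ G, ENNReal.ofReal p ≤ (Measure.pi fun i => gaussianReal 0 (σ i - θ).toNNReal)
      {y | (x, y) ∈ B} := by
    intro x hx
    exact typical_ball_prob hθ hσ hm hm0 hδ hδ1 hmδ x (not_lt.mp hx.1) (not_lt.mp hx.2)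
  obtain ⟨α, hαn, hα⟩ := exists_finset_cover _ τ hBm hGm hcov n
  set U := G ∩ {x | ∀ a ∈ α, (x, a) ∉ B} with hU
  have hUm : MeasurableSet U := by
    refine hGm.inter ?_
    have : {x | ∀ a ∈ α, (x, a) ∉ B} = ⋂ a ∈ α, {x | (x, a) ∈ B}ᶜ := by ext; simp
    rw [this]
    exact Finset.measurableSet_biInter _ fun a _ =>
      ((measurable_id.prodMk measurable_const) hBm).compl
  refine ⟨insert 0 α, Finset.mem_insert_self _ _, (Finset.card_insert_le _ _).trans (by omega),
    fun Z hZ0 hZ => ?_⟩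
  have hUle : ∫ x in U, N x ∂ν ≤ rexp (-(rexp (δ * m) / 2)) * ∑ i, σ i := by
    rw [← hτtoReal U hUm]
    have hfin : (1 - ENNReal.ofReal p) ^ n * τ G ≠ ⊤ :=
      ENNReal.mul_ne_top (ENNReal.pow_ne_top (ENNReal.sub_ne_top ENNReal.one_ne_top))
        (measure_ne_top _ _)
    refine (ENNReal.toReal_mono hfin hα).trans ?_
    rw [ENNReal.toReal_mul, ENNReal.toReal_pow, hτtoReal G hGm]
    have h1 : (1 - ENNReal.ofReal p).toReal ≤ rexp (-p) := by
      rw [← ENNReal.ofReal_one, ← ENNReal.ofReal_sub _ hp0.le]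
      exact ENNReal.toReal_le_of_le_ofReal (Real.exp_pos _).le
        (ENNReal.ofReal_le_ofReal (by linarith [Real.add_one_le_exp (-p)]))
    have h2 : ∫ x in G, N x ∂ν ≤ ∑ i, σ i := by
      rw [← hNint]
      exact setIntegral_le_integral hNi (ae_of_all _ hN0)
    have h3 : rexp (-p) ^ n ≤ rexp (-(rexp (δ * m) / 2)) := by
      rw [← Real.exp_nat_mul]
      refine Real.exp_le_exp.mpr ?_
      have h4 : rexp (δ * m) = rexp (R + 2 * δ * m) * rexp (-(R + δ * m)) := by
        rw [← Real.exp_add]; ring_nf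
      have h5 := mul_le_mul_of_nonneg_right hn (Real.exp_pos (-(R + δ * m))).le
      rw [hp]
      nlinarith
    calc (1 - ENNReal.ofReal p).toReal ^ n * ∫ x in G, N x ∂ν
        ≤ rexp (-p) ^ n * ∑ i, σ i := by
          gcongr
      _ ≤ _ := by gcongr
  have hSle : ∀ c : ι → ℝ, (∀ i, 0 ≤ c i) → (∀ i, c i ≤ 1) →
      ∫ x in {x | δ * m < ∑ i, c i * (x i ^ 2 / σ i - 1)}, N x ∂ν
        ≤ (∑ i, σ i) * (8 / δ * rexp (1 - 3 * δ ^ 2 * m / 32)) := by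
    intro c hc0 hc1
    rw [integral_finsetSum _ fun i _ => (hxi i).integrableOn, Finset.sum_mul]
    refine Finset.sum_le_sum fun k _ => ?_
    refine (setIntegral_sq_chiSquare_le hσ0 hm hδ hδ1 hc0 hc1 k).trans (le_of_eq ?_)
    ring
  have hS₁le := hSle (fun i => θ / σ i) (fun i => (hw0 i).le) fun i => (hw1 i).le
  have hS₂le := hSle (fun i => 1 - θ / σ i) (fun i => by linarith [hw1 i])
    fun i => by linarith [hw0 i]
  have hpt : ∀ x, Z x ≤ s₀ + (S₁.indicator N x + (S₂.indicator N x + U.indicator N x)) := by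
    intro x
    have i1 : 0 ≤ S₁.indicator N x := Set.indicator_nonneg (fun y _ => hN0 y) x
    have i2 : 0 ≤ S₂.indicator N x := Set.indicator_nonneg (fun y _ => hN0 y) x
    have i3 : 0 ≤ U.indicator N x := Set.indicator_nonneg (fun y _ => hN0 y) x
    have hZN : Z x ≤ N x := by simpa [hN] using hZ x 0 (Finset.mem_insert_self _ _)
    by_cases h1 : x ∈ S₁
    · rw [Set.indicator_of_mem h1]; linarith
    by_cases h2 : x ∈ S₂
    · rw [Set.indicator_of_mem h2]; linarith
    by_cases h3 : x ∈ U
    · rw [Set.indicator_of_mem h3]; linarith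
    have h4 : ∃ a ∈ α, (x, a) ∈ B := by
      by_contra hcon
      push Not at hcon
      exact h3 ⟨⟨h1, h2⟩, hcon⟩
    obtain ⟨a, ha, hab⟩ := h4
    have : Z x ≤ s₀ := (hZ x a (Finset.mem_insert_of_mem ha)).trans hab
    linarith
  have hind : ∀ s : Set (ι → ℝ), MeasurableSet s → Integrable (s.indicator N) ν := fun s hs =>
    hNi.indicator hs
  have hI2 : Integrable (fun x => S₂.indicator N x + U.indicator N x) ν :=
    (hind _ hS₂m).add (hind _ hUm)
  have hI1 : Integrable (fun x => S₁.indicator N x + (S₂.indicator N x + U.indicator N x)) ν :=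
    (hind _ hS₁m).add hI2
  refine (integral_mono_of_nonneg (ae_of_all _ hZ0) ((integrable_const _).add hI1)
    (ae_of_all _ hpt)).trans ?_
  change ∫ x, s₀ + (S₁.indicator N x + (S₂.indicator N x + U.indicator N x)) ∂ν ≤ _
  rw [integral_add (integrable_const _) hI1, integral_add (hind _ hS₁m) hI2,
    integral_add (hind _ hS₂m) (hind _ hUm), integral_indicator hS₁m, integral_indicator hS₂m,
    integral_indicator hUm]
  simp only [integral_const, probReal_univ, smul_eq_mul, one_mul]
  linarith

/-- A square integrable centered Gaussian random vector in a real Hilbert space. -/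
structure IsGaussVec {H Ω : Type*} [NormedAddCommGroup H] [InnerProductSpace ℝ H]
    [MeasurableSpace Ω] (P : Measure Ω) (X : Ω → H) : Prop where
  meas : AEStronglyMeasurable X P
  sq_int : Integrable (fun ω => ‖X ω‖ ^ 2) P
  gauss : ∀ f : H, ∃ v : ℝ≥0, Measure.map (fun ω => ⟪f, X ω⟫) P = gaussianReal 0 v

namespace IsGaussVec

variable {H Ω : Type*} [NormedAddCommGroup H] [InnerProductSpace ℝ H]
  [MeasurableSpace Ω] {P : Measure Ω} {X : Ω → H}

theorem memLp_inner (hX : IsGaussVec P X) (f : H) : MemLp (fun ω => ⟪f, X ω⟫) 2 P := by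
  have h : MemLp X 2 P := (memLp_two_iff_integrable_sq_norm hX.meas).mpr hX.sq_int
  exact h.const_inner f

theorem integrable_inner_mul (hX : IsGaussVec P X) (f g : H) :
    Integrable (fun ω => ⟪f, X ω⟫ * ⟪g, X ω⟫) P :=
  (hX.memLp_inner f).integrable_mul (hX.memLp_inner g)

theorem integrable_inner_sq (hX : IsGaussVec P X) (f : H) :
    Integrable (fun ω => ⟪f, X ω⟫ ^ 2) P := (hX.memLp_inner f).integrable_sq

theorem integral_inner (hX : IsGaussVec P X) (f : H) : ∫ ω, ⟪f, X ω⟫ ∂P = 0 := by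
  obtain ⟨v, hv⟩ := hX.gauss f
  have h := integral_map (f := fun x : ℝ => x) (hX.memLp_inner f).aestronglyMeasurable.aemeasurable
    (by fun_prop)
  rw [← h, hv, integral_id_gaussianReal]

theorem map_inner (hX : IsGaussVec P X) (f : H) :
    Measure.map (fun ω => ⟪f, X ω⟫) P
      = gaussianReal 0 (∫ ω, ⟪f, X ω⟫ * ⟪f, X ω⟫ ∂P).toNNReal := by
  obtain ⟨v, hv⟩ := hX.gauss f
  have h := integral_map (f := fun x : ℝ => x ^ 2)
    (hX.memLp_inner f).aestronglyMeasurable.aemeasurable (by fun_prop)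
  rw [hv, integral_sq_gaussianReal] at h
  simp_rw [← sq]
  rw [hv, ← h, Real.toNNReal_coe]

/-- Uncorrelated coordinates of a Gaussian vector are independent. -/
theorem map_coords [IsProbabilityMeasure P] (hX : IsGaussVec P X) {ι : Type*} [Fintype ι]
    [DecidableEq ι] (e : ι → H) (s : ι → ℝ)
    (hs : ∀ i j, ∫ ω, ⟪e i, X ω⟫ * ⟪e j, X ω⟫ ∂P = if i = j then s i else 0) :
    Measure.map (fun ω i => ⟪e i, X ω⟫) P
      = Measure.pi (fun i => gaussianReal 0 (s i).toNNReal) := by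
  have hm : ∀ i, AEMeasurable (fun ω => ⟪e i, X ω⟫) P := fun i =>
    (hX.memLp_inner _).aestronglyMeasurable.aemeasurable
  have hmv : AEMeasurable (fun ω i => ⟪e i, X ω⟫) P := aemeasurable_pi_lambda _ hm
  have hG : HasGaussianLaw (fun ω i => ⟪e i, X ω⟫) P := by
    refine ⟨isGaussian_of_map_eq_gaussianReal fun L => ?_⟩
    obtain ⟨v, hv⟩ := hX.gauss (∑ i, L (Pi.single i 1) • e i)
    refine ⟨0, v, ?_⟩
    rw [AEMeasurable.map_map_of_aemeasurable (by fun_prop) hmv, ← hv]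
    congr 1
    funext ω
    have hsum : (fun i => ⟪e i, X ω⟫) = ∑ i, ⟪e i, X ω⟫ • (Pi.single i (1 : ℝ) : ι → ℝ) := by
      funext j
      simp [Finset.sum_apply, Pi.single_apply]
    rw [Function.comp_apply, hsum, map_sum, sum_inner]
    refine Finset.sum_congr rfl fun i _ => ?_
    rw [map_smul, real_inner_smul_left, smul_eq_mul, mul_comm]
  have hind := hG.iIndepFun_of_covariance_eq_zero (X := fun i ω => ⟪e i, X ω⟫) fun i j hij => by
    rw [covariance_eq_sub (hX.memLp_inner _) (hX.memLp_inner _), hX.integral_inner]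
    simpa [hij] using hs i j
  rw [(iIndepFun_iff_map_fun_eq_pi_map hm).mp hind]
  congr 1
  funext i
  rw [hX.map_inner, hs i i, if_pos rfl]

/-- The covariance form of a Gaussian vector, restricted to a finite dimensional subspace, can be
diagonalized orthonormally with decreasing eigenvalues. -/
theorem exists_diag (hX : IsGaussVec P X) (V : Submodule ℝ H) [FiniteDimensional ℝ V] :
    ∃ (e : Fin (Module.finrank ℝ V) → H) (s : Fin (Module.finrank ℝ V) → ℝ),
      Orthonormal ℝ e ∧ Submodule.span ℝ (Set.range e) = V ∧ Antitone s ∧ (∀ i, 0 ≤ s i) ∧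
      ∀ i j, ∫ ω, ⟪e i, X ω⟫ * ⟪e j, X ω⟫ ∂P = if i = j then s i else 0 := by
  set B : V → V → ℝ := fun x y => ∫ ω, ⟪(x : H), X ω⟫ * ⟪(y : H), X ω⟫ ∂P with hB
  have hBadd : ∀ x y z, B (x + y) z = B x z + B y z := fun x y z => by
    simp only [hB, Submodule.coe_add, inner_add_left, add_mul]
    exact integral_add (hX.integrable_inner_mul _ _) (hX.integrable_inner_mul _ _)
  have hBsmul : ∀ (c : ℝ) x z, B (c • x) z = c * B x z := fun c x z => by
    simp only [hB, Submodule.coe_smul, real_inner_smul_left, mul_assoc]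
    exact integral_const_mul _ _
  have hBsymm : ∀ x y, B x y = B y x := fun x y => by simp only [hB, mul_comm]
  let b := stdOrthonormalBasis ℝ V
  let T : V →ₗ[ℝ] V :=
    { toFun := fun x => ∑ i, B x (b i) • b i
      map_add' := fun x y => by simp only [hBadd, add_smul, Finset.sum_add_distrib]
      map_smul' := fun c x => by
        simp only [hBsmul, RingHom.id_apply, Finset.smul_sum, mul_smul] }
  have hTin : ∀ x y, ⟪T x, y⟫ = B x y := by
    intro x y
    have hBr : ∀ (s : Finset (Fin (Module.finrank ℝ V))), B (∑ i ∈ s, ⟪b i, y⟫ • b i) x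
        = ∑ i ∈ s, ⟪b i, y⟫ * B (b i) x := by
      intro s
      classical
      induction s using Finset.induction_on with
      | empty => simp [hB]
      | insert a s ha ih => rw [Finset.sum_insert ha, Finset.sum_insert ha, hBadd, hBsmul, ih]
    have h2 := hBr Finset.univ
    rw [b.sum_repr' y] at h2
    change ⟪∑ i, B x (b i) • b i, y⟫ = _
    rw [sum_inner, hBsymm x y, h2]
    refine Finset.sum_congr rfl fun i _ => ?_
    rw [real_inner_smul_left, mul_comm, hBsymm]
  have hT : T.IsSymmetric := fun x y => by
    rw [hTin, real_inner_comm, hTin, hBsymm]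
  let u := hT.eigenvectorBasis rfl
  refine ⟨fun i => (u i : H), hT.eigenvalues rfl, ?_, ?_, hT.eigenvalues_antitone rfl, ?_⟩
  · exact u.orthonormal.comp_linearIsometry V.subtypeₗᵢ
  · have : Set.range (fun i => (u i : H)) = V.subtype '' Set.range u := by
      rw [← Set.range_comp]; rfl
    rw [this, Submodule.span_image]
    have h := u.toBasis.span_eq
    rw [OrthonormalBasis.coe_toBasis] at h
    rw [h, Submodule.map_top, Submodule.range_subtype]
  · have key : ∀ i j, ∫ ω, ⟪(u i : H), X ω⟫ * ⟪(u j : H), X ω⟫ ∂P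
        = if i = j then hT.eigenvalues rfl i else 0 := by
      intro i j
      change B (u i) (u j) = _
      rw [← hTin, hT.apply_eigenvectorBasis, inner_smul_left, orthonormal_iff_ite.mp u.orthonormal]
      simp
    refine ⟨fun i => ?_, key⟩
    have := key i i
    rw [if_pos rfl] at this
    rw [← this]
    exact integral_nonneg fun ω => mul_self_nonneg _

theorem integral_sq_of_diag (hX : IsGaussVec P X) {ι : Type*} [Fintype ι] [DecidableEq ι]
    {e : ι → H} {s : ι → ℝ} (he : Orthonormal ℝ e)
    (hs : ∀ i j, ∫ ω, ⟪e i, X ω⟫ * ⟪e j, X ω⟫ ∂P = if i = j then s i else 0)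
    {f : H} (hf : f ∈ Submodule.span ℝ (Set.range e)) :
    ∫ ω, ⟪f, X ω⟫ ^ 2 ∂P = ∑ i, s i * ⟪e i, f⟫ ^ 2 ∧ ‖f‖ ^ 2 = ∑ i, ⟪e i, f⟫ ^ 2 := by
  obtain ⟨c, rfl⟩ := (Submodule.mem_span_range_iff_exists_fun ℝ).mp hf
  have hc : ∀ i, ⟪e i, ∑ j, c j • e j⟫ = c i := fun i => he.inner_right_fintype c i
  simp_rw [hc]
  refine ⟨?_, ?_⟩
  · have h : ∀ ω, ⟪∑ j, c j • e j, X ω⟫ ^ 2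
        = ∑ i, ∑ j, c i * c j * (⟪e i, X ω⟫ * ⟪e j, X ω⟫) := by
      intro ω
      rw [sum_inner, sq, Finset.sum_mul_sum]
      refine Finset.sum_congr rfl fun i _ => Finset.sum_congr rfl fun j _ => ?_
      rw [real_inner_smul_left, real_inner_smul_left]
      ring
    simp_rw [h]
    rw [integral_finsetSum _ fun i _ => integrable_finsetSum _ fun j _ =>
      (hX.integrable_inner_mul _ _).const_mul _]
    refine Finset.sum_congr rfl fun i _ => ?_
    rw [integral_finsetSum _ fun j _ => (hX.integrable_inner_mul _ _).const_mul _]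
    simp_rw [integral_const_mul, hs]
    simp
    ring
  · rw [← real_inner_self_eq_norm_sq, he.inner_sum]
    simp [sq]

end IsGaussVec

theorem exists_mem_ne_zero_forall_eq_zero {H : Type*} [AddCommGroup H] [Module ℝ H]
    (W : Submodule ℝ H) [FiniteDimensional ℝ W] {κ : Type*} [Fintype κ] (l : κ → H →ₗ[ℝ] ℝ)
    (hκ : Fintype.card κ < Module.finrank ℝ W) : ∃ f ∈ W, f ≠ 0 ∧ ∀ k, l k f = 0 := by
  let L : W →ₗ[ℝ] (κ → ℝ) := LinearMap.pi fun k => (l k).comp W.subtype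
  have h : L.ker ≠ ⊥ := LinearMap.ker_ne_bot_of_finrank_lt (by simpa using hκ)
  obtain ⟨f, hf, hf0⟩ := (Submodule.ne_bot_iff _).mp h
  refine ⟨f, f.2, by simpa using hf0, fun k => ?_⟩
  exact congrFun (LinearMap.mem_ker.mp hf) k

namespace IsGaussVec

variable {H Ω : Type*} [NormedAddCommGroup H] [InnerProductSpace ℝ H]
  [MeasurableSpace Ω] {P : Measure Ω} {X : Ω → H}

theorem eigenvalue_le (hX : IsGaussVec P X) {d : ℕ} {e : Fin d → H} {s : Fin d → ℝ}
    (he : Orthonormal ℝ e) (hsa : Antitone s)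
    (hs : ∀ i j, ∫ ω, ⟪e i, X ω⟫ * ⟪e j, X ω⟫ ∂P = if i = j then s i else 0)
    {j : ℕ} (l : Fin j → H →ₗ[ℝ] ℝ) {t : ℝ}
    (hl : ∀ f, (∀ k, l k f = 0) → ∫ ω, ⟪f, X ω⟫ ^ 2 ∂P ≤ t * ‖f‖ ^ 2) (i : Fin d) (hi : j ≤ i) :
    s i ≤ t := by
  set W := Submodule.span ℝ (Set.range e) with hW
  have : FiniteDimensional ℝ W := FiniteDimensional.span_of_finite ℝ (Set.finite_range e)
  have hWd : Module.finrank ℝ W = d := by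
    rw [hW, finrank_span_eq_card he.linearIndependent, Fintype.card_fin]
  obtain ⟨f, hf, hf0, hfl⟩ := exists_mem_ne_zero_forall_eq_zero W
    (Sum.elim l fun k : {k : Fin d // i < k} => (innerSL ℝ (e k)).toLinearMap) (by
      rw [hWd, Fintype.card_sum, Fintype.card_fin, Fintype.card_subtype]
      have : (Finset.univ.filter fun k => i < k) = Finset.Ioi i := by ext; simp
      rw [this, Fin.card_Ioi]
      omega)
  have h1 := hl f fun k => hfl (Sum.inl k)
  have h2 : ∀ k, i < k → ⟪e k, f⟫ = 0 := fun k hk => hfl (Sum.inr ⟨k, hk⟩)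
  obtain ⟨h3, h4⟩ := hX.integral_sq_of_diag he hs hf
  have hpos : 0 < ‖f‖ ^ 2 := by positivity
  have h5 : s i * ‖f‖ ^ 2 ≤ ∫ ω, ⟪f, X ω⟫ ^ 2 ∂P := by
    rw [h3, h4, Finset.mul_sum]
    refine Finset.sum_le_sum fun k _ => ?_
    rcases lt_or_ge i k with hk | hk
    · simp [h2 k hk]
    · exact mul_le_mul_of_nonneg_right (hsa hk) (sq_nonneg _)
  exact le_of_mul_le_mul_right (h5.trans h1) hpos

theorem le_eigenvalue (hX : IsGaussVec P X) {d : ℕ} {e : Fin d → H} {s : Fin d → ℝ}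
    (he : Orthonormal ℝ e) (hsa : Antitone s)
    (hs : ∀ i j, ∫ ω, ⟪e i, X ω⟫ * ⟪e j, X ω⟫ ∂P = if i = j then s i else 0)
    (W : Submodule ℝ H) [FiniteDimensional ℝ W] (hW : W ≤ Submodule.span ℝ (Set.range e)) {t : ℝ}
    (hl : ∀ f ∈ W, t * ‖f‖ ^ 2 ≤ ∫ ω, ⟪f, X ω⟫ ^ 2 ∂P) (i : Fin d)
    (hi : (i : ℕ) < Module.finrank ℝ W) : t ≤ s i := by
  obtain ⟨f, hf, hf0, hfl⟩ := exists_mem_ne_zero_forall_eq_zero W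
    (fun k : {k : Fin d // k < i} => (innerSL ℝ (e k)).toLinearMap) (by
      rw [Fintype.card_subtype]
      have : (Finset.univ.filter fun k => k < i) = Finset.Iio i := by ext; simp
      rw [this, Fin.card_Iio]
      exact hi)
  have h1 := hl f hf
  have h2 : ∀ k, k < i → ⟪e k, f⟫ = 0 := fun k hk => hfl ⟨k, hk⟩
  obtain ⟨h3, h4⟩ := hX.integral_sq_of_diag he hs (hW hf)
  have hpos : 0 < ‖f‖ ^ 2 := by positivity
  have h5 : ∫ ω, ⟪f, X ω⟫ ^ 2 ∂P ≤ s i * ‖f‖ ^ 2 := by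
    rw [h3, h4, Finset.mul_sum]
    refine Finset.sum_le_sum fun k _ => ?_
    rcases lt_or_ge k i with hk | hk
    · simp [h2 k hk]
    · exact mul_le_mul_of_nonneg_right (hsa hk) (sq_nonneg _)
  exact le_of_mul_le_mul_right (h1.trans h5) hpos

end IsGaussVec

/-- The mean squared distortion of the codebook `α`. -/
noncomputable def distortion {H : Type*} [NormedAddCommGroup H] [InnerProductSpace ℝ H]
    {Ω : Type*} [MeasurableSpace Ω] (P : Measure Ω) (X : Ω → H) (α : Finset H) : ℝ :=
  ∫ ω, sInf ((fun a => ‖X ω - a‖ ^ 2) '' (α : Set H)) ∂P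

theorem norm_sub_sum_sq {H : Type*} [NormedAddCommGroup H] [InnerProductSpace ℝ H] {ι : Type*}
    [Fintype ι] {e : ι → H} (he : Orthonormal ℝ e) (x : H) (a : ι → ℝ) :
    ‖x - ∑ i, a i • e i‖ ^ 2
      = ‖x‖ ^ 2 - ∑ i, ⟪e i, x⟫ ^ 2 + ∑ i, (⟪e i, x⟫ - a i) ^ 2 := by
  have h1 : ‖∑ i, a i • e i‖ ^ 2 = ∑ i, a i ^ 2 := by
    rw [← real_inner_self_eq_norm_sq, he.inner_sum]
    simp [sq]
  rw [norm_sub_sq_real, h1, inner_sum, Finset.mul_sum]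
  have h2 : ∀ i, ⟪x, a i • e i⟫ = a i * ⟪e i, x⟫ := fun i => by
    rw [real_inner_smul_right, real_inner_comm]
  simp_rw [h2]
  rw [sub_add, sub_add, ← Finset.sum_sub_distrib, ← Finset.sum_sub_distrib]
  congr 1
  exact Finset.sum_congr rfl fun i _ => by ring

section

variable {H Ω : Type*} [NormedAddCommGroup H] [InnerProductSpace ℝ H]
  [MeasurableSpace Ω] {P : Measure Ω} {X : Ω → H}

theorem sInf_image_eq_inf' {ι : Type*} {α : Finset ι} (hα : α.Nonempty) (f : ι → ℝ) :
    sInf (f '' (α : Set ι)) = α.inf' hα f := (Finset.inf'_eq_csInf_image α hα f).symm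

theorem IsGaussVec.integrable_sInf [IsFiniteMeasure P] (hX : IsGaussVec P X) {α : Finset H}
    (hα : α.Nonempty) :
    Integrable (fun ω => sInf ((fun a => ‖X ω - a‖ ^ 2) '' (α : Set H))) P := by
  simp_rw [sInf_image_eq_inf' hα]
  have ha := hα.choose_spec
  set a := hα.choose
  have hc : Continuous fun x : H => α.inf' hα fun a => ‖x - a‖ ^ 2 :=
    Continuous.finset_inf'_apply hα fun a _ => by fun_prop
  have hint : Integrable (fun ω => ‖X ω - a‖ ^ 2) P := by
    have h : MemLp X 2 P := (memLp_two_iff_integrable_sq_norm hX.meas).mpr hX.sq_int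
    have h2 : MemLp (fun ω => X ω - a) 2 P := h.sub (memLp_const a)
    exact (memLp_two_iff_integrable_sq_norm h2.1).mp h2
  refine hint.mono' (hc.comp_aestronglyMeasurable hX.meas) (ae_of_all _ fun ω => ?_)
  rw [Real.norm_of_nonneg (Finset.le_inf' _ _ fun a _ => by positivity)]
  exact Finset.inf'_le _ ha

theorem IsGaussVec.waterFill_le_distortion [IsProbabilityMeasure P] (hX : IsGaussVec P X)
    {ι : Type*} [Fintype ι] [DecidableEq ι]
    {e : ι → H} {s : ι → ℝ} (he : Orthonormal ℝ e) (hs0 : ∀ i, 0 ≤ s i)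
    (hs : ∀ i j, ∫ ω, ⟪e i, X ω⟫ * ⟪e j, X ω⟫ ∂P = if i = j then s i else 0)
    {θ : ℝ} (hθ : 0 < θ) {α : Finset H} (hα : α.Nonempty) {n : ℕ} (hn : α.card ≤ n) :
    ∑ i, waterFill θ (s i) - 2 * θ * Real.log n ≤ distortion P X α := by
  classical
  set c : H → ι → ℝ := fun x i => ⟪e i, x⟫ with hc
  set β := α.image c with hβ
  have hβne : β.Nonempty := hα.image _
  set Z : (ι → ℝ) → ℝ := fun x => β.inf' hβne fun a => ∑ i, (x i - a i) ^ 2 with hZ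
  have hZc : Continuous Z := Continuous.finset_inf'_apply hβne fun a _ => by fun_prop
  have hlaw := hX.map_coords e s hs
  have hm : AEMeasurable (fun ω => c (X ω)) P :=
    aemeasurable_pi_lambda _ fun i => (hX.memLp_inner _).aestronglyMeasurable.aemeasurable
  have hle : ∀ ω, Z (c (X ω)) ≤ sInf ((fun a => ‖X ω - a‖ ^ 2) '' (α : Set H)) := by
    intro ω
    rw [sInf_image_eq_inf' hα]
    refine Finset.le_inf' _ _ fun a ha => ?_
    refine (Finset.inf'_le _ (Finset.mem_image_of_mem c ha)).trans ?_
    simp only [hc, ← inner_sub_right]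
    have := he.sum_inner_products_le (x := X ω - a) (s := Finset.univ)
    simpa using this
  have hZ0 : ∀ x, 0 ≤ Z x := fun x => Finset.le_inf' _ _ fun a _ => by positivity
  have hZi : Integrable (fun ω => Z (c (X ω))) P := by
    refine (hX.integrable_sInf hα).mono' (hZc.comp_aestronglyMeasurable hm.aestronglyMeasurable)
      (ae_of_all _ fun ω => ?_)
    rw [Real.norm_of_nonneg (hZ0 _)]
    exact hle ω
  have hZi' : Integrable Z (Measure.pi fun i => gaussianReal 0 (s i).toNNReal) := by
    rw [← hlaw]
    exact (integrable_map_measure hZc.aestronglyMeasurable hm).mpr hZi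
  have h := waterFill_le_integral (fun i => (s i).toNNReal) hθ β
    (Finset.card_image_le.trans hn) hβne hZi' fun x => by
      obtain ⟨a, ha, h⟩ := Finset.exists_mem_eq_inf' hβne fun a => ∑ i, (x i - a i) ^ 2
      exact ⟨a, ha, h.symm.le⟩
  simp_rw [Real.coe_toNNReal _ (hs0 _)] at h
  refine h.trans ?_
  rw [← hlaw, integral_map hm hZc.aestronglyMeasurable]
  exact integral_mono hZi (hX.integrable_sInf hα) hle

theorem IsGaussVec.exists_distortion_le [IsProbabilityMeasure P] (hX : IsGaussVec P X)
    {ι : Type*} [Fintype ι] [DecidableEq ι]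
    {e : ι → H} {s : ι → ℝ} (he : Orthonormal ℝ e)
    (hs : ∀ i j, ∫ ω, ⟪e i, X ω⟫ * ⟪e j, X ω⟫ ∂P = if i = j then s i else 0)
    {ε : ℝ} (hε : ∫ ω, (‖X ω‖ ^ 2 - ∑ i, ⟪e i, X ω⟫ ^ 2) ∂P ≤ ε)
    {θ δ m : ℝ} (hθ : 0 < θ) (hm : ((Finset.univ.filter fun i => θ < s i).card : ℝ) ≤ m)
    (hm0 : 0 < m) (hδ : 0 < δ) (hδ1 : δ ≤ 1) (hmδ : 2 * (16 + 2 * gaussFour) ≤ m * δ ^ 2) {n : ℕ}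
    (hn : rexp (∑ i with θ < s i, Real.log (s i / θ) / 2 + 2 * δ * m) ≤ n) :
    ∃ α : Finset H, α.Nonempty ∧ α.card ≤ n + 1 ∧ distortion P X α ≤ ε + ∑ i, min (s i) θ
      + 2 * θ * δ * m + (∫ ω, ‖X ω‖ ^ 2 ∂P) *
          (2 * (8 / δ * rexp (1 - 3 * δ ^ 2 * m / 32)) + rexp (-(rexp (δ * m) / 2))) := by
  classical
  let κ := {i // θ < s i}
  have hcard : Fintype.card κ = (Finset.univ.filter fun i => θ < s i).card :=
    Fintype.card_subtype _
  have hsub : ∀ g : ι → ℝ, ∑ i : κ, g i = ∑ i with θ < s i, g i := fun g =>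
    (Finset.sum_subtype (Finset.univ.filter fun i => θ < s i) (by simp) g).symm
  obtain ⟨β, h0, hβn, hβ⟩ := exists_codebook (ι := κ) (σ := fun i => s i) hθ (fun i => i.2)
    (by rw [hcard]; exact hm) hm0 hδ hδ1 hmδ (n := n)
    (by rw [hsub fun i => Real.log (s i / θ) / 2]; exact hn)
  set e' : κ → H := fun i => e i with he'
  have he'o : Orthonormal ℝ e' := he.comp _ Subtype.val_injective
  have hs' : ∀ i j : κ, ∫ ω, ⟪e' i, X ω⟫ * ⟪e' j, X ω⟫ ∂P = if i = j then s i else 0 := by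
    intro i j
    rw [he', hs]
    exact if_congr Subtype.ext_iff.symm rfl rfl
  have hlaw := hX.map_coords e' (fun i => s i) hs'
  have hβne : β.Nonempty := ⟨0, h0⟩
  set Z : (κ → ℝ) → ℝ := fun x => β.inf' hβne fun a => ∑ i, (x i - a i) ^ 2 with hZ
  have hZc : Continuous Z := Continuous.finset_inf'_apply hβne fun a _ => by fun_prop
  have hZ0 : ∀ x, 0 ≤ Z x := fun x => Finset.le_inf' _ _ fun a _ => by positivity
  have hZint := hβ Z hZ0 fun x a ha => Finset.inf'_le _ ha
  have hm : AEMeasurable (fun ω (i : κ) => ⟪e' i, X ω⟫) P :=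
    aemeasurable_pi_lambda _ fun i => (hX.memLp_inner _).aestronglyMeasurable.aemeasurable
  rw [← hlaw, integral_map hm hZc.aestronglyMeasurable] at hZint
  set L : (κ → ℝ) → H := fun a => ∑ i, a i • e' i with hL
  have hαne : (β.image L).Nonempty := hβne.image _
  refine ⟨β.image L, hαne, Finset.card_image_le.trans hβn, ?_⟩
  have hsq : ∀ i, ∫ ω, ⟪e i, X ω⟫ ^ 2 ∂P = s i := fun i => by
    have := hs i i
    rw [if_pos rfl] at this
    simpa [sq] using this
  have hZi : Integrable (fun ω => Z fun i => ⟪e' i, X ω⟫) P := by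
    refine (integrable_finsetSum Finset.univ fun i _ => hX.integrable_inner_sq (e' i)).mono'
      (hZc.comp_aestronglyMeasurable hm.aestronglyMeasurable) (ae_of_all _ fun ω => ?_)
    rw [Real.norm_of_nonneg (hZ0 _)]
    refine (Finset.inf'_le _ h0).trans ?_
    simp
  have hR : Integrable (fun ω => ∑ i, ⟪e i, X ω⟫ ^ 2) P :=
    integrable_finsetSum _ fun i _ => hX.integrable_inner_sq (e i)
  have hQ : Integrable (fun ω => ∑ i with ¬ θ < s i, ⟪e i, X ω⟫ ^ 2) P :=
    integrable_finsetSum _ fun i _ => hX.integrable_inner_sq (e i)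
  have hpt : ∀ ω, sInf ((fun a => ‖X ω - a‖ ^ 2) '' ((β.image L : Finset H) : Set H))
      ≤ (‖X ω‖ ^ 2 - ∑ i, ⟪e i, X ω⟫ ^ 2) + ∑ i with ¬ θ < s i, ⟪e i, X ω⟫ ^ 2
        + Z fun i => ⟪e' i, X ω⟫ := by
    intro ω
    obtain ⟨a, ha, hae⟩ := Finset.exists_mem_eq_inf' hβne
      fun a => ∑ i : κ, (⟪e' i, X ω⟫ - a i) ^ 2
    rw [sInf_image_eq_inf' hαne]
    refine (Finset.inf'_le _ (Finset.mem_image_of_mem L ha)).trans ?_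
    have hZa : (Z fun i => ⟪e' i, X ω⟫) = ∑ i : κ, (⟪e' i, X ω⟫ - a i) ^ 2 := hae
    rw [hL, norm_sub_sum_sq he'o, hZa, hsub fun i => ⟪e i, X ω⟫ ^ 2,
      ← Finset.sum_filter_add_sum_filter_not Finset.univ (fun i => θ < s i)
        fun i => ⟪e i, X ω⟫ ^ 2]
    linarith
  have hI1 : Integrable (fun ω => ‖X ω‖ ^ 2 - ∑ i, ⟪e i, X ω⟫ ^ 2) P := hX.sq_int.sub hR
  have hI2 : Integrable (fun ω => (‖X ω‖ ^ 2 - ∑ i, ⟪e i, X ω⟫ ^ 2)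
      + ∑ i with ¬ θ < s i, ⟪e i, X ω⟫ ^ 2) P := hI1.add hQ
  have hstep : distortion P X (β.image L) ≤ ε + ∑ i with ¬ θ < s i, s i
      + ∫ ω, Z fun i => ⟪e' i, X ω⟫ ∂P := by
    refine (integral_mono (hX.integrable_sInf hαne) (hI2.add hZi) hpt).trans ?_
    change ∫ ω, ((‖X ω‖ ^ 2 - ∑ i, ⟪e i, X ω⟫ ^ 2) + ∑ i with ¬ θ < s i, ⟪e i, X ω⟫ ^ 2)
      + (Z fun i => ⟪e' i, X ω⟫) ∂P ≤ _
    rw [integral_add hI2 hZi, integral_add hI1 hQ,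
      integral_finsetSum _ fun i _ => hX.integrable_inner_sq (e i)]
    simp_rw [hsq]
    linarith
  have htot : ∑ i : κ, s i ≤ ∫ ω, ‖X ω‖ ^ 2 ∂P := by
    have : ∑ i : κ, s i = ∫ ω, ∑ i : κ, ⟪e' i, X ω⟫ ^ 2 ∂P := by
      rw [integral_finsetSum _ fun i _ => hX.integrable_inner_sq (e' i)]
      exact Finset.sum_congr rfl fun i _ => (hsq i).symm
    rw [this]
    refine integral_mono (integrable_finsetSum _ fun i _ => hX.integrable_inner_sq (e' i))
      hX.sq_int fun ω => ?_
    have := he'o.sum_inner_products_le (x := X ω) (s := Finset.univ)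
    simpa using this
  have hmin : ∑ i with ¬ θ < s i, s i + θ * Fintype.card κ ≤ ∑ i, min (s i) θ := by
    rw [← Finset.sum_filter_add_sum_filter_not Finset.univ (fun i => θ < s i), add_comm]
    refine add_le_add ?_ (Finset.sum_le_sum fun i hi => ?_)
    · rw [hcard, mul_comm, ← nsmul_eq_mul, ← Finset.sum_const]
      refine Finset.sum_le_sum fun i hi => ?_
      exact le_min (Finset.mem_filter.mp hi).2.le le_rfl
    · exact le_min le_rfl (not_lt.mp (Finset.mem_filter.mp hi).2)
  have herr : (∑ i : κ, s i) *
      (2 * (8 / δ * rexp (1 - 3 * δ ^ 2 * m / 32)) + rexp (-(rexp (δ * m) / 2)))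
      ≤ (∫ ω, ‖X ω‖ ^ 2 ∂P) *
        (2 * (8 / δ * rexp (1 - 3 * δ ^ 2 * m / 32)) + rexp (-(rexp (δ * m) / 2))) := by
    gcongr
  linarith

/-- A square integrable vector is well approximated by a finite dimensional subspace. -/
theorem IsGaussVec.exists_subspace [IsProbabilityMeasure P] (hX : IsGaussVec P X) {ε : ℝ}
    (hε : 0 < ε) :
    ∃ V : Submodule ℝ H, FiniteDimensional ℝ V ∧
      ∀ {ι : Type} [Fintype ι] {e : ι → H}, Orthonormal ℝ e →
        Submodule.span ℝ (Set.range e) = V →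
        ∫ ω, (‖X ω‖ ^ 2 - ∑ i, ⟪e i, X ω⟫ ^ 2) ∂P ≤ ε := by
  have h : MemLp X 2 P := (memLp_two_iff_integrable_sq_norm hX.meas).mpr hX.sq_int
  obtain ⟨g, hg, hgL⟩ := h.exists_simpleFunc_eLpNorm_sub_lt (by norm_num)
    (ε := ENNReal.ofReal (√ε)) (by simpa using hε)
  refine ⟨Submodule.span ℝ (Set.range g), FiniteDimensional.span_of_finite ℝ g.finite_range,
    fun {ι} _ {e} he hspan => ?_⟩
  have hsub : MemLp (fun ω => X ω - g ω) 2 P := h.sub hgL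
  have hint : Integrable (fun ω => ‖X ω - g ω‖ ^ 2) P :=
    (memLp_two_iff_integrable_sq_norm hsub.1).mp hsub
  have hle : ∫ ω, ‖X ω - g ω‖ ^ 2 ∂P ≤ ε := by
    have h1 : eLpNorm (fun ω => X ω - g ω) 2 P ≤ ENNReal.ofReal (√ε) := hg.le
    rw [hsub.eLpNorm_eq_integral_rpow_norm (by norm_num) (by norm_num)] at h1
    have h2 := (ENNReal.ofReal_le_ofReal_iff (Real.sqrt_nonneg ε)).mp h1
    simp only [ENNReal.toReal_ofNat, Real.rpow_ofNat] at h2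
    rw [← one_div, ← Real.sqrt_eq_rpow] at h2
    exact (Real.sqrt_le_sqrt_iff hε.le).mp h2
  refine (integral_mono (hX.sq_int.sub (integrable_finsetSum _ fun i _ =>
    hX.integrable_inner_sq (e i))) hint fun ω => ?_).trans hle
  have hgω : g ω ∈ Submodule.span ℝ (Set.range e) := by
    rw [hspan]
    exact Submodule.subset_span ⟨ω, rfl⟩
  obtain ⟨c, hc⟩ := (Submodule.mem_span_range_iff_exists_fun ℝ).mp hgω
  have := norm_sub_sum_sq he (X ω) c
  rw [hc] at this
  have h0 : 0 ≤ ∑ i, (⟪e i, X ω⟫ - c i) ^ 2 := by positivity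
  simp only [Pi.sub_apply]
  linarith

end

theorem mul_log_sub_le_log_factorial (m : ℕ) (hm : 1 ≤ m) :
    m * Real.log m - m ≤ Real.log m.factorial := by
  have h := Real.pow_div_factorial_le_exp (m : ℝ) (by positivity) m
  have hm0 : (0 : ℝ) < m := by exact_mod_cast hm
  have hf : (0 : ℝ) < m.factorial := by exact_mod_cast m.factorial_pos
  have h2 := Real.log_le_log (by positivity) h
  rw [Real.log_exp, Real.log_div (by positivity) (by positivity), Real.log_pow] at h2
  linarith

theorem log_factorial_le (m : ℕ) (hm : 1 ≤ m) :
    Real.log m.factorial ≤ (m + 1) * Real.log m - m + 1 := by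
  induction m, hm using Nat.le_induction with
  | base => simp
  | succ m hm ih =>
    have hm0 : (0 : ℝ) < m := by exact_mod_cast hm
    have hf : (0 : ℝ) < m.factorial := by exact_mod_cast m.factorial_pos
    rw [Nat.factorial_succ]
    push_cast
    rw [Real.log_mul (by positivity) (by positivity)]
    have h1 : Real.log ((m : ℝ) / (m + 1)) ≤ m / (m + 1) - 1 :=
      Real.log_le_sub_one_of_pos (by positivity)
    rw [Real.log_div (by positivity) (by positivity)] at h1
    have h2 : (m : ℝ) / (m + 1) - 1 = -(1 / (m + 1)) := by field_simp; ring
    rw [h2] at h1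
    have h3 : (m + 1 : ℝ) * (Real.log m - Real.log (m + 1)) ≤ -1 := by
      have := mul_le_mul_of_nonneg_left h1 (by positivity : (0 : ℝ) ≤ m + 1)
      refine this.trans (le_of_eq ?_)
      field_simp
    nlinarith

theorem sum_log_div_eq (m : ℕ) (hm : 1 ≤ m) :
    ∑ j ∈ Finset.Icc 1 m, Real.log ((m : ℝ) / j) = m * Real.log m - Real.log m.factorial := by
  have hm0 : (0 : ℝ) < m := by exact_mod_cast hm
  have h : ∀ j ∈ Finset.Icc 1 m, Real.log ((m : ℝ) / j) = Real.log m - Real.log j := by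
    intro j hj
    have hj0 : (0 : ℝ) < j := by exact_mod_cast (Finset.mem_Icc.mp hj).1
    exact Real.log_div hm0.ne' hj0.ne'
  have h2 : Real.log m.factorial = ∑ j ∈ Finset.Icc 1 m, Real.log j := by
    rw [← Finset.prod_Ico_id_eq_factorial, Finset.Ico_add_one_right_eq_Icc]
    push_cast
    refine Real.log_prod fun j hj => ?_
    have : (0 : ℝ) < j := by exact_mod_cast (Finset.mem_Icc.mp hj).1
    exact this.ne'
  rw [Finset.sum_congr rfl h, Finset.sum_sub_distrib, h2]
  simp

theorem rpow_neg_mul_one_sub_le {x p : ℝ} (hp : 0 ≤ p) (hx : -1 < x) :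
    1 - p * x ≤ (1 + x) ^ (-p) := by
  rw [Real.rpow_def_of_pos (by linarith)]
  have h1 := Real.add_one_le_exp (Real.log (1 + x) * -p)
  have h2 : Real.log (1 + x) ≤ x := by
    have := Real.log_le_sub_one_of_pos (x := 1 + x) (by linarith)
    linarith
  nlinarith

theorem rpow_sub_rpow_succ_le {b y : ℝ} (hb : 1 < b) (hy : 0 < y) :
    y ^ (1 - b) - (y + 1) ^ (1 - b) ≤ (b - 1) * y ^ (-b) := by
  have h := rpow_neg_mul_one_sub_le (p := b - 1) (x := 1 / y) (by linarith)
    (by have : 0 < 1 / y := by positivity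
        linarith)
  have h1 : y + 1 = y * (1 + 1 / y) := by field_simp
  rw [h1, Real.mul_rpow hy.le (by positivity)]
  have h2 : y ^ (-b) = y ^ (1 - b) * (1 / y) := by
    rw [show (-b) = (1 - b) - 1 by ring, Real.rpow_sub_one hy.ne']
    field_simp
  rw [h2]
  have h3 : 0 < y ^ (1 - b) := Real.rpow_pos_of_pos hy _
  rw [show -(b - 1) = 1 - b by ring] at h
  nlinarith

theorem mul_rpow_succ_le {b y : ℝ} (hb : 1 < b) (hy : 0 < y) :
    (b - 1) * (y + 1) ^ (-b) ≤ y ^ (1 - b) - (y + 1) ^ (1 - b) := by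
  have hy1 : 0 < y + 1 := by linarith
  have h := rpow_neg_mul_one_sub_le (p := b - 1) (x := -(1 / (y + 1))) (by linarith)
    (by rw [neg_lt_neg_iff, div_lt_one hy1]; linarith)
  have h1 : y = (y + 1) * (1 + -(1 / (y + 1))) := by field_simp; ring
  have h0 : (0 : ℝ) ≤ 1 + -(1 / (y + 1)) := by
    have : 1 / (y + 1) ≤ 1 := by rw [div_le_one hy1]; linarith
    linarith
  nth_rewrite 2 [h1]
  rw [Real.mul_rpow hy1.le h0]
  have h2 : (y + 1) ^ (-b) = (y + 1) ^ (1 - b) * (1 / (y + 1)) := by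
    rw [show (-b) = (1 - b) - 1 by ring, Real.rpow_sub_one hy1.ne']
    field_simp
  rw [h2]
  have h3 : 0 < (y + 1) ^ (1 - b) := Real.rpow_pos_of_pos hy1 _
  rw [show -(b - 1) = 1 - b by ring] at h
  nlinarith

theorem sum_rpow_tail_le {b : ℝ} (hb : 1 < b) {m : ℕ} (hm : 1 ≤ m) (d : ℕ) :
    ∑ j ∈ Finset.Ico m d, (j : ℝ) ^ (-b) ≤ (m : ℝ) ^ (-b) + (m : ℝ) ^ (1 - b) / (b - 1) := by
  have hb1 : 0 < b - 1 := by linarith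
  have hm0 : (0 : ℝ) < m := by exact_mod_cast hm
  rcases le_or_gt d m with hd | hd
  · rw [Finset.Ico_eq_empty_of_le hd, Finset.sum_empty]
    positivity
  · suffices h : ∀ d, m + 1 ≤ d → ∑ j ∈ Finset.Ico m d, (j : ℝ) ^ (-b)
        ≤ (m : ℝ) ^ (-b) + ((m : ℝ) ^ (1 - b) - ((d - 1 : ℕ) : ℝ) ^ (1 - b)) / (b - 1) by
      refine (h d hd).trans ?_
      gcongr
      have : 0 ≤ ((d - 1 : ℕ) : ℝ) ^ (1 - b) := by positivity
      linarith
    intro d hd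
    induction d, hd using Nat.le_induction with
    | base => simp
    | succ d hd ih =>
      rw [Finset.sum_Ico_succ_top (by omega)]
      have hd0 : (0 : ℝ) < ((d - 1 : ℕ) : ℝ) := by exact_mod_cast (by omega : 0 < d - 1)
      have h := mul_rpow_succ_le hb hd0
      have h2 : ((d - 1 : ℕ) : ℝ) + 1 = d := by
        rw [Nat.cast_sub (by omega)]
        simp
      rw [h2] at h
      have h3 : (d : ℝ) ^ (-b) ≤ (((d - 1 : ℕ) : ℝ) ^ (1 - b) - (d : ℝ) ^ (1 - b)) / (b - 1) := by
        rw [le_div_iff₀ hb1]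
        linarith
      refine (add_le_add ih h3).trans (le_of_eq ?_)
      rw [Nat.add_sub_cancel]
      ring

theorem le_sum_rpow {b : ℝ} (hb : 1 < b) {m : ℕ} (hm : 1 ≤ m) {M : ℕ} (hM : m ≤ M) :
    ((m : ℝ) ^ (1 - b) - (M : ℝ) ^ (1 - b)) / (b - 1) ≤ ∑ j ∈ Finset.Ico m M, (j : ℝ) ^ (-b) := by
  have hb1 : 0 < b - 1 := by linarith
  induction M, hM using Nat.le_induction with
  | base => simp
  | succ M hM ih =>
    rw [Finset.sum_Ico_succ_top hM]
    have h := rpow_sub_rpow_succ_le hb (y := M) (by exact_mod_cast (by omega : 0 < M))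
    push_cast
    have h3 : ((M : ℝ) ^ (1 - b) - (M + 1 : ℝ) ^ (1 - b)) / (b - 1) ≤ (M : ℝ) ^ (-b) := by
      rw [div_le_iff₀ hb1]
      linarith
    refine le_trans (le_of_eq ?_) (add_le_add ih h3)
    ring

theorem waterFill_mono {θ : ℝ} (hθ : 0 < θ) : Monotone (waterFill θ) := by
  intro v w h
  unfold waterFill
  split_ifs with h1 h2 h2
  · have : 0 < v := hθ.trans h1
    gcongr
  · exact absurd (h1.trans_le h) h2
  · have : 0 ≤ Real.log (w / θ) := Real.log_nonneg (by rw [le_div_iff₀ hθ]; linarith)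
    nlinarith
  · exact h

theorem waterFill_nonneg {θ v : ℝ} (hθ : 0 < θ) (hv : 0 ≤ v) : 0 ≤ waterFill θ v := by
  unfold waterFill
  split_ifs with h
  · have : 0 ≤ Real.log (v / θ) := Real.log_nonneg (by rw [le_div_iff₀ hθ]; linarith)
    positivity
  · exact hv

section

variable {H Ω : Type*} [NormedAddCommGroup H] [InnerProductSpace ℝ H]
  [MeasurableSpace Ω] {P : Measure Ω} {X : Ω → H}

/-- Lower bound `(1 - δ) c j ^ (-b)` on the covariance form on `j`-dimensional subspaces. -/
def SpecLower (P : Measure Ω) (X : Ω → H) (b c : ℝ) : Prop :=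
  ∀ δ : ℝ, 0 < δ → δ < 1 → ∀ᶠ j : ℕ in atTop, ∃ W : Submodule ℝ H, FiniteDimensional ℝ W ∧
    j ≤ Module.finrank ℝ W ∧
    ∀ f ∈ W, (1 - δ) * c * (j : ℝ) ^ (-b) * ‖f‖ ^ 2 ≤ ∫ ω, ⟪f, X ω⟫ ^ 2 ∂P

theorem IsGaussVec.sum_waterFill_le [IsProbabilityMeasure P] (hX : IsGaussVec P X) {t : ℕ → ℝ}
    {J M : ℕ} (hJ : 1 ≤ J) (hJM : J ≤ M)
    (hspec : ∀ j, J ≤ j → ∃ W : Submodule ℝ H, FiniteDimensional ℝ W ∧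
      j ≤ Module.finrank ℝ W ∧ ∀ f ∈ W, t j * ‖f‖ ^ 2 ≤ ∫ ω, ⟪f, X ω⟫ ^ 2 ∂P)
    {θ : ℝ} (hθ : 0 < θ) {α : Finset H} (hα : α.Nonempty) {n : ℕ} (hn : α.card ≤ n) :
    ∑ j ∈ Finset.Icc J M, waterFill θ (t j) - 2 * θ * Real.log n ≤ distortion P X α := by
  classical
  choose! W hWfin hWrank hWf using hspec
  set V : Submodule ℝ H := ⨆ j : Finset.Icc J M, W j with hV
  have hfd : ∀ j : Finset.Icc J M, FiniteDimensional ℝ (W j) := fun j =>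
    hWfin j (Finset.mem_Icc.mp j.2).1
  have hVfin : FiniteDimensional ℝ V := by
    rw [hV]
    exact Submodule.finiteDimensional_iSup _
  have hdiag := hX.exists_diag V
  have hle : ∀ j ∈ Finset.Icc J M, W j ≤ V := fun j hj =>
    le_iSup (fun j : Finset.Icc J M => W j) ⟨j, hj⟩
  have hd : M ≤ Module.finrank ℝ V :=
    (hWrank M hJM).trans (Submodule.finrank_mono (hle M (Finset.mem_Icc.mpr ⟨hJM, le_rfl⟩)))
  generalize Module.finrank ℝ V = d at hd hdiag
  obtain ⟨e, s, he, hspan, hsa, hs0, hs⟩ := hdiag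
  refine le_trans ?_ (hX.waterFill_le_distortion he hs0 hs hθ hα hn)
  refine sub_le_sub_right ?_ _
  set G : ℕ → ℝ := fun i => if h : i < d then waterFill θ (s ⟨i, h⟩) else 0 with hG
  have hsum : ∑ i, waterFill θ (s i) = ∑ i ∈ Finset.range d, G i := by
    rw [Finset.sum_range]
    exact Finset.sum_congr rfl fun i _ => by simp [hG]
  have hG0 : ∀ i, 0 ≤ G i := fun i => by
    simp only [hG]
    split_ifs
    · exact waterFill_nonneg hθ (hs0 _)
    · exact le_rfl
  have hinj : Set.InjOn (fun j : ℕ => j - 1) (Finset.Icc J M) := by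
    intro a ha b hb hab
    have h1 := (Finset.mem_Icc.mp ha).1
    have h2 := (Finset.mem_Icc.mp hb).1
    simp only at hab
    omega
  calc ∑ j ∈ Finset.Icc J M, waterFill θ (t j) ≤ ∑ j ∈ Finset.Icc J M, G (j - 1) := by
        refine Finset.sum_le_sum fun j hj => ?_
        obtain ⟨hj1, hj2⟩ := Finset.mem_Icc.mp hj
        have hjd : j - 1 < d := by omega
        simp only [hG, dif_pos hjd]
        refine waterFill_mono hθ ?_
        have := hWfin j hj1
        refine hX.le_eigenvalue he hsa hs (W j) (by rw [hspan]; exact hle j hj) (hWf j hj1) _ ?_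
        have := hWrank j hj1
        simp only
        omega
    _ = ∑ i ∈ (Finset.Icc J M).image (fun j => j - 1), G i := (Finset.sum_image hinj).symm
    _ ≤ ∑ i ∈ Finset.range d, G i := by
        refine Finset.sum_le_sum_of_subset_of_nonneg ?_ fun i _ _ => hG0 i
        intro i hi
        obtain ⟨j, hj, rfl⟩ := Finset.mem_image.mp hi
        have := Finset.mem_Icc.mp hj
        exact Finset.mem_range.mpr (by omega)
    _ = _ := hsum.symm

theorem le_sum_waterFill {b C : ℝ} (hb : 1 < b) (hC : 0 < C) {J m M : ℕ} (hJ : 1 ≤ J)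
    (hJm : J ≤ m) (hmM : m ≤ M) :
    C * (m : ℝ) ^ (-b) * ((1 + b) * m - J - b * (1 + (J + 1) * Real.log m))
      + C * (((m : ℝ) ^ (1 - b) - ((M + 1 : ℕ) : ℝ) ^ (1 - b)) / (b - 1))
      ≤ ∑ j ∈ Finset.Icc J M, waterFill (C * (m : ℝ) ^ (-b)) (C * (j : ℝ) ^ (-b)) := by
  have hm1 : 1 ≤ m := hJ.trans hJm
  have hm0 : (0 : ℝ) < m := by exact_mod_cast hm1
  set θ := C * (m : ℝ) ^ (-b) with hθ
  have hθ0 : 0 < θ := by positivity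
  rw [← Finset.Ico_add_one_right_eq_Icc, ← Finset.sum_Ico_consecutive _ hJm (by omega : m ≤ M + 1)]
  refine add_le_add ?_ ?_
  · have h1 : ∀ j ∈ Finset.Ico J m, waterFill θ (C * (j : ℝ) ^ (-b))
        = θ * (1 + b * Real.log ((m : ℝ) / j)) := by
      intro j hj
      obtain ⟨hj1, hj2⟩ := Finset.mem_Ico.mp hj
      have hj0 : (0 : ℝ) < j := by exact_mod_cast hJ.trans hj1
      have hlt : θ < C * (j : ℝ) ^ (-b) := by
        rw [hθ]
        refine mul_lt_mul_of_pos_left ?_ hC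
        exact Real.rpow_lt_rpow_of_neg hj0 (by exact_mod_cast hj2) (by linarith)
      have hq : C * (j : ℝ) ^ (-b) / θ = ((m : ℝ) / j) ^ b := by
        rw [hθ, mul_div_mul_left _ _ hC.ne', ← Real.div_rpow hj0.le hm0.le,
          Real.rpow_neg (by positivity), ← Real.inv_rpow (by positivity), inv_div]
      rw [waterFill, if_pos hlt, hq, Real.log_rpow (by positivity)]
      ring
    rw [Finset.sum_congr rfl h1, ← Finset.mul_sum]
    refine mul_le_mul_of_nonneg_left ?_ hθ0.le
    rw [Finset.sum_add_distrib, ← Finset.mul_sum]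
    have h2 : ∑ j ∈ Finset.Ico J m, (1 : ℝ) = m - J := by
      simp [Nat.cast_sub hJm]
    have h3 := sum_log_div_eq m hm1
    have h4 := log_factorial_le m hm1
    have h5 : ∑ j ∈ Finset.Icc 1 m, Real.log ((m : ℝ) / j)
        = ∑ j ∈ Finset.Ico 1 J, Real.log ((m : ℝ) / j)
          + ∑ j ∈ Finset.Ico J m, Real.log ((m : ℝ) / j) := by
      rw [Finset.sum_Ico_consecutive _ hJ hJm, ← Finset.Ico_add_one_right_eq_Icc,
        Finset.sum_Ico_succ_top hm1]
      simp [hm0.ne']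
    have hlm : 0 ≤ Real.log m := Real.log_nonneg (by exact_mod_cast hm1)
    have h6 : ∑ j ∈ Finset.Ico 1 J, Real.log ((m : ℝ) / j) ≤ J * Real.log m := by
      calc ∑ j ∈ Finset.Ico 1 J, Real.log ((m : ℝ) / j) ≤ ∑ j ∈ Finset.Ico 1 J, Real.log m := by
            refine Finset.sum_le_sum fun j hj => ?_
            have hj0 : (1 : ℝ) ≤ j := by exact_mod_cast (Finset.mem_Ico.mp hj).1
            exact Real.log_le_log (by positivity) (div_le_self hm0.le hj0)
        _ = ((J - 1 : ℕ) : ℝ) * Real.log m := by simp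
        _ ≤ J * Real.log m := by
            gcongr
            exact Nat.sub_le _ _
    rw [h2]
    nlinarith
  · have h1 : ∀ j ∈ Finset.Ico m (M + 1), waterFill θ (C * (j : ℝ) ^ (-b)) = C * (j : ℝ) ^ (-b) := by
      intro j hj
      have hjm : (m : ℝ) ≤ j := by exact_mod_cast (Finset.mem_Ico.mp hj).1
      rw [waterFill, if_neg]
      rw [not_lt, hθ]
      refine mul_le_mul_of_nonneg_left ?_ hC.le
      exact Real.rpow_le_rpow_of_nonpos hm0 hjm (by linarith)
    rw [Finset.sum_congr rfl h1, ← Finset.mul_sum]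
    exact mul_le_mul_of_nonneg_left (le_sum_rpow hb hm1 (by omega)) hC.le

theorem IsGaussVec.le_distortion [IsProbabilityMeasure P] (hX : IsGaussVec P X) {b C : ℝ}
    (hb : 1 < b) (hC : 0 < C) {J m : ℕ} (hJ : 1 ≤ J) (hJm : J ≤ m)
    (hspec : ∀ j, J ≤ j → ∃ W : Submodule ℝ H, FiniteDimensional ℝ W ∧
      j ≤ Module.finrank ℝ W ∧
        ∀ f ∈ W, C * (j : ℝ) ^ (-b) * ‖f‖ ^ 2 ≤ ∫ ω, ⟪f, X ω⟫ ^ 2 ∂P)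
    {α : Finset H} (hα : α.Nonempty) {n : ℕ} (hn : α.card ≤ n) (hnm : 2 * Real.log n ≤ b * m) :
    C * (m : ℝ) ^ (1 - b) * (b / (b - 1) - (J + b * (1 + (J + 1) * Real.log m)) / m)
      ≤ distortion P X α := by
  have hm0 : (0 : ℝ) < m := by exact_mod_cast hJ.trans hJm
  have hb1 : 0 < b - 1 := by linarith
  have hlim : Tendsto (fun M : ℕ => C * (m : ℝ) ^ (-b) *
      (m - J - b * (1 + (J + 1) * Real.log m))
      + C * (((m : ℝ) ^ (1 - b) - ((M + 1 : ℕ) : ℝ) ^ (1 - b)) / (b - 1))) atTop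
      (nhds (C * (m : ℝ) ^ (-b) * (m - J - b * (1 + (J + 1) * Real.log m))
      + C * (((m : ℝ) ^ (1 - b) - 0) / (b - 1)))) := by
    have h0 : Tendsto (fun M : ℕ => ((M + 1 : ℕ) : ℝ) ^ (1 - b)) atTop (nhds 0) := by
      have h1 := (tendsto_rpow_neg_atTop hb1).comp
        (tendsto_natCast_atTop_atTop.comp (tendsto_add_atTop_nat 1))
      refine h1.congr fun M => ?_
      simp [Function.comp]
    exact tendsto_const_nhds.add (((tendsto_const_nhds.sub h0).div_const _).const_mul _)
  have hle : ∀ᶠ M : ℕ in atTop, C * (m : ℝ) ^ (-b) * (m - J - b * (1 + (J + 1) * Real.log m))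
      + C * (((m : ℝ) ^ (1 - b) - ((M + 1 : ℕ) : ℝ) ^ (1 - b)) / (b - 1)) ≤ distortion P X α := by
    filter_upwards [eventually_ge_atTop m] with M hM
    have h1 := hX.sum_waterFill_le hJ (hJm.trans hM) (t := fun j => C * (j : ℝ) ^ (-b))
      hspec (θ := C * (m : ℝ) ^ (-b)) (by positivity) hα hn
    have h2 := le_sum_waterFill hb hC hJ hJm hM
    have h3 : 2 * (C * (m : ℝ) ^ (-b)) * Real.log n ≤ C * (m : ℝ) ^ (-b) * (b * m) := by
      have : 0 < C * (m : ℝ) ^ (-b) := by positivity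
      nlinarith
    linarith
  refine le_trans (le_of_eq ?_) (le_of_tendsto hlim hle)
  have h2 : (m : ℝ) ^ (-b) = (m : ℝ) ^ (1 - b) / m := by
    rw [show (-b) = (1 - b) - 1 by ring, Real.rpow_sub_one hm0.ne']
  rw [h2]
  field_simp
  ring

/-- Asymptotic lower bound on the quantization error from the eigenvalue asymptotics. -/
theorem IsGaussVec.eventually_le_distortion [IsProbabilityMeasure P] (hX : IsGaussVec P X)
    {b c K : ℝ} (hb : 1 < b) (hc : 0 < c) (hspec : SpecLower P X b c)
    (hK : K < c * (b / 2) ^ (b - 1) * (b / (b - 1))) :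
    ∀ᶠ n : ℕ in atTop, ∀ α : Finset H, α.Nonempty → α.card ≤ n →
      K * Real.log n ^ (1 - b) ≤ distortion P X α := by
  have hb1 : 0 < b - 1 := by linarith
  set K₀ := c * (b / 2) ^ (b - 1) * (b / (b - 1)) with hK₀
  have hK₀0 : 0 < K₀ := by positivity
  obtain ⟨δ, hδ0, hδ1, hδK⟩ : ∃ δ : ℝ, 0 < δ ∧ δ < 1 ∧ K < (1 - δ) * K₀ := by
    have h1 : Tendsto (fun δ : ℝ => (1 - δ) * K₀) (nhdsWithin 0 (Set.Ioi 0))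
        (nhds ((1 - 0) * K₀)) :=
      ((by fun_prop : Continuous fun δ : ℝ => (1 - δ) * K₀).tendsto 0).mono_left
        nhdsWithin_le_nhds
    rw [sub_zero, one_mul] at h1
    have h2 : ∀ᶠ δ : ℝ in nhdsWithin 0 (Set.Ioi 0), δ < 1 :=
      nhdsWithin_le_nhds (gt_mem_nhds one_pos)
    obtain ⟨δ, ⟨ha, hb'⟩, hc'⟩ :=
      (((h1.eventually_const_lt hK).and h2).and self_mem_nhdsWithin).exists
    exact ⟨δ, hc', hb', ha⟩
  obtain ⟨J', hJ'⟩ := eventually_atTop.mp (hspec δ hδ0 hδ1)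
  set J := max J' 1 with hJdef
  set C := (1 - δ) * c with hCdef
  have hC : 0 < C := mul_pos (by linarith) hc
  set r : ℝ → ℝ := fun x => (J + b * (1 + (J + 1) * Real.log x)) / x with hr
  have hr0 : Tendsto r atTop (nhds 0) := by
    have h1 : Tendsto (fun x : ℝ => Real.log x / x) atTop (nhds 0) := by
      simpa using Real.isLittleO_log_id_atTop.tendsto_div_nhds_zero
    have h2 : Tendsto (fun x : ℝ => (J + b) * x⁻¹ + b * (J + 1) * (Real.log x / x)) atTop
        (nhds ((J + b) * 0 + b * (J + 1) * 0)) :=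
      (tendsto_inv_atTop_zero.const_mul _).add (h1.const_mul _)
    rw [mul_zero, mul_zero, add_zero] at h2
    refine h2.congr fun x => ?_
    simp only [hr]
    ring
  set m : ℕ → ℕ := fun n => ⌈2 / b * Real.log n⌉₊ with hm
  have hlog : Tendsto (fun n : ℕ => Real.log n) atTop atTop :=
    Real.tendsto_log_atTop.comp tendsto_natCast_atTop_atTop
  have hmratio : Tendsto (fun n : ℕ => (m n : ℝ) / Real.log n) atTop (nhds (2 / b)) :=
    (tendsto_nat_ceil_mul_div_atTop (R := ℝ) (a := 2 / b) (by positivity)).comp hlog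
  have hmtop : Tendsto m atTop atTop := by
    refine tendsto_nat_ceil_atTop.comp (hlog.const_mul_atTop (by positivity))
  have hlim : Tendsto (fun n : ℕ => C * ((m n : ℝ) / Real.log n) ^ (1 - b)
      * (b / (b - 1) - r (m n))) atTop (nhds (C * (2 / b) ^ (1 - b) * (b / (b - 1) - 0))) :=
    ((hmratio.rpow_const (Or.inl (by positivity))).const_mul C).mul
      (tendsto_const_nhds.sub (hr0.comp (tendsto_natCast_atTop_atTop.comp hmtop)))
  have hval : C * (2 / b) ^ (1 - b) * (b / (b - 1) - 0) = (1 - δ) * K₀ := by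
    have : (2 / b) ^ (1 - b) = (b / 2) ^ (b - 1) := by
      rw [show 1 - b = -(b - 1) by ring, Real.rpow_neg (by positivity),
        ← Real.inv_rpow (by positivity), inv_div]
    rw [this, sub_zero, hCdef, hK₀]
    ring
  rw [hval] at hlim
  filter_upwards [hlim.eventually_const_lt hδK, hmtop.eventually_ge_atTop J,
    hlog.eventually_gt_atTop 0] with n h1 h2 h3 α hα hn
  have hb0 : 0 < b := by linarith
  have h4 := hX.le_distortion hb hC (J := J) (le_max_right _ _) h2
    (fun j hj => hJ' j ((le_max_left _ _).trans hj)) hα hn (by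
      have := Nat.le_ceil (2 / b * Real.log n)
      have h5 := mul_le_mul_of_nonneg_left this hb0.le
      have h6 : b * (2 / b * Real.log n) = 2 * Real.log n := by field_simp
      linarith)
  refine le_trans ?_ h4
  have h5 := mul_le_mul_of_nonneg_right h1.le (Real.rpow_nonneg h3.le (1 - b))
  refine h5.trans (le_of_eq ?_)
  rw [Real.div_rpow (by positivity) h3.le]
  have : 0 < Real.log n ^ (1 - b) := Real.rpow_pos_of_pos h3 _
  simp only [hr]
  generalize b / (b - 1) - (↑J + b * (1 + (↑J + 1) * Real.log ↑(m n))) / ↑(m n) = x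
  field_simp

end

section

variable {H Ω : Type*} [NormedAddCommGroup H] [InnerProductSpace ℝ H]
  [MeasurableSpace Ω] {P : Measure Ω} {X : Ω → H}

/-- Upper bound `(1 + δ) c j ^ (-b)` on the covariance form on subspaces of codimension `j`. -/
def SpecUpper (P : Measure Ω) (X : Ω → H) (b c : ℝ) : Prop :=
  ∀ δ : ℝ, 0 < δ → ∀ᶠ j : ℕ in atTop, ∃ L : Finset (H →ₗ[ℝ] ℝ), L.card ≤ j ∧
    ∀ f, (∀ l ∈ L, l f = 0) → ∫ ω, ⟪f, X ω⟫ ^ 2 ∂P ≤ (1 + δ) * c * (j : ℝ) ^ (-b) * ‖f‖ ^ 2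

theorem IsGaussVec.eigenvalue_le' (hX : IsGaussVec P X) {d : ℕ} {e : Fin d → H} {s : Fin d → ℝ}
    (he : Orthonormal ℝ e) (hsa : Antitone s)
    (hs : ∀ i j, ∫ ω, ⟪e i, X ω⟫ * ⟪e j, X ω⟫ ∂P = if i = j then s i else 0) {t : ℝ} {j : ℕ}
    {L : Finset (H →ₗ[ℝ] ℝ)} (hL : L.card ≤ j)
    (hl : ∀ f, (∀ l ∈ L, l f = 0) → ∫ ω, ⟪f, X ω⟫ ^ 2 ∂P ≤ t * ‖f‖ ^ 2) (i : Fin d)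
    (hi : j ≤ i) : s i ≤ t := by
  refine hX.eigenvalue_le he hsa hs (fun k : Fin L.card => (L.equivFin.symm k : H →ₗ[ℝ] ℝ))
    (fun f hf => hl f fun l hlL => ?_) i (hL.trans hi)
  simpa using hf (L.equivFin ⟨l, hlL⟩)

theorem IsGaussVec.exists_distortion_le_of_spec [IsProbabilityMeasure P] (hX : IsGaussVec P X)
    {b C δ : ℝ} (hb : 1 < b) (hC : 0 < C) {J m : ℕ} (hJ : 1 ≤ J) (hJm : J ≤ m)
    (hspec : ∀ j, J ≤ j → ∃ L : Finset (H →ₗ[ℝ] ℝ), L.card ≤ j ∧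
      ∀ f, (∀ l ∈ L, l f = 0) → ∫ ω, ⟪f, X ω⟫ ^ 2 ∂P ≤ C * (j : ℝ) ^ (-b) * ‖f‖ ^ 2)
    (hδ : 0 < δ) (hδ1 : δ ≤ 1) (hmδ : 2 * (16 + 2 * gaussFour) ≤ m * δ ^ 2) {n : ℕ}
    (hn : rexp (J * (max 0 (Real.log ((∫ ω, ‖X ω‖ ^ 2 ∂P) / (C * (m : ℝ) ^ (-b)))) / 2)
      + b / 2 * m + 2 * δ * m) ≤ n) :
    ∃ α : Finset H, α.Nonempty ∧ α.card ≤ n + 1 ∧ distortion P X α ≤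
      C * (m : ℝ) ^ (1 - b) * (1 + 3 * δ + (m : ℝ)⁻¹ + 1 / (b - 1)) + (∫ ω, ‖X ω‖ ^ 2 ∂P) *
          (2 * (8 / δ * rexp (1 - 3 * δ ^ 2 * m / 32)) + rexp (-(rexp (δ * m) / 2))) := by
  classical
  have hm1 : 1 ≤ m := hJ.trans hJm
  have hm0 : (0 : ℝ) < m := by exact_mod_cast hm1
  have hb1 : 0 < b - 1 := by linarith
  set Λ := ∫ ω, ‖X ω‖ ^ 2 ∂P with hΛ
  set θ := C * (m : ℝ) ^ (-b) with hθdef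
  have hθ : 0 < θ := by positivity
  set ℓ := max 0 (Real.log (Λ / θ)) with hℓ
  have hℓ0 : 0 ≤ ℓ := le_max_left _ _
  obtain ⟨V, hV, hVe⟩ := hX.exists_subspace (ε := C * (m : ℝ) ^ (1 - b) * δ) (by positivity)
  have hdiag := hX.exists_diag V
  generalize Module.finrank ℝ V = d at hdiag
  obtain ⟨e, s, he, hspan, hsa, hs0, hs⟩ := hdiag
  have hε := hVe he hspan
  have hsle : ∀ i : Fin d, J ≤ i → s i ≤ C * (i : ℝ) ^ (-b) := by
    intro i hi
    obtain ⟨L, hL, hl⟩ := hspec i hi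
    exact hX.eigenvalue_le' he hsa hs hL hl i le_rfl
  have hsΛ : ∀ i, s i ≤ Λ := by
    intro i
    have h1 := hs i i
    rw [if_pos rfl] at h1
    rw [← h1]
    refine integral_mono (hX.integrable_inner_mul _ _) hX.sq_int fun ω => ?_
    have h2 := abs_real_inner_le_norm (e i) (X ω)
    rw [he.1 i, one_mul] at h2
    have h3 := pow_le_pow_left₀ (abs_nonneg _) h2 2
    rw [sq_abs] at h3
    simpa [sq] using h3
  have hsθ : ∀ i : Fin d, m ≤ i → s i ≤ θ := by
    intro i hi
    refine (hsle i (hJm.trans hi)).trans ?_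
    refine mul_le_mul_of_nonneg_left ?_ hC.le
    exact Real.rpow_le_rpow_of_nonpos hm0 (by exact_mod_cast hi) (by linarith)
  have hcard : ((Finset.univ.filter fun i => θ < s i).card : ℝ) ≤ m := by
    have h1 : (Finset.univ.filter fun i => θ < s i).card ≤ (Finset.range m).card := by
      refine Finset.card_le_card_of_injOn (fun i => (i : ℕ)) (fun i hi => ?_)
        (Fin.val_injective.injOn)
      have hi' := (Finset.mem_filter.mp hi).2
      by_contra h
      simp only [Finset.coe_range, Set.mem_Iio, not_lt] at h
      exact absurd (hsθ i h) (not_le.mpr hi')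
    rw [Finset.card_range] at h1
    exact_mod_cast h1
  have hlogm : ∀ i ∈ Finset.Icc 1 m, 0 ≤ b / 2 * Real.log ((m : ℝ) / i) := by
    intro i hi
    obtain ⟨h1, h2⟩ := Finset.mem_Icc.mp hi
    have h3 : (0 : ℝ) < i := by exact_mod_cast h1
    have h4 : (1 : ℝ) ≤ m / i := by rw [le_div_iff₀ h3, one_mul]; exact_mod_cast h2
    have := Real.log_nonneg h4
    positivity
  have hR : ∑ i with θ < s i, Real.log (s i / θ) / 2 ≤ J * (ℓ / 2) + b / 2 * m := by
    rw [Finset.sum_filter]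
    calc ∑ i : Fin d, (if θ < s i then Real.log (s i / θ) / 2 else 0)
        ≤ ∑ i : Fin d, ((if (i : ℕ) ∈ Finset.range J then ℓ / 2 else 0)
          + if (i : ℕ) ∈ Finset.Icc 1 m then b / 2 * Real.log ((m : ℝ) / (i : ℕ)) else 0) := by
          refine Finset.sum_le_sum fun i _ => ?_
          have h2 : 0 ≤ if (i : ℕ) ∈ Finset.Icc 1 m then
              b / 2 * Real.log ((m : ℝ) / (i : ℕ)) else 0 := by
            split_ifs with h
            · exact hlogm _ h
            · exact le_rfl
          have h1 : 0 ≤ if (i : ℕ) ∈ Finset.range J then ℓ / 2 else 0 := by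
            split_ifs <;> positivity
          by_cases h : θ < s i
          · rw [if_pos h]
            rcases lt_or_ge (i : ℕ) J with hi | hi
            · rw [if_pos (Finset.mem_range.mpr hi)]
              have h3 : Real.log (s i / θ) ≤ ℓ :=
                (Real.log_le_log (div_pos (hθ.trans h) hθ)
                  (div_le_div_of_nonneg_right (hsΛ i) hθ.le)).trans (le_max_right _ _)
              linarith
            · have him : (i : ℕ) ≤ m := by
                by_contra h'
                exact absurd (hsθ i (by omega)) (not_le.mpr h)
              have hi0 : (0 : ℝ) < (i : ℕ) := by exact_mod_cast hJ.trans hi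
              rw [if_pos (Finset.mem_Icc.mpr ⟨hJ.trans hi, him⟩)]
              have h3 : s i / θ ≤ ((m : ℝ) / (i : ℕ)) ^ b := by
                rw [Real.div_rpow hm0.le hi0.le, div_le_div_iff₀ hθ (by positivity)]
                have h4 := mul_le_mul_of_nonneg_right (hsle i hi)
                  (Real.rpow_nonneg hi0.le b)
                refine h4.trans (le_of_eq ?_)
                rw [hθdef, Real.rpow_neg hi0.le, Real.rpow_neg hm0.le]
                have := (Real.rpow_pos_of_pos hi0 b).ne'
                have := (Real.rpow_pos_of_pos hm0 b).ne'
                field_simp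
              have h4 := Real.log_le_log (div_pos (hθ.trans h) hθ) h3
              rw [Real.log_rpow (by positivity)] at h4
              linarith
          · rw [if_neg h]
            exact add_nonneg h1 h2
      _ = ∑ i ∈ Finset.range d, (if i ∈ Finset.range J then ℓ / 2 else 0)
          + ∑ i ∈ Finset.range d,
            (if i ∈ Finset.Icc 1 m then b / 2 * Real.log ((m : ℝ) / i) else 0) := by
          rw [← Finset.sum_add_distrib, Finset.sum_range]
      _ ≤ ∑ i ∈ Finset.range J, ℓ / 2
          + ∑ i ∈ Finset.Icc 1 m, b / 2 * Real.log ((m : ℝ) / i) := by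
          rw [Finset.sum_ite_mem, Finset.sum_ite_mem]
          refine add_le_add (Finset.sum_le_sum_of_subset_of_nonneg Finset.inter_subset_right
            fun _ _ _ => by positivity) (Finset.sum_le_sum_of_subset_of_nonneg
              Finset.inter_subset_right fun i hi _ => hlogm i hi)
      _ ≤ J * (ℓ / 2) + b / 2 * m := by
          rw [Finset.sum_const, Finset.card_range, nsmul_eq_mul, ← Finset.mul_sum,
            sum_log_div_eq m hm1]
          have := mul_log_sub_le_log_factorial m hm1
          gcongr
          linarith
  have hmin : ∑ i, min (s i) θ ≤ m * θ + C * ((m : ℝ) ^ (-b) + (m : ℝ) ^ (1 - b) / (b - 1)) := by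
    calc ∑ i : Fin d, min (s i) θ
        ≤ ∑ i : Fin d, ((if (i : ℕ) ∈ Finset.range m then θ else 0)
          + if (i : ℕ) ∈ Finset.Ico m d then C * ((i : ℕ) : ℝ) ^ (-b) else 0) := by
          refine Finset.sum_le_sum fun i _ => ?_
          rcases lt_or_ge (i : ℕ) m with hi | hi
          · rw [if_pos (Finset.mem_range.mpr hi), if_neg (by simp [hi]), add_zero]
            exact min_le_right _ _
          · rw [if_neg (by simp [hi]), if_pos (by simp [hi]), zero_add]
            exact (min_le_left _ _).trans (hsle i (hJm.trans hi))
      _ = ∑ i ∈ Finset.range d, (if i ∈ Finset.range m then θ else 0)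
          + ∑ i ∈ Finset.range d, (if i ∈ Finset.Ico m d then C * (i : ℝ) ^ (-b) else 0) := by
          rw [← Finset.sum_add_distrib, Finset.sum_range]
      _ ≤ ∑ i ∈ Finset.range m, θ + ∑ i ∈ Finset.Ico m d, C * (i : ℝ) ^ (-b) := by
          rw [Finset.sum_ite_mem, Finset.sum_ite_mem]
          refine add_le_add (Finset.sum_le_sum_of_subset_of_nonneg Finset.inter_subset_right
            fun _ _ _ => hθ.le) (Finset.sum_le_sum_of_subset_of_nonneg
              Finset.inter_subset_right fun i hi _ => by positivity)
      _ ≤ _ := by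
          rw [Finset.sum_const, Finset.card_range, nsmul_eq_mul, ← Finset.mul_sum]
          gcongr
          exact sum_rpow_tail_le hb hm1 d
  obtain ⟨α, h1, h2, h3⟩ := hX.exists_distortion_le he hs hε hθ hcard hm0 hδ hδ1 hmδ (n := n)
    (le_trans (Real.exp_le_exp.mpr (by linarith)) hn)
  refine ⟨α, h1, h2, h3.trans ?_⟩
  refine add_le_add ?_ le_rfl
  have h5 : (m : ℝ) ^ (-b) = (m : ℝ) ^ (1 - b) / m := by
    rw [show (-b) = (1 - b) - 1 by ring, Real.rpow_sub_one hm0.ne']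
  have h4 : C * (m : ℝ) ^ (1 - b) * (1 + 3 * δ + (m : ℝ)⁻¹ + 1 / (b - 1))
      = C * (m : ℝ) ^ (1 - b) * δ + (m * θ + C * ((m : ℝ) ^ (-b) + (m : ℝ) ^ (1 - b) / (b - 1)))
        + 2 * θ * δ * m := by
    rw [hθdef, h5]
    field_simp
    ring
  linarith

theorem tendsto_codebook_remainder {δ b : ℝ} (hδ : 0 < δ) :
    Tendsto (fun x : ℝ => (2 * (8 / δ * rexp (1 - 3 * δ ^ 2 * x / 32)) + rexp (-(rexp (δ * x) / 2)))
      * x ^ (b - 1)) atTop (nhds 0) := by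
  have h1 := (tendsto_rpow_mul_exp_neg_mul_atTop_nhds_zero (b - 1) (3 * δ ^ 2 / 32)
    (by positivity)).const_mul (16 / δ * rexp 1)
  have h2 := tendsto_rpow_mul_exp_neg_mul_atTop_nhds_zero (b - 1) (δ / 2) (by positivity)
  have h3 := h1.add h2
  rw [mul_zero, zero_add] at h3
  refine squeeze_zero' ?_ ?_ h3
  · filter_upwards [eventually_ge_atTop 0] with x hx
    positivity
  · filter_upwards [eventually_ge_atTop 0] with x hx
    have h4 : rexp (1 - 3 * δ ^ 2 * x / 32) = rexp 1 * rexp (-(3 * δ ^ 2 / 32) * x) := by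
      rw [← Real.exp_add]
      ring_nf
    have h5 : rexp (-(rexp (δ * x) / 2)) ≤ rexp (-(δ / 2) * x) := by
      refine Real.exp_le_exp.mpr ?_
      have := Real.add_one_le_exp (δ * x)
      linarith
    have h6 := mul_le_mul_of_nonneg_right h5 (Real.rpow_nonneg hx (b - 1))
    rw [h4, add_mul]
    refine (add_le_add le_rfl h6).trans (le_of_eq ?_)
    ring

theorem tendsto_log_div_rpow_div (Λ C b J : ℝ) :
    Tendsto (fun x : ℝ => J * (max 0 (Real.log (Λ / (C * x ^ (-b)))) / 2) / x) atTop
      (nhds 0) := by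
  have h1 : Tendsto (fun x : ℝ => Real.log x / x) atTop (nhds 0) := by
    simpa using Real.isLittleO_log_id_atTop.tendsto_div_nhds_zero
  have h2 : Tendsto (fun x : ℝ => J * (max 0 (Real.log (Λ / C) * x⁻¹ + b * (Real.log x / x)) / 2))
      atTop (nhds (J * (max 0 (Real.log (Λ / C) * 0 + b * 0) / 2))) :=
    ((tendsto_const_nhds.max ((tendsto_inv_atTop_zero.const_mul _).add
      (h1.const_mul _))).div_const _).const_mul _
  have h3 : J * (max 0 (Real.log (Λ / C) * 0 + b * 0) / 2) = 0 := by simp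
  rw [h3] at h2
  by_cases hne : Λ / C = 0
  · refine tendsto_const_nhds.congr fun x => ?_
    rw [← div_div, hne]
    simp
  · refine h2.congr' ?_
    filter_upwards [eventually_gt_atTop 0] with x hx
    have h4 : Real.log (Λ / (C * x ^ (-b))) = Real.log (Λ / C) + b * Real.log x := by
      rw [← div_div, Real.log_div hne (Real.rpow_pos_of_pos hx _).ne', Real.log_rpow hx]
      ring
    rw [h4, show Real.log (Λ / C) * x⁻¹ + b * (Real.log x / x)
      = (Real.log (Λ / C) + b * Real.log x) / x by ring]
    have h5 := max_div_div_right hx.le 0 (Real.log (Λ / C) + b * Real.log x)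
    rw [zero_div] at h5
    rw [h5]
    ring

/-- Asymptotic upper bound on the quantization error from the eigenvalue asymptotics. -/
theorem IsGaussVec.eventually_exists_distortion_le [IsProbabilityMeasure P] (hX : IsGaussVec P X)
    {b c K : ℝ} (hb : 1 < b) (hc : 0 < c) (hspec : SpecUpper P X b c)
    (hK : c * (b / 2) ^ (b - 1) * (b / (b - 1)) < K) :
    ∀ᶠ n : ℕ in atTop, ∃ α : Finset H, α.Nonempty ∧ α.card ≤ n ∧
      distortion P X α ≤ K * Real.log n ^ (1 - b) := by
  have hb1 : 0 < b - 1 := by linarith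
  obtain ⟨δ, hδ0, hδ1, hδK⟩ : ∃ δ : ℝ, 0 < δ ∧ δ ≤ 1 ∧
      (b / 2 + 4 * δ) ^ (b - 1) * ((1 + δ) * c * (1 + 3 * δ + 0 + 1 / (b - 1)) + 0) < K := by
    have hcont : ContinuousAt (fun δ : ℝ => (b / 2 + 4 * δ) ^ (b - 1)
        * ((1 + δ) * c * (1 + 3 * δ + 0 + 1 / (b - 1)) + 0)) 0 := by
      refine ContinuousAt.mul (ContinuousAt.rpow_const (by fun_prop) (Or.inr hb1.le)) (by fun_prop)
    have h1 := hcont.tendsto.mono_left (nhdsWithin_le_nhds (s := Set.Ioi 0))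
    have hval : (b / 2 + 4 * (0 : ℝ)) ^ (b - 1) * ((1 + 0) * c * (1 + 3 * 0 + 0 + 1 / (b - 1)) + 0)
        = c * (b / 2) ^ (b - 1) * (b / (b - 1)) := by
      rw [mul_zero, add_zero]
      field_simp
      ring
    rw [hval] at h1
    have h2 : ∀ᶠ δ : ℝ in nhdsWithin 0 (Set.Ioi 0), δ < 1 :=
      nhdsWithin_le_nhds (gt_mem_nhds one_pos)
    obtain ⟨δ, ⟨ha, hb'⟩, hc'⟩ :=
      (((h1.eventually_lt_const hK).and h2).and self_mem_nhdsWithin).exists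
    exact ⟨δ, hc', hb'.le, ha⟩
  obtain ⟨J', hJ'⟩ := eventually_atTop.mp (hspec δ hδ0)
  set J := max J' 1 with hJdef
  set C := (1 + δ) * c with hCdef
  have hC : 0 < C := by positivity
  set Λ := ∫ ω, ‖X ω‖ ^ 2 ∂P with hΛ
  set A := b / 2 + 4 * δ with hA
  have hA0 : 0 < A := by positivity
  set err : ℝ → ℝ := fun x =>
    2 * (8 / δ * rexp (1 - 3 * δ ^ 2 * x / 32)) + rexp (-(rexp (δ * x) / 2)) with herr
  have hlog : Tendsto (fun n : ℕ => Real.log n) atTop atTop :=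
    Real.tendsto_log_atTop.comp tendsto_natCast_atTop_atTop
  set m : ℕ → ℕ := fun n => ⌊A⁻¹ * Real.log n⌋₊ with hm
  have hmratio : Tendsto (fun n : ℕ => (m n : ℝ) / Real.log n) atTop (nhds A⁻¹) :=
    (tendsto_nat_floor_mul_div_atTop (R := ℝ) (a := A⁻¹) (by positivity)).comp hlog
  have hmtop : Tendsto m atTop atTop :=
    tendsto_nat_floor_atTop.comp (hlog.const_mul_atTop (by positivity))
  have hmtopR : Tendsto (fun n => (m n : ℝ)) atTop atTop := tendsto_natCast_atTop_atTop.comp hmtop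
  have hlim : Tendsto (fun n : ℕ => ((m n : ℝ) / Real.log n) ^ (1 - b)
      * (C * (1 + 3 * δ + (m n : ℝ)⁻¹ + 1 / (b - 1)) + Λ * (err (m n) * (m n : ℝ) ^ (b - 1))))
      atTop (nhds (A⁻¹ ^ (1 - b) * (C * (1 + 3 * δ + 0 + 1 / (b - 1)) + Λ * 0))) := by
    refine (hmratio.rpow_const (Or.inl (by positivity))).mul (Tendsto.add ?_ ?_)
    · exact ((tendsto_const_nhds.add (tendsto_inv_atTop_zero.comp hmtopR)).add
        tendsto_const_nhds).const_mul C
    · exact ((tendsto_codebook_remainder hδ0).comp hmtopR).const_mul Λ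
  have hval : A⁻¹ ^ (1 - b) = A ^ (b - 1) := by
    rw [show 1 - b = -(b - 1) by ring, Real.rpow_neg (by positivity),
        ← Real.inv_rpow (by positivity), inv_inv]
  rw [hval, mul_zero] at hlim
  have hJlim := (tendsto_log_div_rpow_div Λ C b J).comp hmtopR
  have hexp : Tendsto (fun n => rexp (-(δ * m n))) atTop (nhds 0) :=
    Real.tendsto_exp_neg_atTop_nhds_zero.comp (hmtopR.const_mul_atTop hδ0)
  filter_upwards [hlim.eventually_lt_const hδK, hmtop.eventually_ge_atTop J,
    hlog.eventually_gt_atTop 0, hJlim.eventually_lt_const hδ0,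
    hexp.eventually_lt_const (by norm_num : (0 : ℝ) < 1 / 2), eventually_ge_atTop 2,
    (hmtopR.atTop_mul_const (by positivity : 0 < δ ^ 2)).eventually_ge_atTop
      (2 * (16 + 2 * gaussFour))] with n h1 h2 h3 h4 h5 h6 h7
  have hm0 : (0 : ℝ) < m n := by exact_mod_cast (le_max_right J' 1).trans h2
  have hn0 : (2 : ℝ) ≤ n := by exact_mod_cast h6
  obtain ⟨α, hα, hαn, hαD⟩ := hX.exists_distortion_le_of_spec hb hC (J := J) (le_max_right _ _) h2
    (fun j hj => hJ' j ((le_max_left _ _).trans hj)) hδ0 hδ1 h7 (n := n - 1) (by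
      rw [Nat.cast_sub (by omega), Nat.cast_one]
      simp only [Function.comp] at h4
      rw [div_lt_iff₀ hm0] at h4
      have h8 : (m n : ℝ) ≤ A⁻¹ * Real.log n := Nat.floor_le (by positivity)
      have h9 : A * m n ≤ Real.log n := by
        have := mul_le_mul_of_nonneg_left h8 hA0.le
        rwa [← mul_assoc, mul_inv_cancel₀ hA0.ne', one_mul] at this
      calc _ ≤ rexp (Real.log n + -(δ * m n)) := by
            refine Real.exp_le_exp.mpr ?_
            rw [hA] at h9
            linarith
        _ = n * rexp (-(δ * m n)) := by rw [Real.exp_add, Real.exp_log (by linarith)]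
        _ ≤ n * (1 / 2) := by gcongr
        _ ≤ n - 1 := by linarith)
  refine ⟨α, hα, by omega, hαD.trans ?_⟩
  have h8 := mul_le_mul_of_nonneg_right h1.le (Real.rpow_nonneg h3.le (1 - b))
  refine le_trans (le_of_eq ?_) h8
  rw [Real.div_rpow (by positivity) h3.le]
  have h9 : 0 < Real.log n ^ (1 - b) := Real.rpow_pos_of_pos h3 _
  have h10 : (m n : ℝ) ^ (1 - b) * (m n : ℝ) ^ (b - 1) = 1 := by
    rw [← Real.rpow_add hm0]
    simp
  have h11 : Λ * err (m n) = Λ * err (m n) * ((m n : ℝ) ^ (1 - b) * (m n : ℝ) ^ (b - 1)) := by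
    rw [h10, mul_one]
  change _ + Λ * err (m n) = _
  rw [h11]
  generalize err (m n) = x
  field_simp

end

theorem integrableOn_rpow_mul_exp_neg {p a : ℝ} (hp : -1 < p) (ha : 0 < a) :
    IntegrableOn (fun v : ℝ => v ^ p * rexp (-(a * v))) (Set.Ioi 0) := by
  have h := integrableOn_rpow_mul_exp_neg_mul_rpow (p := 1) (s := p) (b := a) hp one_pos ha
  simpa [neg_mul] using h

/-- The Gamma integral with complex rate. -/
theorem integral_rpow_mul_cexp_neg {β : ℝ} (hβ : 0 < β) {z : ℂ} (hz : 0 < z.re) :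
    ∫ v in Set.Ioi (0 : ℝ), ((v ^ (β - 1) : ℝ) : ℂ) * Complex.exp (-(z * v))
      = (1 / z) ^ (β : ℂ) * Real.Gamma β := by
  set ν : Measure ℝ := (volume.restrict (Set.Ioi (0 : ℝ))).withDensity
    (fun v => ENNReal.ofReal (v ^ (β - 1))) with hν
  have hmeas : Measurable fun v : ℝ => v ^ (β - 1) := by fun_prop
  have hmgf : ∀ w : ℂ, complexMGF (fun v : ℝ => -v) ν w
      = ∫ v in Set.Ioi (0 : ℝ), ((v ^ (β - 1) : ℝ) : ℂ) * Complex.exp (-(w * v)) := by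
    intro w
    rw [complexMGF, hν, integral_withDensity_eq_integral_toReal_smul (by fun_prop) (by simp)]
    refine setIntegral_congr_fun measurableSet_Ioi fun v hv => ?_
    have : 0 ≤ v ^ (β - 1) := Real.rpow_nonneg (le_of_lt hv) _
    simp [ENNReal.toReal_ofReal this]
  have hset : Set.Ioi (0 : ℝ) ⊆ interior (integrableExpSet (fun v : ℝ => -v) ν) := by
    refine interior_maximal (fun t ht => ?_) isOpen_Ioi
    rw [integrableExpSet, Set.mem_ofPred_eq, hν,
      integrable_withDensity_iff_integrable_smul' (by fun_prop) (by simp)]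
    refine (integrableOn_rpow_mul_exp_neg (p := β - 1) (by linarith) ht).congr ?_
    filter_upwards [ae_restrict_mem measurableSet_Ioi] with v hv
    have : 0 ≤ v ^ (β - 1) := Real.rpow_nonneg (le_of_lt hv) _
    simp [ENNReal.toReal_ofReal this]
  have hopen : IsOpen {w : ℂ | 0 < w.re} := isOpen_lt continuous_const Complex.continuous_re
  have hF : AnalyticOnNhd ℂ (complexMGF (fun v : ℝ => -v) ν) {w : ℂ | 0 < w.re} :=
    ((differentiableOn_complexMGF).mono fun w hw => hset hw).analyticOnNhd hopen
  have hG : AnalyticOnNhd ℂ (fun w : ℂ => (1 / w) ^ (β : ℂ) * Real.Gamma β)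
      {w : ℂ | 0 < w.re} := by
    refine DifferentiableOn.analyticOnNhd (fun w hw => ?_) hopen
    have hw0 : w ≠ 0 := by rintro rfl; simp at hw
    have h1 : (1 / w) ∈ Complex.slitPlane := by
      refine Or.inl ?_
      rw [one_div, Complex.inv_re]
      exact div_pos hw (Complex.normSq_pos.mpr hw0)
    refine DifferentiableAt.differentiableWithinAt ?_
    exact (((differentiableAt_const _).div differentiableAt_id hw0).cpow
      (differentiableAt_const _) h1).mul_const _
  have hpre : IsPreconnected {w : ℂ | 0 < w.re} :=
    (convex_halfSpace_re_gt 0).isPreconnected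
  have heq : ∀ r : ℝ, 0 < r → complexMGF (fun v : ℝ => -v) ν r
      = (1 / (r : ℂ)) ^ (β : ℂ) * Real.Gamma β := by
    intro r hr
    rw [hmgf, ← Complex.Gamma_ofReal,
      ← Complex.integral_cpow_mul_exp_neg_mul_Ioi (by simpa using hβ) hr]
    refine setIntegral_congr_fun measurableSet_Ioi fun v hv => ?_
    simp [Complex.ofReal_cpow (le_of_lt hv)]
  have hfreq : ∃ᶠ w in nhdsWithin (1 : ℂ) {1}ᶜ, complexMGF (fun v : ℝ => -v) ν w
      = (1 / w) ^ (β : ℂ) * Real.Gamma β := by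
    have htend : Tendsto (fun n : ℕ => ((1 + 1 / ((n : ℝ) + 1) : ℝ) : ℂ)) atTop
        (nhdsWithin 1 {1}ᶜ) := by
      refine tendsto_nhdsWithin_iff.mpr ⟨?_, Eventually.of_forall fun n => ?_⟩
      · have h1 : Tendsto (fun n : ℕ => 1 + 1 / ((n : ℝ) + 1)) atTop (nhds (1 + 0)) :=
          tendsto_const_nhds.add tendsto_one_div_add_atTop_nhds_zero_nat
        rw [add_zero] at h1
        exact (Complex.continuous_ofReal.tendsto 1).comp h1
      · have h2 : (1 : ℝ) / ((n : ℝ) + 1) ≠ 0 := by positivity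
        simp only [Set.mem_compl_iff, Set.mem_singleton_iff]
        intro h3
        apply h2
        have h4 : (1 + 1 / ((n : ℝ) + 1) : ℝ) = 1 := by exact_mod_cast h3
        linarith
    refine htend.frequently (Eventually.of_forall fun n => ?_).frequently
    exact heq _ (by positivity)
  rw [← hmgf]
  exact hF.eqOn_of_preconnected_of_frequently_eq hG hpre (z₀ := 1) (by simp) hfreq hz

theorem norm_integral_rpow_mul_cexp_neg {β : ℝ} (hβ : 0 < β) {z : ℂ} (hz : 0 < z.re) :
    ‖∫ v in Set.Ioi (0 : ℝ), ((v ^ (β - 1) : ℝ) : ℂ) * Complex.exp (-(z * v))‖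
      = Real.Gamma β * ‖z‖ ^ (-β) := by
  have hz0 : z ≠ 0 := by rintro rfl; simp at hz
  rw [integral_rpow_mul_cexp_neg hβ hz, norm_mul, Complex.norm_cpow_real, Complex.norm_real,
    Real.norm_of_nonneg (Real.Gamma_pos_of_pos hβ).le, norm_div, norm_one, one_div,
    Real.inv_rpow (norm_nonneg _), Real.rpow_neg (norm_nonneg _)]
  ring

instance : IsProbabilityMeasure μ01 := ⟨by simp [μ01]⟩

theorem integral_μ01 {E : Type*} [NormedAddCommGroup E] [NormedSpace ℝ E] (f : ℝ → E) :
    ∫ t, f t ∂μ01 = ∫ t in (0 : ℝ)..1, f t := by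
  rw [intervalIntegral.integral_of_le zero_le_one, μ01, integral_Icc_eq_integral_Ioc]

theorem μ01_eq_restrict_Ioc : μ01 = volume.restrict (Set.Ioc (0 : ℝ) 1) :=
  Measure.restrict_congr_set Ioc_ae_eq_Icc.symm

theorem ae_μ01_mem : ∀ᵐ t ∂μ01, t ∈ Set.Ioo (0 : ℝ) 1 := by
  rw [μ01, Measure.restrict_congr_set Ioo_ae_eq_Icc.symm]
  exact ae_restrict_mem measurableSet_Ioo

theorem abs_integral_mul_le {α : Type*} [MeasurableSpace α] {μ : Measure α} {f g : α → ℝ}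
    (hf : MemLp f 2 μ) (hg : MemLp g 2 μ) :
    ∫ x, |f x * g x| ∂μ ≤ √(∫ x, f x ^ 2 ∂μ) * √(∫ x, g x ^ 2 ∂μ) := by
  have h := integral_mul_norm_le_Lp_mul_Lq (μ := μ) (f := f) (g := g) Real.HolderConjugate.two_two
    (by simpa using hf) (by simpa using hg)
  simp only [Real.norm_eq_abs, ← abs_mul] at h
  refine h.trans (le_of_eq ?_)
  simp [Real.sqrt_eq_rpow]

/-- A measurable kernel on the unit interval with uniformly square integrable rows. -/
structure IsRowKernel (k : ℝ → ℝ → ℝ) (M : ℝ) : Prop where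
  meas : Measurable (Function.uncurry k)
  memLp : ∀ r ∈ Set.Ioo (0 : ℝ) 1, MemLp (k r) 2 μ01
  sq_le : ∀ r ∈ Set.Ioo (0 : ℝ) 1, ∫ t, k r t ^ 2 ∂μ01 ≤ M

/-- The integral operator with kernel `k` on the unit interval. -/
noncomputable def kerOp (k : ℝ → ℝ → ℝ) (f : ℝ → ℝ) (r : ℝ) : ℝ := ∫ t, k r t * f t ∂μ01

namespace IsRowKernel

variable {k : ℝ → ℝ → ℝ} {M : ℝ} {f : ℝ → ℝ}

theorem integrable_row (hk : IsRowKernel k M) (hf : MemLp f 2 μ01) {r : ℝ}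
    (hr : r ∈ Set.Ioo (0 : ℝ) 1) : Integrable (fun t => k r t * f t) μ01 :=
  (hk.memLp r hr).integrable_mul hf

theorem integral_abs_le (hk : IsRowKernel k M) (hf : MemLp f 2 μ01) {r : ℝ}
    (hr : r ∈ Set.Ioo (0 : ℝ) 1) :
    ∫ t, |k r t * f t| ∂μ01 ≤ √M * √(∫ t, f t ^ 2 ∂μ01) := by
  refine (abs_integral_mul_le (hk.memLp r hr) hf).trans ?_
  gcongr
  exact hk.sq_le r hr

theorem abs_kerOp_le (hk : IsRowKernel k M) (hf : MemLp f 2 μ01) {r : ℝ}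
    (hr : r ∈ Set.Ioo (0 : ℝ) 1) : |kerOp k f r| ≤ √M * √(∫ t, f t ^ 2 ∂μ01) :=
  (abs_integral_le_integral_abs).trans (hk.integral_abs_le hf hr)

theorem aestronglyMeasurable_prod (hk : IsRowKernel k M) (hf : MemLp f 2 μ01) :
    AEStronglyMeasurable (fun z : ℝ × ℝ => k z.1 z.2 * f z.2) (μ01.prod μ01) :=
  hk.meas.aestronglyMeasurable.mul hf.1.comp_snd

theorem aestronglyMeasurable_kerOp (hk : IsRowKernel k M) (hf : MemLp f 2 μ01) :
    AEStronglyMeasurable (kerOp k f) μ01 :=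
  (hk.aestronglyMeasurable_prod hf).integral_prod_right'

theorem integrable_prod (hk : IsRowKernel k M) (hf : MemLp f 2 μ01) :
    Integrable (fun z : ℝ × ℝ => k z.1 z.2 * f z.2) (μ01.prod μ01) := by
  rw [integrable_prod_iff (hk.aestronglyMeasurable_prod hf)]
  refine ⟨?_, ?_⟩
  · filter_upwards [ae_μ01_mem] with r hr using hk.integrable_row hf hr
  · refine Integrable.of_bound (C := √M * √(∫ t, f t ^ 2 ∂μ01))
      (hk.aestronglyMeasurable_prod hf).norm.integral_prod_right' ?_
    filter_upwards [ae_μ01_mem] with r hr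
    rw [Real.norm_of_nonneg (integral_nonneg fun _ => norm_nonneg _)]
    exact hk.integral_abs_le hf hr

theorem memLp_kerOp (hk : IsRowKernel k M) (hf : MemLp f 2 μ01) : MemLp (kerOp k f) 2 μ01 := by
  refine MemLp.of_bound (hk.aestronglyMeasurable_kerOp hf) (√M * √(∫ t, f t ^ 2 ∂μ01)) ?_
  filter_upwards [ae_μ01_mem] with r hr using hk.abs_kerOp_le hf hr

/-- The quadratic form of the composite kernel `∫ k(r,s) k(r,t) dr`. -/
theorem integral_integral_mul (hk : IsRowKernel k M) (hf : MemLp f 2 μ01) :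
    ∫ s, ∫ t, f s * (∫ r, k r s * k r t ∂μ01) * f t ∂μ01 ∂μ01
      = ∫ r, kerOp k f r ^ 2 ∂μ01 := by
  set F : (ℝ × ℝ) × ℝ → ℝ := fun z => (k z.2 z.1.1 * f z.1.1) * (k z.2 z.1.2 * f z.1.2) with hF
  have hkm1 : Measurable fun z : (ℝ × ℝ) × ℝ => k z.2 z.1.1 :=
    hk.meas.comp (measurable_snd.prodMk (measurable_fst.comp measurable_fst))
  have hkm2 : Measurable fun z : (ℝ × ℝ) × ℝ => k z.2 z.1.2 :=
    hk.meas.comp (measurable_snd.prodMk (measurable_snd.comp measurable_fst))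
  have hFm : AEStronglyMeasurable F ((μ01.prod μ01).prod μ01) := by
    refine (hkm1.aestronglyMeasurable.mul ?_).mul (hkm2.aestronglyMeasurable.mul ?_)
    · exact (hf.1.comp_fst (ν := μ01)).comp_fst
    · exact (hf.1.comp_snd (μ := μ01)).comp_fst
  have hFint : Integrable F ((μ01.prod μ01).prod μ01) := by
    rw [integrable_prod_iff' hFm]
    refine ⟨?_, ?_⟩
    · filter_upwards [ae_μ01_mem] with r hr
      exact (hk.integrable_row hf hr).mul_prod (hk.integrable_row hf hr)
    · have hnorm : ∀ r, ∫ z : ℝ × ℝ, ‖F (z, r)‖ ∂(μ01.prod μ01)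
          = (∫ t, |k r t * f t| ∂μ01) * ∫ t, |k r t * f t| ∂μ01 := by
        intro r
        rw [← integral_prod_mul]
        refine integral_congr_ae (Eventually.of_forall fun z => ?_)
        simp only [hF, Real.norm_eq_abs, abs_mul]
      simp_rw [hnorm]
      have hm : AEStronglyMeasurable (fun r => ∫ t, |k r t * f t| ∂μ01) μ01 :=
        (hk.aestronglyMeasurable_prod hf).norm.integral_prod_right'
      refine Integrable.of_bound (hm.mul hm)
        (C := (√M * √(∫ t, f t ^ 2 ∂μ01)) * (√M * √(∫ t, f t ^ 2 ∂μ01))) ?_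
      filter_upwards [ae_μ01_mem] with r hr
      have h0 : 0 ≤ ∫ t, |k r t * f t| ∂μ01 := integral_nonneg fun _ => abs_nonneg _
      have h1 := hk.integral_abs_le hf hr
      rw [Real.norm_of_nonneg (mul_nonneg h0 h0)]
      exact mul_le_mul h1 h1 h0 (h0.trans h1)
  have h1 : ∀ s t, f s * (∫ r, k r s * k r t ∂μ01) * f t = ∫ r, F ((s, t), r) ∂μ01 := by
    intro s t
    rw [← integral_const_mul, ← integral_mul_const]
    refine integral_congr_ae (Eventually.of_forall fun r => ?_)
    simp only [hF]
    ring
  simp_rw [h1]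
  rw [← integral_prod (fun z : ℝ × ℝ => ∫ r, F (z, r) ∂μ01) hFint.integral_prod_left,
    integral_integral_swap (f := fun z r => F (z, r)) hFint]
  refine integral_congr_ae (Eventually.of_forall fun r => ?_)
  simp only [hF]
  rw [integral_prod_mul (fun t => k r t * f t) (fun t => k r t * f t), kerOp, sq]

end IsRowKernel

/-- The Riemann–Liouville kernel. -/
noncomputable def rlKer (p r t : ℝ) : ℝ := if r < t then (t - r) ^ p else 0

theorem measurable_rlKer (p : ℝ) : Measurable (Function.uncurry (rlKer p)) := by
  refine Measurable.ite (measurableSet_lt measurable_fst measurable_snd) ?_ measurable_const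
  exact (measurable_snd.sub measurable_fst).pow_const p

theorem intervalIntegrable_sub_rpow {p : ℝ} (hp : -1 < p) (r a b : ℝ) :
    IntervalIntegrable (fun t => (t - r) ^ p) volume a b := by
  have h := (intervalIntegral.intervalIntegrable_rpow' (r := p) hp (a := a - r)
    (b := b - r)).comp_sub_right r
  simpa using h

theorem isRowKernel_rlKer {p : ℝ} (hp : -1 / 2 < p) :
    IsRowKernel (rlKer p) (1 / (2 * p + 1)) := by
  have hsq : ∀ r t, rlKer p r t ^ 2 = (Set.Ioi r).indicator (fun t => (t - r) ^ (2 * p)) t := by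
    intro r t
    rw [rlKer, Set.indicator_apply]
    simp only [Set.mem_Ioi]
    split_ifs with h
    · rw [← Real.rpow_natCast, ← Real.rpow_mul (by linarith)]
      norm_num [mul_comm]
    · simp
  have hint : ∀ r ∈ Set.Ioo (0 : ℝ) 1, Integrable (fun t => rlKer p r t ^ 2) μ01 := by
    intro r hr
    simp_rw [hsq]
    rw [integrable_indicator_iff measurableSet_Ioi, IntegrableOn, μ01,
      Measure.restrict_restrict measurableSet_Ioi]
    have h := (intervalIntegrable_sub_rpow (p := 2 * p) (by linarith) r r 1).1
    refine h.mono_set fun t ht => ⟨ht.1, ht.2.2⟩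
  refine ⟨measurable_rlKer p, fun r hr => ?_, fun r hr => ?_⟩
  · rw [memLp_two_iff_integrable_sq]
    · exact hint r hr
    · exact ((measurable_rlKer p).comp measurable_prodMk_left).aestronglyMeasurable
  · simp_rw [hsq]
    rw [integral_indicator measurableSet_Ioi, μ01, Measure.restrict_restrict measurableSet_Ioi]
    have hset : Set.Ioi r ∩ Set.Icc 0 1 = Set.Ioc r 1 := by
      ext t
      simp only [Set.mem_inter_iff, Set.mem_Ioi, Set.mem_Icc, Set.mem_Ioc]
      exact ⟨fun h => ⟨h.1, h.2.2⟩, fun h => ⟨h.1, (hr.1.trans h.1).le, h.2⟩⟩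
    rw [hset, ← intervalIntegral.integral_of_le hr.2.le,
      intervalIntegral.integral_comp_sub_right (fun t => t ^ (2 * p)) r,
      integral_rpow (Or.inl (by linarith)), sub_self, Real.zero_rpow (by linarith), sub_zero]
    have h1 : (1 - r) ^ (2 * p + 1) ≤ 1 :=
      Real.rpow_le_one (by linarith [hr.2]) (by linarith [hr.1]) (by linarith)
    have h2 : 0 < 2 * p + 1 := by linarith
    gcongr

theorem rlKernel_eq (ρ : ℝ) {s t : ℝ} (hs : s ∈ Set.Ioo (0 : ℝ) 1) (ht : t ∈ Set.Ioo (0 : ℝ) 1) :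
    rlKernel ρ s t = ∫ r, rlKer (ρ - 1 / 2) r s * rlKer (ρ - 1 / 2) r t ∂μ01 := by
  have h : ∀ r, rlKer (ρ - 1 / 2) r s * rlKer (ρ - 1 / 2) r t = (Set.Iio (min s t)).indicator
      (fun r => (t - r) ^ (ρ - 1 / 2) * (s - r) ^ (ρ - 1 / 2)) r := by
    intro r
    rw [rlKer, rlKer, Set.indicator_apply]
    simp only [Set.mem_Iio, lt_min_iff]
    split_ifs with h1 h2 h3 h3 h2 h3 h3 <;> simp_all [mul_comm]
  have hset : Set.Iio (min s t) ∩ Set.Icc 0 1 = Set.Ico 0 (min s t) := by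
    ext r
    simp only [Set.mem_inter_iff, Set.mem_Iio, Set.mem_Icc, Set.mem_Ico]
    refine ⟨fun h => ⟨h.2.1, h.1⟩, fun h => ⟨h.2, h.1, ?_⟩⟩
    exact (h.2.trans_le (min_le_left _ _)).le.trans hs.2.le
  simp_rw [h]
  rw [integral_indicator measurableSet_Iio, μ01, Measure.restrict_restrict measurableSet_Iio, hset,
    rlKernel, intervalIntegral.integral_of_le (le_min hs.1.le ht.1.le), ← integral_Icc_eq_integral_Ioc,
    integral_Icc_eq_integral_Ico]

theorem integral_rlKernel {ρ : ℝ} (hρ : 0 < ρ) {f : ℝ → ℝ} (hf : MemLp f 2 μ01) :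
    ∫ s in (0 : ℝ)..1, (∫ t in (0 : ℝ)..1, f s * rlKernel ρ s t * f t)
      = ∫ r, kerOp (rlKer (ρ - 1 / 2)) f r ^ 2 ∂μ01 := by
  rw [← (isRowKernel_rlKer (p := ρ - 1 / 2) (by linarith)).integral_integral_mul hf]
  simp_rw [← integral_μ01]
  refine integral_congr_ae ?_
  filter_upwards [ae_μ01_mem] with s hs
  refine integral_congr_ae ?_
  filter_upwards [ae_μ01_mem] with t ht
  rw [rlKernel_eq ρ hs ht]

theorem summable_exp_mul_rpow {a : ℝ} (ha : 0 < a) (p : ℝ) :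
    Summable fun n : ℕ => rexp (-(a * n)) * ((n : ℝ) + 2) ^ |p| := by
  obtain ⟨m, hm⟩ := exists_nat_ge |p|
  have h := (summable_nat_add_iff 2).2 (summable_pow_mul_exp_neg_nat_mul m ha)
  refine Summable.of_nonneg_of_le (fun n => by positivity) (fun n => ?_) (h.mul_left (rexp (a * 2)))
  have h1 : ((n : ℝ) + 2) ^ |p| ≤ ((n : ℝ) + 2) ^ m := by
    rw [← Real.rpow_natCast]
    exact Real.rpow_le_rpow_of_exponent_le (by linarith [n.cast_nonneg (α := ℝ)]) hm
  have h2 : rexp (-(a * n)) = rexp (a * 2) * rexp (-a * ((n + 2 : ℕ) : ℝ)) := by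
    rw [← Real.exp_add]
    congr 1
    push_cast
    ring
  rw [h2]
  push_cast
  calc rexp (a * 2) * rexp (-a * (n + 2)) * ((n : ℝ) + 2) ^ |p|
      ≤ rexp (a * 2) * rexp (-a * (n + 2)) * ((n : ℝ) + 2) ^ m := by gcongr
    _ = _ := by ring

/-- The exponentially damped sum of the translates of the power function. -/
noncomputable def tailSum (a p v : ℝ) : ℝ := ∑' n : ℕ, rexp (-(a * n)) * |v + n| ^ p

/-- The constant controlling `tailSum` on `(0, 2]`. -/
noncomputable def tailConst (a p : ℝ) : ℝ := ∑' n : ℕ, rexp (-(a * n)) * ((n : ℝ) + 2) ^ |p|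

theorem tailConst_nonneg (a p : ℝ) : 0 ≤ tailConst a p := tsum_nonneg fun n => by positivity

theorem tailSum_nonneg (a p v : ℝ) : 0 ≤ tailSum a p v := tsum_nonneg fun n => by positivity

theorem measurable_tailSum (a p : ℝ) : Measurable (tailSum a p) := by
  refine Measurable.tsum fun n => ?_
  exact (((measurable_id.add_const _).abs).pow_const _).const_mul _

theorem rpow_add_nat_le {v : ℝ} (hv : 0 < v) (hv2 : v ≤ 2) (p : ℝ) (n : ℕ) :
    |v + n| ^ p ≤ ((n : ℝ) + 2) ^ |p| * (v ^ p + 1) := by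
  have hn : (0 : ℝ) ≤ n := n.cast_nonneg
  rw [abs_of_pos (by linarith)]
  have h1 : (1 : ℝ) ≤ ((n : ℝ) + 2) ^ |p| := Real.one_le_rpow (by linarith) (abs_nonneg _)
  have h2 : 0 < v ^ p := Real.rpow_pos_of_pos hv p
  rcases le_total 0 p with hp | hp
  · have h3 : (v + n) ^ p ≤ ((n : ℝ) + 2) ^ |p| := by
      rw [abs_of_nonneg hp]
      exact Real.rpow_le_rpow (by linarith) (by linarith) hp
    nlinarith
  · have h3 : (v + n) ^ p ≤ v ^ p := Real.rpow_le_rpow_of_nonpos hv (by linarith) hp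
    nlinarith

theorem summable_tailSum {a : ℝ} (ha : 0 < a) (p : ℝ) {v : ℝ} (hv : 0 < v) (hv2 : v ≤ 2) :
    Summable fun n : ℕ => rexp (-(a * n)) * |v + n| ^ p := by
  refine Summable.of_nonneg_of_le (fun n => by positivity) (fun n => ?_)
    ((summable_exp_mul_rpow ha p).mul_right (v ^ p + 1))
  rw [mul_assoc]
  gcongr
  exact rpow_add_nat_le hv hv2 p n

theorem tailSum_le {a : ℝ} (ha : 0 < a) (p : ℝ) {v : ℝ} (hv : 0 < v) (hv2 : v ≤ 2) :
    tailSum a p v ≤ tailConst a p * (v ^ p + 1) := by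
  rw [tailSum, tailConst, ← tsum_mul_right]
  refine (summable_tailSum ha p hv hv2).tsum_le_tsum (fun n => ?_)
    ((summable_exp_mul_rpow ha p).mul_right _)
  rw [mul_assoc]
  gcongr
  exact rpow_add_nat_le hv hv2 p n

theorem rpow_le_add_two_rpow {t v : ℝ} (ht : 0 < t) (htv : t ≤ v) (hv2 : v ≤ 2) (p : ℝ) :
    v ^ p ≤ t ^ p + 2 ^ |p| := by
  have h0 : 0 < t ^ p := Real.rpow_pos_of_pos ht p
  have h1 : (0 : ℝ) < 2 ^ |p| := by positivity
  rcases le_total 0 p with hp | hp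
  · have := Real.rpow_le_rpow (by linarith) hv2 hp
    rw [abs_of_nonneg hp] at h1 ⊢
    linarith
  · have := Real.rpow_le_rpow_of_nonpos ht htv hp
    linarith

theorem memLp_rpow {p : ℝ} (hp : -1 / 2 < p) : MemLp (fun t : ℝ => t ^ p) 2 μ01 := by
  rw [memLp_two_iff_integrable_sq (f := fun t : ℝ => t ^ p)
      (measurable_id.pow_const p).aestronglyMeasurable,
    μ01_eq_restrict_Ioc]
  have h := (intervalIntegral.intervalIntegrable_rpow' (r := 2 * p) (by linarith)
    (a := 0) (b := 1)).1
  refine (integrableOn_congr_fun (fun t ht => ?_) measurableSet_Ioc).1 h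
  rw [← Real.rpow_natCast, ← Real.rpow_mul ht.1.le]
  norm_num [mul_comm]

theorem tailSum_le_of_le {a : ℝ} (ha : 0 < a) (p : ℝ) {t v : ℝ} (ht : 0 < t) (htv : t ≤ v)
    (hv2 : v ≤ 2) : tailSum a p v ≤ tailConst a p * (t ^ p + (2 ^ |p| + 1)) := by
  refine (tailSum_le ha p (ht.trans_le htv) hv2).trans ?_
  have := rpow_le_add_two_rpow ht htv hv2 p
  have h0 := tailConst_nonneg a p
  exact mul_le_mul_of_nonneg_left (by linarith) h0

/-- The kernel of the smooth remainder operator. -/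
noncomputable def remKer (a p r t : ℝ) : ℝ := tailSum a p (1 - r + t)

/-- The row bound of `remKer`. -/
noncomputable def remConst (a p : ℝ) : ℝ :=
  ∫ t, (tailConst a p * (t ^ p + (2 ^ |p| + 1))) ^ 2 ∂μ01

theorem isRowKernel_remKer {a p : ℝ} (ha : 0 < a) (hp : -1 / 2 < p) :
    IsRowKernel (remKer a p) (remConst a p) := by
  have hm : Measurable (Function.uncurry (remKer a p)) :=
    (measurable_tailSum a p).comp
      ((measurable_const.sub measurable_fst).add measurable_snd)
  have hdom : MemLp (fun t : ℝ => tailConst a p * (t ^ p + (2 ^ |p| + 1))) 2 μ01 :=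
    ((memLp_rpow hp).add (memLp_const _)).const_mul _
  have hle : ∀ r ∈ Set.Ioo (0 : ℝ) 1, ∀ᵐ t ∂μ01,
      remKer a p r t ≤ tailConst a p * (t ^ p + (2 ^ |p| + 1)) := by
    intro r hr
    filter_upwards [ae_μ01_mem] with t ht
    exact tailSum_le_of_le ha p ht.1 (by linarith [hr.2]) (by linarith [hr.1, ht.2])
  have hmem : ∀ r ∈ Set.Ioo (0 : ℝ) 1, MemLp (remKer a p r) 2 μ01 := by
    intro r hr
    refine hdom.mono' (hm.comp measurable_prodMk_left).aestronglyMeasurable ?_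
    filter_upwards [hle r hr] with t ht
    rw [remKer, Real.norm_of_nonneg (tailSum_nonneg _ _ _)]
    exact ht
  refine ⟨hm, hmem, fun r hr => ?_⟩
  refine integral_mono_ae (hmem r hr).integrable_sq hdom.integrable_sq ?_
  filter_upwards [hle r hr] with t ht
  exact pow_le_pow_left₀ (tailSum_nonneg _ _ _) ht 2

theorem exists_one_add_rpow_taylor (p B : ℝ) (hB : 0 ≤ B) (n : ℕ) :
    ∃ c : ℕ → ℝ, ∃ C, 0 ≤ C ∧ ∀ s, 0 ≤ s → s ≤ B →
      |(1 + s) ^ p - ∑ k ∈ Finset.range (n + 1), c k * s ^ k| ≤ C * s ^ (n + 1) := by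
  have hd : ContDiffOn ℝ (n + 1) (fun s : ℝ => (1 + s) ^ p) (Set.Icc 0 B) := by
    refine ContDiffOn.rpow_const_of_ne (contDiffOn_const.add contDiffOn_id) fun s hs => ?_
    have : 0 ≤ s := hs.1
    positivity
  obtain ⟨C, hC⟩ := exists_taylor_mean_remainder_bound hB hd
  refine ⟨fun k => ((k.factorial : ℝ))⁻¹ *
    iteratedDerivWithin k (fun s : ℝ => (1 + s) ^ p) (Set.Icc 0 B) 0, |C|, abs_nonneg C,
    fun s hs hsB => ?_⟩
  have h := hC s ⟨hs, hsB⟩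
  rw [taylor_within_apply, Real.norm_eq_abs] at h
  simp only [sub_zero, smul_eq_mul] at h
  have h2 : C * s ^ (n + 1) ≤ |C| * s ^ (n + 1) := by
    have := le_abs_self C
    gcongr
  refine le_trans (le_of_eq ?_) (h.trans h2)
  congr 2
  refine Finset.sum_congr rfl fun k _ => ?_
  ring

theorem tailSum_taylor {a p : ℝ} (ha : 0 < a) {c : ℕ → ℝ} {C B : ℝ} {q : ℕ} (hC : 0 ≤ C)
    (hc : ∀ s, 0 ≤ s → s ≤ B →
      |(1 + s) ^ p - ∑ k ∈ Finset.range q, c k * s ^ k| ≤ C * s ^ q)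
    {v w σ : ℝ} (hw : 0 < w) (hwv : w ≤ v) (hv2 : v ≤ 2) (hB : v - w ≤ B * w)
    (hσ : v - w ≤ σ * w) :
    |tailSum a p v - ∑ k ∈ Finset.range q, c k * (v - w) ^ k * tailSum a (p - k) w|
      ≤ C * σ ^ q * tailSum a p w := by
  have hw2 : w ≤ 2 := hwv.trans hv2
  have hv : 0 < v := hw.trans_le hwv
  have hterm : ∀ n : ℕ, |rexp (-(a * n)) * |v + n| ^ p
      - ∑ k ∈ Finset.range q, c k * (v - w) ^ k * (rexp (-(a * n)) * |w + n| ^ (p - k))|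
      ≤ C * σ ^ q * (rexp (-(a * n)) * |w + n| ^ p) := by
    intro n
    have hn : (0 : ℝ) ≤ n := n.cast_nonneg
    have hwn : 0 < w + n := by linarith
    rw [abs_of_pos hwn, abs_of_pos (by linarith : 0 < v + n)]
    set s : ℝ := (v - w) / (w + n) with hs
    have hs0 : 0 ≤ s := div_nonneg (by linarith) hwn.le
    have hsw : s ≤ (v - w) / w := by
      rw [hs]
      have : 0 ≤ v - w := by linarith
      gcongr
      linarith
    have hsB : s ≤ B := hsw.trans ((div_le_iff₀ hw).2 hB)
    have hsσ : s ≤ σ := hsw.trans ((div_le_iff₀ hw).2 hσ)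
    have hmul : v + n = (w + n) * (1 + s) := by
      rw [hs]
      field_simp
      ring
    have hpow : (v + n) ^ p = (w + n) ^ p * (1 + s) ^ p := by
      rw [hmul, Real.mul_rpow hwn.le (by linarith)]
    have hk : ∀ k : ℕ, (v - w) ^ k * (w + n) ^ (p - k) = (w + n) ^ p * s ^ k := by
      intro k
      rw [Real.rpow_sub hwn, Real.rpow_natCast, hs, div_pow]
      ring
    have heq : rexp (-(a * n)) * (v + n) ^ p
        - ∑ k ∈ Finset.range q, c k * (v - w) ^ k * (rexp (-(a * n)) * (w + n) ^ (p - k))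
        = rexp (-(a * n)) * (w + n) ^ p *
          ((1 + s) ^ p - ∑ k ∈ Finset.range q, c k * s ^ k) := by
      rw [hpow, mul_sub, Finset.mul_sum]
      congr 1
      · ring
      · refine Finset.sum_congr rfl fun k _ => ?_
        linear_combination c k * rexp (-(a * n)) * hk k
    rw [heq, abs_mul, abs_of_nonneg (by positivity : 0 ≤ rexp (-(a * n)) * (w + n) ^ p)]
    have h1 : |(1 + s) ^ p - ∑ k ∈ Finset.range q, c k * s ^ k| ≤ C * σ ^ q :=
      (hc s hs0 hsB).trans (by gcongr)
    rw [mul_comm (C * σ ^ q)]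
    gcongr
  have hsum2 : ∀ k ∈ Finset.range q,
      Summable fun n : ℕ => c k * (v - w) ^ k * (rexp (-(a * n)) * |w + n| ^ (p - k)) :=
    fun k _ => (summable_tailSum ha (p - k) hw hw2).mul_left _
  have h2 : ∑ k ∈ Finset.range q, c k * (v - w) ^ k * tailSum a (p - k) w
      = ∑' n : ℕ, ∑ k ∈ Finset.range q,
        c k * (v - w) ^ k * (rexp (-(a * n)) * |w + n| ^ (p - k)) := by
    rw [Summable.tsum_finsetSum hsum2]
    refine Finset.sum_congr rfl fun k _ => ?_
    rw [tailSum, tsum_mul_left]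
  have hs1 := summable_tailSum ha p hv hv2
  have hs2 := summable_sum hsum2
  have hs3 := (summable_tailSum ha p hw hw2).mul_left (C * σ ^ q)
  rw [h2, tailSum, ← hs1.tsum_sub hs2, tailSum, ← tsum_mul_left]
  refine abs_le.2 ⟨?_, ?_⟩
  · rw [← tsum_neg]
    exact hs3.neg.tsum_le_tsum (fun n => (abs_le.1 (hterm n)).1) (hs1.sub hs2)
  · exact (hs1.sub hs2).tsum_le_tsum (fun n => (abs_le.1 (hterm n)).2) hs3

theorem one_add_pow_sub_one_le {u : ℝ} (hu : 0 ≤ u) (hu1 : u ≤ 1) (k : ℕ) :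
    (1 + u) ^ k - 1 ≤ 2 ^ k * u := by
  induction k with
  | zero => simpa using hu
  | succ k ih =>
    have h : (1 + u) ^ k ≤ 2 ^ k := pow_le_pow_left₀ (by linarith) (by linarith) k
    rw [pow_succ, pow_succ]
    nlinarith

/-- The graded mesh: the node below `y ^ κ` is relatively close to it. -/
theorem graded_mesh {y : ℝ} (hy : 0 < y) {N κ : ℕ} {i : ℕ} (hN : 1 ≤ N) (hI : ⌊N * y⌋₊ = i)
    (hi : 1 ≤ i) {w : ℝ} (hw : w = ((i : ℝ) / N) ^ κ) :
    0 < w ∧ w ≤ y ^ κ ∧ y ^ κ - w ≤ 2 ^ κ * w ∧ y ^ κ - w ≤ 2 ^ (κ + 1) / (N * y) * w := by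
  have hN0 : (0 : ℝ) < N := by exact_mod_cast hN
  have hi0 : (1 : ℝ) ≤ i := by exact_mod_cast hi
  have hle : (i : ℝ) ≤ N * y := by
    rw [← hI]
    exact Nat.floor_le (by positivity)
  have hlt : N * y < i + 1 := by
    rw [← hI]
    exact Nat.lt_floor_add_one _
  have hw0 : 0 < w := by
    rw [hw]
    positivity
  have hwy : w ≤ y ^ κ := by
    rw [hw]
    refine pow_le_pow_left₀ (by positivity) ?_ κ
    rw [div_le_iff₀ hN0]
    linarith
  have hyw : y ^ κ ≤ w * (1 + 1 / i) ^ κ := by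
    rw [hw, ← mul_pow]
    refine pow_le_pow_left₀ hy.le ?_ κ
    have : (i : ℝ) / N * (1 + 1 / i) = (i + 1) / N := by field_simp
    rw [this, le_div_iff₀ hN0]
    linarith
  have h1i : 1 / (i : ℝ) ≤ 1 := by
    rw [div_le_one (by linarith)]
    exact hi0
  have hd := one_add_pow_sub_one_le (by positivity : (0 : ℝ) ≤ 1 / i) h1i κ
  have hmain : y ^ κ - w ≤ 2 ^ κ * (1 / i) * w := by nlinarith
  refine ⟨hw0, hwy, hmain.trans ?_, hmain.trans ?_⟩
  · gcongr
    have : (0 : ℝ) < 2 ^ κ := by positivity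
    nlinarith
  · gcongr
    rw [pow_succ, mul_div_assoc]
    refine mul_le_mul_of_nonneg_left ?_ (by positivity)
    rw [div_le_div_iff₀ (by linarith) (by positivity)]
    linarith

theorem integral_sq_eq_norm_sq (f : Lp ℝ 2 μ01) : ∫ t, f t ^ 2 ∂μ01 = ‖f‖ ^ 2 := by
  rw [← real_inner_self_eq_norm_sq, L2.inner_def]
  refine integral_congr_ae (Eventually.of_forall fun t => ?_)
  simp [sq]

theorem sqrt_integral_sq (f : Lp ℝ 2 μ01) : √(∫ t, f t ^ 2 ∂μ01) = ‖f‖ := by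
  rw [integral_sq_eq_norm_sq, Real.sqrt_sq (norm_nonneg f)]

/-- Integration against a square integrable function, as a linear functional. -/
noncomputable def integralFunctional (g : ℝ → ℝ) : Lp ℝ 2 μ01 →ₗ[ℝ] ℝ :=
  open Classical in
  if h : MemLp g 2 μ01 then (innerSL ℝ (h.toLp g)).toLinearMap else 0

theorem integralFunctional_apply {g : ℝ → ℝ} (hg : MemLp g 2 μ01) (f : Lp ℝ 2 μ01) :
    integralFunctional g f = ∫ t, g t * f t ∂μ01 := by
  rw [integralFunctional, dif_pos hg]
  simp only [ContinuousLinearMap.coe_coe, innerSL_apply_apply]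
  rw [L2.inner_def]
  refine integral_congr_ae ?_
  filter_upwards [hg.coeFn_toLp] with t ht
  simp [ht, mul_comm]

theorem memLp_tailSum {a : ℝ} (ha : 0 < a) (p : ℝ) {w : ℝ} (hw : 0 < w) (hw1 : w ≤ 1) :
    MemLp (fun t => tailSum a p (w + t)) 2 μ01 := by
  refine MemLp.of_bound
    ((measurable_tailSum a p).comp (measurable_const.add measurable_id)).aestronglyMeasurable
    (tailConst a p * (w ^ p + (2 ^ |p| + 1))) ?_
  filter_upwards [ae_μ01_mem] with t ht
  rw [Real.norm_of_nonneg (tailSum_nonneg _ _ _)]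
  exact tailSum_le_of_le ha p hw (by linarith [ht.1]) (by linarith [ht.2])

theorem abs_kerOp_remKer_le {a p : ℝ} (ha : 0 < a) (hp : -1 / 2 < p) {c : ℕ → ℝ} {C : ℝ}
    {q κ N : ℕ} (hC : 0 ≤ C)
    (hc : ∀ s, 0 ≤ s → s ≤ 2 ^ κ →
      |(1 + s) ^ p - ∑ k ∈ Finset.range q, c k * s ^ k| ≤ C * s ^ q)
    (hN : 1 ≤ N) (f : Lp ℝ 2 μ01)
    (hf : ∀ i < N, ∀ k < q,
      integralFunctional (fun t => tailSum a (p - k) (((i : ℝ) / N) ^ κ + t)) f = 0)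
    {r y : ℝ} (hr : r ∈ Set.Ioo (0 : ℝ) 1) (hy : 0 < y) (hy1 : y < 1) (hyr : y ^ κ = 1 - r) :
    |kerOp (remKer a p) f r|
      ≤ (C * (2 ^ (κ + 1)) ^ q + 1) * (1 / (N * y)) ^ q * (√(remConst a p) * ‖f‖) := by
  have hN0 : (0 : ℝ) < N := by exact_mod_cast hN
  have hK := isRowKernel_remKer ha hp
  have hfm : MemLp f 2 μ01 := Lp.memLp f
  obtain ⟨i, hI⟩ : ∃ i, ⌊N * y⌋₊ = i := ⟨_, rfl⟩
  rcases Nat.eq_zero_or_pos i with hi | hi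
  · have h1 := hK.abs_kerOp_le hfm hr
    rw [sqrt_integral_sq] at h1
    refine h1.trans (le_mul_of_one_le_left (by positivity) ?_)
    rw [hi, Nat.floor_eq_zero] at hI
    have h2 : 1 ≤ (1 / (N * y)) ^ q := by
      refine one_le_pow₀ ?_
      rw [le_div_iff₀ (by positivity)]
      linarith
    have h3 : 1 ≤ C * (2 ^ (κ + 1)) ^ q + 1 := by
      have : 0 ≤ C * (2 ^ (κ + 1)) ^ q := by positivity
      linarith
    nlinarith
  · obtain ⟨w, hw⟩ : ∃ w : ℝ, w = ((i : ℝ) / N) ^ κ := ⟨_, rfl⟩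
    obtain ⟨hw0, hwy, hd1, hd2⟩ := graded_mesh hy hN hI hi hw
    have hw1 : w < 1 := by linarith [hr.1]
    have hiN : i < N := by
      have h1 : (i : ℝ) ≤ N * y := by
        rw [← hI]
        exact Nat.floor_le (by positivity)
      have h2 : (i : ℝ) < N := by nlinarith
      exact_mod_cast h2
    have hr' : 1 - w ∈ Set.Ioo (0 : ℝ) 1 := ⟨by linarith, by linarith⟩
    obtain ⟨σ, hσ⟩ : ∃ σ : ℝ, σ = 2 ^ (κ + 1) / (N * y) := ⟨_, rfl⟩
    rw [← hσ] at hd2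
    have hσ0 : 0 ≤ σ := by
      rw [hσ]
      positivity
    have hzero : ∀ k ∈ Finset.range q, ∫ t, tailSum a (p - k) (w + t) * f t ∂μ01 = 0 := by
      intro k hk
      rw [← integralFunctional_apply (memLp_tailSum ha _ hw0 hw1.le), hw]
      exact hf i hiN k (Finset.mem_range.1 hk)
    have hint : ∀ k ∈ Finset.range q, Integrable
        (fun t => c k * (y ^ κ - w) ^ k * (tailSum a (p - k) (w + t) * f t)) μ01 := fun k _ =>
      ((memLp_tailSum ha _ hw0 hw1.le).integrable_mul hfm).const_mul _
    have heq : kerOp (remKer a p) f r = ∫ t, (remKer a p r t * f t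
        - ∑ k ∈ Finset.range q, c k * (y ^ κ - w) ^ k * (tailSum a (p - k) (w + t) * f t))
          ∂μ01 := by
      rw [integral_sub (hK.integrable_row hfm hr) (integrable_finsetSum _ hint),
        integral_finsetSum _ hint, Finset.sum_eq_zero, sub_zero, kerOp]
      intro k hk
      rw [integral_const_mul, hzero k hk, mul_zero]
    rw [heq]
    refine abs_integral_le_integral_abs.trans ?_
    have hbound : ∫ t, |remKer a p r t * f t
        - ∑ k ∈ Finset.range q, c k * (y ^ κ - w) ^ k * (tailSum a (p - k) (w + t) * f t)| ∂μ01
        ≤ ∫ t, C * σ ^ q * |remKer a p (1 - w) t * f t| ∂μ01 := by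
      refine integral_mono_ae
        ((hK.integrable_row hfm hr).sub (integrable_finsetSum _ hint)).abs
        ((hK.integrable_row hfm hr').abs.const_mul _) ?_
      filter_upwards [ae_μ01_mem] with t ht
      have hwt : y ^ κ - w ≤ 2 ^ κ * (w + t) := by
        have : (0 : ℝ) ≤ 2 ^ κ * t := mul_nonneg (by positivity) ht.1.le
        linarith
      have hwt2 : y ^ κ - w ≤ σ * (w + t) := by
        have : 0 ≤ σ * t := mul_nonneg hσ0 ht.1.le
        linarith
      have h := tailSum_taylor ha hC hc (v := y ^ κ + t) (w := w + t) (σ := σ)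
        (by linarith [ht.1]) (by linarith) (by linarith [ht.2, hr.1])
        (by linarith) (by linarith)
      have hdiff : y ^ κ + t - (w + t) = y ^ κ - w := by ring
      rw [hdiff] at h
      have e1 : remKer a p r t = tailSum a p (y ^ κ + t) := by rw [remKer, hyr]
      have e2 : remKer a p (1 - w) t = tailSum a p (w + t) := by
        rw [remKer]
        congr 1
        ring
      have e3 : remKer a p r t * f t - ∑ k ∈ Finset.range q,
          c k * (y ^ κ - w) ^ k * (tailSum a (p - k) (w + t) * f t)
          = (tailSum a p (y ^ κ + t) - ∑ k ∈ Finset.range q,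
          c k * (y ^ κ - w) ^ k * tailSum a (p - k) (w + t)) * f t := by
        rw [e1, sub_mul, Finset.sum_mul]
        congr 1
        refine Finset.sum_congr rfl fun k _ => ?_
        ring
      rw [e3, e2, abs_mul, abs_mul, abs_of_nonneg (tailSum_nonneg a p (w + t)), ← mul_assoc]
      gcongr
    refine hbound.trans ?_
    rw [integral_const_mul]
    have h4 := hK.integral_abs_le hfm hr'
    rw [sqrt_integral_sq] at h4
    have h5 : C * σ ^ q ≤ (C * (2 ^ (κ + 1)) ^ q + 1) * (1 / (N * y)) ^ q := by
      have : σ ^ q = (2 ^ (κ + 1)) ^ q * (1 / (N * y)) ^ q := by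
        rw [hσ, ← mul_pow]
        congr 1
        ring
      rw [this]
      have : 0 ≤ (1 / (N * y)) ^ q := by positivity
      nlinarith
    exact mul_le_mul h5 h4 (integral_nonneg fun _ => abs_nonneg _) (by positivity)

theorem memLp_one_sub_rpow {p : ℝ} (hp : -1 / 2 < p) :
    MemLp (fun t : ℝ => (1 - t) ^ p) 2 μ01 := by
  rw [memLp_two_iff_integrable_sq (f := fun t : ℝ => (1 - t) ^ p)
      ((measurable_const.sub measurable_id).pow_const p).aestronglyMeasurable,
    μ01_eq_restrict_Ioc]
  have h0 := (intervalIntegral.intervalIntegrable_rpow' (r := 2 * p) (by linarith)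
    (a := 0) (b := 1)).comp_sub_left 1
  rw [sub_zero, sub_self] at h0
  refine (integrableOn_congr_fun (fun t ht => ?_) measurableSet_Ioc).1 h0.2
  have h1 : (0 : ℝ) ≤ 1 - t := by linarith [ht.2]
  rw [← Real.rpow_natCast, ← Real.rpow_mul h1]
  norm_num [mul_comm]

/-- The remainder operator is negligible off a subspace of small codimension. -/
theorem exists_functionals_remKer {a p : ℝ} (ha : 0 < a) (hp : -1 / 2 < p) (n : ℕ) :
    ∃ D, 0 ≤ D ∧ ∀ N : ℕ, 1 ≤ N → ∃ L : Finset (Lp ℝ 2 μ01 →ₗ[ℝ] ℝ),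
      L.card ≤ N * (n + 1) ∧ ∀ f : Lp ℝ 2 μ01, (∀ l ∈ L, l f = 0) →
        √(∫ r, kerOp (remKer a p) f r ^ 2 ∂μ01) ≤ D / (N : ℝ) ^ (n + 1) * ‖f‖ := by
  classical
  obtain ⟨κ, hκ⟩ : ∃ κ : ℕ, κ = 4 * (n + 1) := ⟨_, rfl⟩
  obtain ⟨c, C, hC, hc⟩ := exists_one_add_rpow_taylor p (2 ^ κ) (by positivity) n
  have hW : MemLp (fun t : ℝ => (1 - t) ^ (-1 / 4 : ℝ)) 2 μ01 := memLp_one_sub_rpow (by norm_num)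
  obtain ⟨A, hA⟩ : ∃ A, A = (C * (2 ^ (κ + 1)) ^ (n + 1) + 1) * √(remConst a p) := ⟨_, rfl⟩
  have hA0 : 0 ≤ A := by
    rw [hA]
    positivity
  refine ⟨A * √(∫ r, ((1 - r) ^ (-1 / 4 : ℝ)) ^ 2 ∂μ01), by positivity, fun N hN => ?_⟩
  have hN0 : (0 : ℝ) < N := by exact_mod_cast hN
  refine ⟨(Finset.range N ×ˢ Finset.range (n + 1)).image fun z : ℕ × ℕ =>
    integralFunctional fun t => tailSum a (p - z.2) (((z.1 : ℝ) / N) ^ κ + t), ?_, ?_⟩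
  · refine Finset.card_image_le.trans ?_
    simp
  · intro f hf
    have hf' : ∀ i < N, ∀ k < n + 1,
        integralFunctional (fun t => tailSum a (p - k) (((i : ℝ) / N) ^ κ + t)) f = 0 :=
      fun i hi k hk => hf _ (Finset.mem_image.2 ⟨(i, k), by simp [hi, hk], rfl⟩)
    have hpt : ∀ r ∈ Set.Ioo (0 : ℝ) 1, kerOp (remKer a p) f r ^ 2
        ≤ (A / (N : ℝ) ^ (n + 1) * ‖f‖) ^ 2 * ((1 - r) ^ (-1 / 4 : ℝ)) ^ 2 := by
      intro r hr
      have hx : 0 < 1 - r := by linarith [hr.2]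
      have hκ0 : κ ≠ 0 := by omega
      have hy : (0 : ℝ) < (1 - r) ^ (1 / (κ : ℝ)) := Real.rpow_pos_of_pos hx _
      have hy1 : (1 - r) ^ (1 / (κ : ℝ)) < 1 :=
        Real.rpow_lt_one hx.le (by linarith [hr.1]) (by positivity)
      have hyr : ((1 - r) ^ (1 / (κ : ℝ))) ^ κ = 1 - r := by
        rw [one_div, Real.rpow_inv_natCast_pow hx.le hκ0]
      have h := abs_kerOp_remKer_le ha hp hC hc hN f hf' hr hy hy1 hyr
      have hpow : (1 / (N * (1 - r) ^ (1 / (κ : ℝ)))) ^ (n + 1)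
          = 1 / (N : ℝ) ^ (n + 1) * (1 - r) ^ (-1 / 4 : ℝ) := by
        rw [div_pow, one_pow, mul_pow, ← Real.rpow_mul_natCast hx.le, one_div _, mul_inv, ← one_div ((N : ℝ) ^ (n + 1))]
        congr 1
        rw [← Real.rpow_neg hx.le]
        congr 1
        rw [hκ]
        push_cast
        field_simp
      rw [hpow] at h
      rw [← mul_pow, ← sq_abs]
      refine pow_le_pow_left₀ (abs_nonneg _) (h.trans (le_of_eq ?_)) 2
      rw [hA]
      ring
    have hB : 0 ≤ A / (N : ℝ) ^ (n + 1) * ‖f‖ := by positivity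
    have hle : ∫ r, kerOp (remKer a p) f r ^ 2 ∂μ01
        ≤ (A / (N : ℝ) ^ (n + 1) * ‖f‖) ^ 2 * ∫ r, ((1 - r) ^ (-1 / 4 : ℝ)) ^ 2 ∂μ01 := by
      rw [← integral_const_mul]
      refine integral_mono_ae
        ((isRowKernel_remKer ha hp).memLp_kerOp (Lp.memLp f)).integrable_sq
        (hW.integrable_sq.const_mul _) ?_
      filter_upwards [ae_μ01_mem] with r hr using hpt r hr
    refine (Real.sqrt_le_sqrt hle).trans (le_of_eq ?_)
    rw [Real.sqrt_mul (by positivity), Real.sqrt_sq hB]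
    ring

theorem IsRowKernel.add {k₁ k₂ : ℝ → ℝ → ℝ} {M₁ M₂ : ℝ} (h₁ : IsRowKernel k₁ M₁)
    (h₂ : IsRowKernel k₂ M₂) : IsRowKernel (fun r t => k₁ r t + k₂ r t) (2 * (M₁ + M₂)) := by
  refine ⟨h₁.meas.add h₂.meas, fun r hr => (h₁.memLp r hr).add (h₂.memLp r hr), fun r hr => ?_⟩
  have i₁ := (h₁.memLp r hr).integrable_sq
  have i₂ := (h₂.memLp r hr).integrable_sq
  calc ∫ t, (k₁ r t + k₂ r t) ^ 2 ∂μ01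
      ≤ ∫ t, 2 * (k₁ r t ^ 2 + k₂ r t ^ 2) ∂μ01 := by
        refine integral_mono (((h₁.memLp r hr).add (h₂.memLp r hr)).integrable_sq)
          ((i₁.add i₂).const_mul 2) fun t => ?_
        simp only
        nlinarith [sq_nonneg (k₁ r t - k₂ r t)]
    _ ≤ 2 * (M₁ + M₂) := by
        rw [integral_const_mul, integral_add i₁ i₂]
        linarith [h₁.sq_le r hr, h₂.sq_le r hr]

theorem IsRowKernel.const_mul {k : ℝ → ℝ → ℝ} {M : ℝ} (h : IsRowKernel k M) (c : ℝ) :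
    IsRowKernel (fun r t => c * k r t) (c ^ 2 * M) := by
  refine ⟨h.meas.const_mul c, fun r hr => (h.memLp r hr).const_mul c, fun r hr => ?_⟩
  simp_rw [mul_pow]
  rw [integral_const_mul]
  exact mul_le_mul_of_nonneg_left (h.sq_le r hr) (sq_nonneg c)

theorem norm_cexp_mul_le (z : ℂ) {r : ℝ} (hr : r ∈ Set.Ioo (0 : ℝ) 1) :
    ‖Complex.exp (z * r)‖ ≤ rexp |z.re| := by
  rw [Complex.norm_exp, Complex.re_mul_ofReal]
  refine Real.exp_le_exp.2 ((le_abs_self _).trans ?_)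
  rw [abs_mul, abs_of_pos hr.1]
  exact mul_le_of_le_one_right (abs_nonneg _) hr.2.le

theorem integrable_cexp_mul {z : ℂ} {f : ℝ → ℝ} (hf : Integrable f μ01) :
    Integrable (fun r : ℝ => Complex.exp (z * r) * (f r : ℂ)) μ01 := by
  refine hf.ofReal.bdd_mul (c := rexp |z.re|) (by fun_prop) ?_
  filter_upwards [ae_μ01_mem] with r hr using norm_cexp_mul_le z hr

theorem IsRowKernel.integral_cexp_mul_kerOp {k : ℝ → ℝ → ℝ} {M : ℝ} (hk : IsRowKernel k M)
    {f : ℝ → ℝ} (hf : MemLp f 2 μ01) (z : ℂ) :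
    ∫ r : ℝ, Complex.exp (z * r) * (kerOp k f r : ℂ) ∂μ01
      = ∫ t : ℝ, (∫ r : ℝ, Complex.exp (z * r) * (k r t : ℂ) ∂μ01) * (f t : ℂ) ∂μ01 := by
  have hint : Integrable (Function.uncurry fun r t : ℝ =>
      Complex.exp (z * r) * ((k r t * f t : ℝ) : ℂ)) (μ01.prod μ01) := by
    refine (hk.integrable_prod hf).ofReal.bdd_mul (c := rexp |z.re|) (by fun_prop) ?_
    have h : ∀ᵐ x : ℝ × ℝ ∂μ01.prod μ01, x.1 ∈ Set.Ioo (0 : ℝ) 1 :=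
      Measure.quasiMeasurePreserving_fst.ae ae_μ01_mem
    filter_upwards [h] with x hx using norm_cexp_mul_le z hx
  calc ∫ r : ℝ, Complex.exp (z * r) * (kerOp k f r : ℂ) ∂μ01
      = ∫ r : ℝ, ∫ t : ℝ, Complex.exp (z * r) * ((k r t * f t : ℝ) : ℂ) ∂μ01 ∂μ01 := by
        refine integral_congr_ae (Eventually.of_forall fun r => ?_)
        simp only
        rw [integral_const_mul, kerOp, ← integral_complex_ofReal]
    _ = ∫ t : ℝ, ∫ r : ℝ, Complex.exp (z * r) * ((k r t * f t : ℝ) : ℂ) ∂μ01 ∂μ01 :=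
        integral_integral_swap hint
    _ = _ := by
        refine integral_congr_ae (Eventually.of_forall fun t => ?_)
        simp only
        rw [← integral_mul_const]
        refine integral_congr_ae (Eventually.of_forall fun r => ?_)
        push_cast
        ring

/-- The integrand of the complex Gamma integral. -/
noncomputable def gammaFun (p : ℝ) (z : ℂ) (w : ℝ) : ℂ :=
  ((w ^ p : ℝ) : ℂ) * Complex.exp (-(z * w))

theorem integrableOn_gammaFun {p : ℝ} (hp : -1 < p) {z : ℂ} (hz : 0 < z.re) :
    IntegrableOn (gammaFun p z) (Set.Ioi 0) := by
  refine (integrableOn_rpow_mul_exp_neg hp hz).mono' ?_ ?_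
  · refine Measurable.aestronglyMeasurable ?_
    unfold gammaFun
    fun_prop
  · filter_upwards [ae_restrict_mem measurableSet_Ioi] with w hw
    have hw0 : (0 : ℝ) < w := hw
    rw [gammaFun, norm_mul, Complex.norm_real, Real.norm_of_nonneg (by positivity),
      Complex.norm_exp]
    simp

theorem integral_cexp_mul_rlKer (p : ℝ) (z : ℂ) {t : ℝ} (ht : t ∈ Set.Ioo (0 : ℝ) 1) :
    ∫ r : ℝ, Complex.exp (z * r) * (rlKer p r t : ℂ) ∂μ01
      = Complex.exp (z * t) * ∫ w in (0 : ℝ)..t, gammaFun p z w := by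
  have h : ∀ r : ℝ, Complex.exp (z * r) * (rlKer p r t : ℂ)
      = (Set.Iio t).indicator (fun r : ℝ => Complex.exp (z * t) * gammaFun p z (t - r)) r := by
    intro r
    rw [rlKer, Set.indicator_apply]
    simp only [Set.mem_Iio]
    split_ifs with hrt
    · rw [gammaFun, mul_left_comm, ← Complex.exp_add, mul_comm]
      congr 2
      push_cast
      ring
    · simp
  have hset : Set.Iio t ∩ Set.Icc 0 1 = Set.Ico 0 t := by
    ext r
    simp only [Set.mem_inter_iff, Set.mem_Iio, Set.mem_Icc, Set.mem_Ico]
    exact ⟨fun h => ⟨h.2.1, h.1⟩, fun h => ⟨h.2, h.1, h.2.le.trans ht.2.le⟩⟩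
  simp_rw [h]
  rw [integral_indicator measurableSet_Iio, μ01, Measure.restrict_restrict measurableSet_Iio, hset,
    integral_Ico_eq_integral_Ioo, ← integral_Ioc_eq_integral_Ioo,
    ← intervalIntegral.integral_of_le ht.1.le, intervalIntegral.integral_const_mul,
    intervalIntegral.integral_comp_sub_left (fun w => gammaFun p z w) t]
  simp

theorem integrable_rlKer_column {p : ℝ} (hp : -1 < p) (t : ℝ) :
    Integrable (fun r => rlKer p r t) μ01 := by
  have h : (fun r => rlKer p r t) = (Set.Iio t).indicator fun r => (t - r) ^ p := by
    funext r
    rw [rlKer, Set.indicator_apply]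
    simp only [Set.mem_Iio]
  rw [h, integrable_indicator_iff measurableSet_Iio, IntegrableOn, μ01,
    Measure.restrict_restrict measurableSet_Iio]
  have h0 := (intervalIntegral.intervalIntegrable_rpow' (r := p) hp
    (a := 0) (b := t)).comp_sub_left t
  rw [sub_zero, sub_self] at h0
  have h1 : IntegrableOn (fun r => (t - r) ^ p) (Set.Ico 0 t) :=
    (integrableOn_Ico_iff_integrableOn_Ioo).2 ((integrableOn_Ioc_iff_integrableOn_Ioo).1 h0.2)
  exact h1.mono_set fun r hr => ⟨hr.2.1, hr.1⟩

theorem integrable_remKer_column {a : ℝ} (ha : 0 < a) (p : ℝ) {t : ℝ}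
    (ht : t ∈ Set.Ioo (0 : ℝ) 1) : Integrable (fun r => remKer a p r t) μ01 := by
  refine Integrable.of_bound (C := tailConst a p * (t ^ p + (2 ^ |p| + 1))) ?_ ?_
  · exact ((measurable_tailSum a p).comp
      ((measurable_const.sub measurable_id).add measurable_const)).aestronglyMeasurable
  · filter_upwards [ae_μ01_mem] with r hr
    rw [remKer, Real.norm_of_nonneg (tailSum_nonneg _ _ _)]
    exact tailSum_le_of_le ha p ht.1 (by linarith [hr.2]) (by linarith [hr.1, ht.2])

theorem cexp_mul_remKer_term {a p : ℝ} {z : ℂ} (hz1 : Complex.exp z = (rexp a : ℂ))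
    {t : ℝ} (ht : 0 < t) {r : ℝ} (hr : r ≤ 1) (n : ℕ) :
    Complex.exp (z * r) * ((rexp (-a) * (rexp (-(a * n)) * |1 - r + t + n| ^ p) : ℝ) : ℂ)
      = Complex.exp (z * t) * gammaFun p z (t + (n + 1) - r) := by
  have hn : (0 : ℝ) ≤ n := n.cast_nonneg
  have h1 : Complex.exp (z * (n + 1)) = (rexp (a * (n + 1)) : ℂ) := by
    have e1 : Complex.exp (z * (n + 1)) = Complex.exp z ^ (n + 1) := by
      rw [← Complex.exp_nat_mul]
      congr 1
      push_cast
      ring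
    rw [e1, hz1]
    norm_cast
    rw [← Real.exp_nat_mul]
    congr 1
    push_cast
    ring
  have h2 : Complex.exp (z * t) * Complex.exp (-(z * ((t + (n + 1) - r : ℝ) : ℂ)))
      = Complex.exp (z * r) * (rexp (-(a * (n + 1))) : ℂ) := by
    have e2 : (rexp (-(a * (n + 1))) : ℂ) = Complex.exp (-(z * (n + 1))) := by
      rw [Complex.exp_neg, h1, Real.exp_neg]
      push_cast
      rfl
    rw [e2, ← Complex.exp_add, ← Complex.exp_add]
    congr 1
    push_cast
    ring
  rw [gammaFun, abs_of_pos (by linarith : 0 < 1 - r + t + n),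
    mul_left_comm (Complex.exp (z * t)), h2]
  have h3 : 1 - r + t + n = t + (n + 1) - r := by ring
  have h4 : rexp (-(a * (n + 1))) = rexp (-a) * rexp (-(a * n)) := by
    rw [← Real.exp_add]
    congr 1
    ring
  rw [h3, h4]
  push_cast
  ring

theorem integral_cexp_mul_remKer {a p : ℝ} (ha : 0 < a) (hp : -1 < p) {z : ℂ} (hza : z.re = a)
    (hz1 : Complex.exp z = (rexp a : ℂ)) {t : ℝ} (ht : t ∈ Set.Ioo (0 : ℝ) 1) :
    ∫ r : ℝ, Complex.exp (z * r) * ((rexp (-a) * remKer a p r t : ℝ) : ℂ) ∂μ01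
      = Complex.exp (z * t) * ∫ w in Set.Ioi t, gammaFun p z w := by
  set F : ℕ → ℝ → ℂ := fun n r => Complex.exp (z * r) *
    ((rexp (-a) * (rexp (-(a * n)) * |1 - r + t + n| ^ p) : ℝ) : ℂ) with hF
  have hG : IntegrableOn (gammaFun p z) (Set.Ioi 0) := integrableOn_gammaFun hp (by rwa [hza])
  have hFb : ∀ n, ∀ᵐ r ∂μ01, ‖F n r‖ ≤ rexp |z.re| * (rexp (-a) * (t ^ p + (2 ^ |p| + 1))) *
      (rexp (-(a * n)) * ((n : ℝ) + 2) ^ |p|) := by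
    intro n
    filter_upwards [ae_μ01_mem] with r hr
    have h1 := norm_cexp_mul_le z hr
    have h2 := rpow_add_nat_le (v := 1 - r + t) (by linarith [hr.2, ht.1])
      (by linarith [hr.1, ht.2]) p n
    have h3 := rpow_le_add_two_rpow (v := 1 - r + t) ht.1 (by linarith [hr.2])
      (by linarith [hr.1, ht.2]) p
    rw [hF, norm_mul, Complex.norm_real, Real.norm_of_nonneg (by positivity)]
    calc _ ≤ rexp |z.re| * (rexp (-a) * (rexp (-(a * n)) *
          (((n : ℝ) + 2) ^ |p| * (t ^ p + 2 ^ |p| + 1)))) := by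
          gcongr
          refine h2.trans ?_
          gcongr
      _ = _ := by ring
  have hFm : ∀ n, AEStronglyMeasurable (F n) μ01 := fun n => by
    refine Measurable.aestronglyMeasurable ?_
    simp only [hF]
    fun_prop
  have hFi : ∀ n, Integrable (F n) μ01 := fun n => Integrable.of_bound (hFm n) _ (hFb n)
  have hFs : Summable fun n => ∫ r, ‖F n r‖ ∂μ01 := by
    refine Summable.of_nonneg_of_le (fun n => integral_nonneg fun _ => norm_nonneg _)
      (fun n => ?_) ((summable_exp_mul_rpow ha p).mul_left
        (rexp |z.re| * (rexp (-a) * (t ^ p + (2 ^ |p| + 1)))))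
    refine (integral_mono_ae (hFi n).norm (integrable_const _) (hFb n)).trans ?_
    simp
  have hsum := hasSum_integral_of_summable_integral_norm hFi hFs
  have hL : ∫ r, (∑' n, F n r) ∂μ01
      = ∫ r : ℝ, Complex.exp (z * r) * ((rexp (-a) * remKer a p r t : ℝ) : ℂ) ∂μ01 := by
    refine integral_congr_ae (Eventually.of_forall fun r => ?_)
    simp only [hF]
    rw [tsum_mul_left, ← Complex.ofReal_tsum, tsum_mul_left, remKer, tailSum]
  have hterm : ∀ n : ℕ, ∫ r, F n r ∂μ01
      = Complex.exp (z * t) * ∫ w in (t + (n : ℕ))..(t + (n + 1 : ℕ)), gammaFun p z w := by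
    intro n
    have h1 : ∫ r, F n r ∂μ01 = ∫ r, Complex.exp (z * t) * gammaFun p z (t + (n + 1) - r) ∂μ01 := by
      refine integral_congr_ae ?_
      filter_upwards [ae_μ01_mem] with r hr
      exact cexp_mul_remKer_term hz1 ht.1 hr.2.le n
    rw [h1, integral_const_mul, integral_μ01,
      intervalIntegral.integral_comp_sub_left (fun w => gammaFun p z w) (t + (n + 1))]
    congr 2
    · ring
    · push_cast
      ring
  rw [hL] at hsum
  refine tendsto_nhds_unique hsum.tendsto_sum_nat ?_
  have hint : ∀ x y : ℝ, 0 ≤ x → 0 ≤ y → IntervalIntegrable (gammaFun p z) volume x y := by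
    intro x y hx hy
    rw [intervalIntegrable_iff]
    exact hG.mono_set fun w hw => (le_min hx hy).trans_lt hw.1
  have hpart : ∀ m : ℕ, ∑ n ∈ Finset.range m, ∫ r, F n r ∂μ01
      = Complex.exp (z * t) * ∫ w in t..(t + (m : ℕ)), gammaFun p z w := by
    intro m
    simp_rw [hterm]
    rw [← Finset.mul_sum]
    have := intervalIntegral.sum_integral_adjacent_intervals (f := gammaFun p z) (μ := volume)
      (a := fun n : ℕ => t + (n : ℝ)) (n := m) fun k _ =>
        hint _ _ (by linarith [ht.1, k.cast_nonneg (α := ℝ)])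
          (by linarith [ht.1, (k + 1).cast_nonneg (α := ℝ)])
    rw [this]
    simp
  simp_rw [hpart]
  refine Tendsto.const_mul _ ?_
  exact intervalIntegral_tendsto_integral_Ioi t (hG.mono_set (Set.Ioi_subset_Ioi ht.1.le))
    (tendsto_atTop_add_const_left _ _ tendsto_natCast_atTop_atTop)

/-- The periodized Riemann–Liouville kernel, up to an exponential factor. -/
noncomputable def perKer (a p r t : ℝ) : ℝ := rlKer p r t + rexp (-a) * remKer a p r t

theorem isRowKernel_perKer {a p : ℝ} (ha : 0 < a) (hp : -1 / 2 < p) :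
    ∃ M, IsRowKernel (perKer a p) M :=
  ⟨_, (isRowKernel_rlKer hp).add ((isRowKernel_remKer ha hp).const_mul (rexp (-a)))⟩

theorem integral_cexp_mul_perKer {a p : ℝ} (ha : 0 < a) (hp : -1 < p) {z : ℂ} (hza : z.re = a)
    (hz1 : Complex.exp z = (rexp a : ℂ)) {t : ℝ} (ht : t ∈ Set.Ioo (0 : ℝ) 1) :
    ∫ r : ℝ, Complex.exp (z * r) * (perKer a p r t : ℂ) ∂μ01
      = Complex.exp (z * t) * ∫ w in Set.Ioi 0, gammaFun p z w := by
  have hG : IntegrableOn (gammaFun p z) (Set.Ioi 0) := integrableOn_gammaFun hp (by rwa [hza])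
  have h : ∀ r : ℝ, Complex.exp (z * r) * (perKer a p r t : ℂ)
      = Complex.exp (z * r) * (rlKer p r t : ℂ)
        + Complex.exp (z * r) * ((rexp (-a) * remKer a p r t : ℝ) : ℂ) := by
    intro r
    rw [perKer]
    push_cast
    ring
  simp_rw [h]
  rw [integral_add (integrable_cexp_mul (integrable_rlKer_column hp t))
      (integrable_cexp_mul ((integrable_remKer_column ha p ht).const_mul _)),
    integral_cexp_mul_rlKer p z ht, integral_cexp_mul_remKer ha hp hza hz1 ht, ← mul_add,
    intervalIntegral.integral_interval_add_Ioi hG (hG.mono_set (Set.Ioi_subset_Ioi ht.1.le))]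

/-- The periodized operator is diagonalized by the exponentials. -/
theorem integral_cexp_mul_kerOp_perKer {a p : ℝ} (ha : 0 < a) (hp : -1 / 2 < p) {z : ℂ}
    (hza : z.re = a) (hz1 : Complex.exp z = (rexp a : ℂ)) {f : ℝ → ℝ} (hf : MemLp f 2 μ01) :
    ∫ r : ℝ, Complex.exp (z * r) * (kerOp (perKer a p) f r : ℂ) ∂μ01
      = (∫ w in Set.Ioi 0, gammaFun p z w) *
        ∫ t : ℝ, Complex.exp (z * t) * (f t : ℂ) ∂μ01 := by
  obtain ⟨M, hM⟩ := isRowKernel_perKer ha hp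
  rw [hM.integral_cexp_mul_kerOp hf, ← integral_const_mul]
  refine integral_congr_ae ?_
  filter_upwards [ae_μ01_mem] with t ht
  rw [integral_cexp_mul_perKer ha (by linarith) hza hz1 ht]
  ring

/-- The Fourier coefficients of a real function on the unit interval. -/
noncomputable def fourCoeff (g : ℝ → ℝ) (k : ℤ) : ℂ :=
  ∫ t : ℝ, Complex.exp (-(2 * π * k * Complex.I) * t) * (g t : ℂ) ∂μ01

theorem hasSum_sq_fourCoeff {g : ℝ → ℝ} (hg : MemLp g 2 μ01) :
    HasSum (fun k : ℤ => ‖fourCoeff g k‖ ^ 2) (∫ t, g t ^ 2 ∂μ01) := by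
  have hg' : MemLp (fun t => (g t : ℂ)) 2 (volume.restrict (Set.Ioc (0 : ℝ) 1)) := by
    rw [← μ01_eq_restrict_Ioc]
    exact hg.ofReal
  have h := hasSum_sq_fourierCoeffOn zero_lt_one hg'
  have h1 : ∀ k : ℤ, fourierCoeffOn zero_lt_one (fun t => (g t : ℂ)) k = fourCoeff g k := by
    intro k
    rw [fourierCoeffOn_eq_integral, fourCoeff, integral_μ01]
    simp only [sub_zero, div_one, one_smul]
    refine intervalIntegral.integral_congr fun t _ => ?_
    simp only [fourier_coe_apply, smul_eq_mul]
    congr 2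
    push_cast
    ring
  simp_rw [h1] at h
  convert h using 1
  rw [integral_μ01]
  simp

theorem exp_sub_two_pi_mul (a : ℝ) (k : ℤ) (t : ℝ) (x : ℝ) :
    Complex.exp ((a - 2 * π * k * Complex.I) * t) * (x : ℂ)
      = Complex.exp (-(2 * π * k * Complex.I) * t) * ((rexp (a * t) * x : ℝ) : ℂ) := by
  push_cast
  rw [← mul_assoc, ← Complex.exp_add]
  congr 2
  ring

theorem fourCoeff_kerOp_perKer {a p : ℝ} (ha : 0 < a) (hp : -1 / 2 < p) {f : ℝ → ℝ}
    (hf : MemLp f 2 μ01) (k : ℤ) :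
    ‖fourCoeff (fun r => rexp (a * r) * kerOp (perKer a p) f r) k‖
      = Gamma (p + 1) * ‖(a - 2 * π * k * Complex.I : ℂ)‖ ^ (-(p + 1)) *
        ‖fourCoeff (fun t => rexp (a * t) * f t) k‖ := by
  have hre : (a - 2 * π * k * Complex.I : ℂ).re = a := by simp
  have hexp : Complex.exp (a - 2 * π * k * Complex.I) = (rexp a : ℂ) := by
    rw [Complex.exp_sub]
    have : Complex.exp (2 * π * k * Complex.I) = 1 := by
      rw [Complex.exp_eq_one_iff]
      exact ⟨k, by ring⟩
    rw [this, div_one, Complex.ofReal_exp]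
  have h := integral_cexp_mul_kerOp_perKer ha hp hre hexp hf
  simp_rw [exp_sub_two_pi_mul] at h
  rw [fourCoeff, fourCoeff, h, norm_mul]
  congr 1
  have hG := norm_integral_rpow_mul_cexp_neg (β := p + 1) (by linarith)
    (z := (a - 2 * π * k * Complex.I : ℂ)) (by rwa [hre])
  rw [← hG]
  simp only [gammaFun, add_sub_cancel_right]

theorem norm_sub_two_pi_mul_le {a : ℝ} (ha : 0 < a) (k : ℤ) :
    ‖(a - 2 * π * k * Complex.I : ℂ)‖ ≤ a + 2 * π * |(k : ℝ)| := by
  refine (norm_sub_le _ _).trans ?_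
  simp [abs_of_pos ha, abs_of_pos Real.pi_pos]

theorem le_norm_sub_two_pi_mul (a : ℝ) (k : ℤ) :
    2 * π * |(k : ℝ)| ≤ ‖(a - 2 * π * k * Complex.I : ℂ)‖ := by
  refine le_trans (le_of_eq ?_) (Complex.abs_im_le_norm _)
  simp [abs_mul, abs_of_pos Real.pi_pos]

theorem sqrt_integral_perKer_le {a p : ℝ} (ha : 0 < a) (hp : -1 / 2 < p) {f : ℝ → ℝ}
    (hf : MemLp f 2 μ01) (hg : MemLp (fun t => rexp (a * t) * f t) 2 μ01)
    (hv : MemLp (fun r => rexp (a * r) * kerOp (perKer a p) f r) 2 μ01) {m : ℝ} (hm : 0 < m)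
    (hk : ∀ k : ℤ, |(k : ℝ)| < m → fourCoeff (fun t => rexp (a * t) * f t) k = 0) :
    √(∫ r, (rexp (a * r) * kerOp (perKer a p) f r) ^ 2 ∂μ01)
      ≤ Gamma (p + 1) * (2 * π * m) ^ (-(p + 1)) * √(∫ t, (rexp (a * t) * f t) ^ 2 ∂μ01) := by
  have hΓ := Real.Gamma_pos_of_pos (by linarith : 0 < p + 1)
  have hB : 0 ≤ Gamma (p + 1) * (2 * π * m) ^ (-(p + 1)) := by positivity
  rw [← Real.sqrt_sq hB, ← Real.sqrt_mul (sq_nonneg _)]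
  refine Real.sqrt_le_sqrt ?_
  refine hasSum_le (fun k => ?_) (hasSum_sq_fourCoeff hv) ((hasSum_sq_fourCoeff hg).mul_left _)
  rw [fourCoeff_kerOp_perKer ha hp hf k, ← mul_pow]
  by_cases hkm : |(k : ℝ)| < m
  · simp [hk k hkm]
  · push Not at hkm
    have h1 : 2 * π * m ≤ ‖(a - 2 * π * k * Complex.I : ℂ)‖ :=
      le_trans (by gcongr) (le_norm_sub_two_pi_mul a k)
    have h2 : ‖(a - 2 * π * k * Complex.I : ℂ)‖ ^ (-(p + 1)) ≤ (2 * π * m) ^ (-(p + 1)) :=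
      Real.rpow_le_rpow_of_nonpos (by positivity) h1 (by linarith)
    gcongr

theorem le_sqrt_integral_perKer {a p : ℝ} (ha : 0 < a) (hp : -1 / 2 < p) {f : ℝ → ℝ}
    (hf : MemLp f 2 μ01) (hg : MemLp (fun t => rexp (a * t) * f t) 2 μ01)
    (hv : MemLp (fun r => rexp (a * r) * kerOp (perKer a p) f r) 2 μ01) {m : ℝ} (hm : 0 < m)
    (hk : ∀ k : ℤ, m < |(k : ℝ)| → fourCoeff (fun t => rexp (a * t) * f t) k = 0) :
    Gamma (p + 1) * (a + 2 * π * m) ^ (-(p + 1)) * √(∫ t, (rexp (a * t) * f t) ^ 2 ∂μ01)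
      ≤ √(∫ r, (rexp (a * r) * kerOp (perKer a p) f r) ^ 2 ∂μ01) := by
  have hΓ := Real.Gamma_pos_of_pos (by linarith : 0 < p + 1)
  have hB : 0 ≤ Gamma (p + 1) * (a + 2 * π * m) ^ (-(p + 1)) := by positivity
  rw [← Real.sqrt_sq hB, ← Real.sqrt_mul (sq_nonneg _)]
  refine Real.sqrt_le_sqrt ?_
  refine hasSum_le (fun k => ?_) ((hasSum_sq_fourCoeff hg).mul_left _) (hasSum_sq_fourCoeff hv)
  rw [fourCoeff_kerOp_perKer ha hp hf k, ← mul_pow]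
  by_cases hkm : m < |(k : ℝ)|
  · simp [hk k hkm]
  · push Not at hkm
    have h1 : ‖(a - 2 * π * k * Complex.I : ℂ)‖ ≤ a + 2 * π * m :=
      (norm_sub_two_pi_mul_le ha k).trans (by gcongr)
    have h0 : 0 < ‖(a - 2 * π * k * Complex.I : ℂ)‖ := by
      refine lt_of_lt_of_le ha ?_
      refine le_trans (le_of_eq ?_) (Complex.re_le_norm _)
      simp
    have h2 : (a + 2 * π * m) ^ (-(p + 1)) ≤ ‖(a - 2 * π * k * Complex.I : ℂ)‖ ^ (-(p + 1)) :=
      Real.rpow_le_rpow_of_nonpos h0 h1 (by linarith)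
    gcongr

theorem sqrt_integral_sq_eq_norm {g : ℝ → ℝ} (hg : MemLp g 2 μ01) :
    √(∫ t, g t ^ 2 ∂μ01) = ‖hg.toLp g‖ := by
  rw [← sqrt_integral_sq]
  congr 1
  refine integral_congr_ae ?_
  filter_upwards [hg.coeFn_toLp] with t ht
  rw [ht]

theorem sqrt_integral_sq_add_le {g h : ℝ → ℝ} (hg : MemLp g 2 μ01) (hh : MemLp h 2 μ01) :
    √(∫ t, (g t + h t) ^ 2 ∂μ01) ≤ √(∫ t, g t ^ 2 ∂μ01) + √(∫ t, h t ^ 2 ∂μ01) := by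
  have h1 := sqrt_integral_sq_eq_norm (hg.add hh)
  simp only [Pi.add_apply] at h1
  rw [h1, sqrt_integral_sq_eq_norm hg, sqrt_integral_sq_eq_norm hh, MemLp.toLp_add]
  exact norm_add_le _ _

theorem memLp_exp_mul (a : ℝ) {g : ℝ → ℝ} (hg : MemLp g 2 μ01) :
    MemLp (fun t => rexp (a * t) * g t) 2 μ01 := by
  refine hg.of_le_mul (c := rexp |a|) ?_ ?_
  · exact (by fun_prop : Continuous fun t => rexp (a * t)).aestronglyMeasurable.mul hg.1
  · filter_upwards [ae_μ01_mem] with t ht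
    rw [norm_mul, Real.norm_of_nonneg (Real.exp_pos _).le]
    gcongr
    refine (le_abs_self _).trans ?_
    rw [abs_mul, abs_of_pos ht.1]
    exact mul_le_of_le_one_right (abs_nonneg _) ht.2.le

theorem sqrt_integral_exp_mul_le {a : ℝ} (ha : 0 < a) {g : ℝ → ℝ} (hg : MemLp g 2 μ01) :
    √(∫ t, (rexp (a * t) * g t) ^ 2 ∂μ01) ≤ rexp a * √(∫ t, g t ^ 2 ∂μ01) := by
  rw [← Real.sqrt_sq (Real.exp_pos a).le, ← Real.sqrt_mul (sq_nonneg _), ← integral_const_mul]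
  refine Real.sqrt_le_sqrt (integral_mono_ae (memLp_exp_mul a hg).integrable_sq
    (hg.integrable_sq.const_mul _) ?_)
  filter_upwards [ae_μ01_mem] with t ht
  rw [mul_pow]
  gcongr
  nlinarith [ht.2]

theorem sqrt_integral_le_exp_mul {a : ℝ} (ha : 0 < a) {g : ℝ → ℝ} (hg : MemLp g 2 μ01) :
    √(∫ t, g t ^ 2 ∂μ01) ≤ √(∫ t, (rexp (a * t) * g t) ^ 2 ∂μ01) := by
  refine Real.sqrt_le_sqrt (integral_mono_ae hg.integrable_sq
    (memLp_exp_mul a hg).integrable_sq ?_)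
  filter_upwards [ae_μ01_mem] with t ht
  rw [mul_pow]
  refine le_mul_of_one_le_left (sq_nonneg _) (one_le_pow₀ (Real.one_le_exp ?_))
  nlinarith [ht.1]

theorem kerOp_perKer_eq {a p : ℝ} (ha : 0 < a) (hp : -1 / 2 < p) {f : ℝ → ℝ}
    (hf : MemLp f 2 μ01) {r : ℝ} (hr : r ∈ Set.Ioo (0 : ℝ) 1) :
    kerOp (perKer a p) f r = kerOp (rlKer p) f r + rexp (-a) * kerOp (remKer a p) f r := by
  rw [kerOp, kerOp, kerOp, ← integral_const_mul,
    ← integral_add ((isRowKernel_rlKer hp).integrable_row hf hr)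
      (((isRowKernel_remKer ha hp).integrable_row hf hr).const_mul _)]
  refine integral_congr_ae (Eventually.of_forall fun t => ?_)
  simp only [perKer]
  ring

theorem sqrt_integral_perKer_sub_le {a p : ℝ} (ha : 0 < a) (hp : -1 / 2 < p) {f : ℝ → ℝ}
    (hf : MemLp f 2 μ01) :
    √(∫ r, kerOp (perKer a p) f r ^ 2 ∂μ01)
      ≤ √(∫ r, kerOp (rlKer p) f r ^ 2 ∂μ01) + √(∫ r, kerOp (remKer a p) f r ^ 2 ∂μ01) ∧
    √(∫ r, kerOp (rlKer p) f r ^ 2 ∂μ01)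
      ≤ √(∫ r, kerOp (perKer a p) f r ^ 2 ∂μ01) + √(∫ r, kerOp (remKer a p) f r ^ 2 ∂μ01) := by
  have hU := (isRowKernel_rlKer hp).memLp_kerOp hf
  have hR := (isRowKernel_remKer ha hp).memLp_kerOp hf
  obtain ⟨M, hM⟩ := isRowKernel_perKer ha hp
  have hP := hM.memLp_kerOp hf
  have hscale : ∀ c : ℝ, |c| ≤ 1 → √(∫ r, (c * kerOp (remKer a p) f r) ^ 2 ∂μ01)
      ≤ √(∫ r, kerOp (remKer a p) f r ^ 2 ∂μ01) := by
    intro c hc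
    refine Real.sqrt_le_sqrt (integral_mono (hR.const_mul c).integrable_sq hR.integrable_sq
      fun r => ?_)
    simp only [mul_pow]
    refine mul_le_of_le_one_left (sq_nonneg _) ?_
    rw [← sq_abs]
    exact pow_le_one₀ (abs_nonneg _) hc
  have he : |rexp (-a)| ≤ 1 := by
    rw [abs_of_pos (Real.exp_pos _), Real.exp_le_one_iff]
    linarith
  constructor
  · refine le_trans (le_of_eq ?_) ((sqrt_integral_sq_add_le hU (hR.const_mul (rexp (-a)))).trans
      (add_le_add_right (hscale _ he) _))
    congr 1
    refine integral_congr_ae ?_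
    filter_upwards [ae_μ01_mem] with r hr
    rw [kerOp_perKer_eq ha hp hf hr]
  · refine le_trans (le_of_eq ?_) ((sqrt_integral_sq_add_le hP (hR.const_mul (-rexp (-a)))).trans
      (add_le_add_right (hscale _ (by rwa [abs_neg])) _))
    congr 1
    refine integral_congr_ae ?_
    filter_upwards [ae_μ01_mem] with r hr
    rw [kerOp_perKer_eq ha hp hf hr]
    congr 1
    ring

theorem integral_cos_two_pi_mul (n : ℤ) :
    ∫ t, cos (2 * π * n * t) ∂μ01 = if n = 0 then 1 else 0 := by
  split_ifs with hn
  · simp [hn]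
  · have hc : 2 * π * (n : ℝ) ≠ 0 := by
      have : (n : ℝ) ≠ 0 := by exact_mod_cast hn
      positivity
    rw [integral_μ01, intervalIntegral.integral_comp_mul_left (fun t => cos t) hc]
    have h : sin (2 * π * n) = 0 := by
      rw [Real.sin_eq_zero_iff]
      exact ⟨2 * n, by push_cast; ring⟩
    simp [h]

theorem integral_sin_two_pi_mul (n : ℤ) : ∫ t, sin (2 * π * n * t) ∂μ01 = 0 := by
  by_cases hn : n = 0
  · simp [hn]
  · have hc : 2 * π * (n : ℝ) ≠ 0 := by
      have : (n : ℝ) ≠ 0 := by exact_mod_cast hn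
      positivity
    rw [integral_μ01, intervalIntegral.integral_comp_mul_left (fun t => sin t) hc]
    have h : cos (2 * π * n) = 1 := by
      rw [Real.cos_eq_one_iff]
      exact ⟨n, by ring⟩
    simp [h]

/-- The trigonometric system on the unit interval. -/
noncomputable def trig (b : Bool) (k : ℤ) (t : ℝ) : ℝ :=
  if b then cos (2 * π * k * t) else sin (2 * π * k * t)

theorem continuous_trig (b : Bool) (k : ℤ) : Continuous (trig b k) := by
  unfold trig
  cases b <;> simp <;> fun_prop

theorem abs_trig_le_one (b : Bool) (k : ℤ) (t : ℝ) : |trig b k t| ≤ 1 := by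
  cases b
  · simpa [trig] using abs_sin_le_one _
  · simpa [trig] using abs_cos_le_one _

theorem integrable_cos_two_pi_mul (n : ℤ) : Integrable (fun t => cos (2 * π * n * t)) μ01 := by
  refine Integrable.of_bound (C := 1) (by fun_prop) (Eventually.of_forall fun t => ?_)
  exact abs_cos_le_one _

theorem integrable_sin_two_pi_mul (n : ℤ) : Integrable (fun t => sin (2 * π * n * t)) μ01 := by
  refine Integrable.of_bound (C := 1) (by fun_prop) (Eventually.of_forall fun t => ?_)
  exact abs_sin_le_one _

theorem integral_trig_mul_trig {k m : ℤ} (hk : 0 < k) (hm : 0 < m) (b b' : Bool) :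
    ∫ t, trig b k t * trig b' m t ∂μ01 = if b = b' ∧ k = m then 1 / 2 else 0 := by
  have hc := integrable_cos_two_pi_mul
  have hs := integrable_sin_two_pi_mul
  have hkm : k + m ≠ 0 := by omega
  cases b <;> cases b' <;> simp only [trig, Bool.false_eq_true, if_false, if_true, reduceCtorEq,
    false_and, true_and]
  · have h : ∀ t : ℝ, sin (2 * π * k * t) * sin (2 * π * m * t)
        = 1 / 2 * (cos (2 * π * (k - m : ℤ) * t) - cos (2 * π * (k + m : ℤ) * t)) := by
      intro t
      have e1 : 2 * π * ((k - m : ℤ) : ℝ) * t = 2 * π * k * t - 2 * π * m * t := by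
        push_cast
        ring
      have e2 : 2 * π * ((k + m : ℤ) : ℝ) * t = 2 * π * k * t + 2 * π * m * t := by
        push_cast
        ring
      rw [e1, e2, cos_sub, cos_add]
      ring
    simp_rw [h]
    rw [integral_const_mul, integral_sub (hc _) (hc _), integral_cos_two_pi_mul,
      integral_cos_two_pi_mul, if_neg hkm]
    simp [sub_eq_zero]
  · have h : ∀ t : ℝ, sin (2 * π * k * t) * cos (2 * π * m * t)
        = 1 / 2 * (sin (2 * π * (k - m : ℤ) * t) + sin (2 * π * (k + m : ℤ) * t)) := by
      intro t
      have e1 : 2 * π * ((k - m : ℤ) : ℝ) * t = 2 * π * k * t - 2 * π * m * t := by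
        push_cast
        ring
      have e2 : 2 * π * ((k + m : ℤ) : ℝ) * t = 2 * π * k * t + 2 * π * m * t := by
        push_cast
        ring
      rw [e1, e2, sin_sub, sin_add]
      ring
    simp_rw [h]
    rw [integral_const_mul, integral_add (hs _) (hs _), integral_sin_two_pi_mul,
      integral_sin_two_pi_mul]
    simp
  · have h : ∀ t : ℝ, cos (2 * π * k * t) * sin (2 * π * m * t)
        = 1 / 2 * (sin (2 * π * (k + m : ℤ) * t) - sin (2 * π * (k - m : ℤ) * t)) := by
      intro t
      have e1 : 2 * π * ((k - m : ℤ) : ℝ) * t = 2 * π * k * t - 2 * π * m * t := by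
        push_cast
        ring
      have e2 : 2 * π * ((k + m : ℤ) : ℝ) * t = 2 * π * k * t + 2 * π * m * t := by
        push_cast
        ring
      rw [e1, e2, sin_sub, sin_add]
      ring
    simp_rw [h]
    rw [integral_const_mul, integral_sub (hs _) (hs _), integral_sin_two_pi_mul,
      integral_sin_two_pi_mul]
    simp
  · have h : ∀ t : ℝ, cos (2 * π * k * t) * cos (2 * π * m * t)
        = 1 / 2 * (cos (2 * π * (k - m : ℤ) * t) + cos (2 * π * (k + m : ℤ) * t)) := by
      intro t
      have e1 : 2 * π * ((k - m : ℤ) : ℝ) * t = 2 * π * k * t - 2 * π * m * t := by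
        push_cast
        ring
      have e2 : 2 * π * ((k + m : ℤ) : ℝ) * t = 2 * π * k * t + 2 * π * m * t := by
        push_cast
        ring
      rw [e1, e2, cos_sub, cos_add]
      ring
    simp_rw [h]
    rw [integral_const_mul, integral_add (hc _) (hc _), integral_cos_two_pi_mul,
      integral_cos_two_pi_mul, if_neg hkm]
    simp [sub_eq_zero]

theorem memLp_trig (b : Bool) (k : ℤ) : MemLp (trig b k) 2 μ01 :=
  MemLp.of_bound (continuous_trig b k).aestronglyMeasurable 1
    (Eventually.of_forall fun t => abs_trig_le_one b k t)

/-- The trigonometric coefficients of `exp (a t) f t` as linear functionals of `f`. -/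
noncomputable def trigFunctional (a : ℝ) (b : Bool) (k : ℤ) : Lp ℝ 2 μ01 →ₗ[ℝ] ℝ :=
  integralFunctional fun t => rexp (a * t) * trig b k t

/-- The weighted trigonometric functions biorthogonal to `trigFunctional`. -/
noncomputable def trigVec (a : ℝ) (b : Bool) (k : ℤ) : Lp ℝ 2 μ01 :=
  (memLp_exp_mul (-a) (memLp_trig b k)).toLp _

theorem trigFunctional_apply (a : ℝ) (b : Bool) (k : ℤ) (f : Lp ℝ 2 μ01) :
    trigFunctional a b k f = ∫ t, trig b k t * (rexp (a * t) * f t) ∂μ01 := by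
  rw [trigFunctional, integralFunctional_apply (memLp_exp_mul a (memLp_trig b k))]
  refine integral_congr_ae (Eventually.of_forall fun t => ?_)
  ring

theorem trigFunctional_trigVec (a : ℝ) {k m : ℤ} (hk : 0 < k) (hm : 0 < m) (b b' : Bool) :
    trigFunctional a b k (trigVec a b' m) = if b = b' ∧ k = m then 1 / 2 else 0 := by
  rw [trigFunctional_apply, ← integral_trig_mul_trig hk hm b b']
  refine integral_congr_ae ?_
  filter_upwards [(memLp_exp_mul (-a) (memLp_trig b' m)).coeFn_toLp] with t ht
  rw [trigVec, ht, ← mul_assoc (rexp (a * t)), ← Real.exp_add]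
  simp

theorem fourCoeff_eq {g : ℝ → ℝ} (hg : MemLp g 2 μ01) (k : ℤ) :
    fourCoeff g k = ((∫ t, trig true k t * g t ∂μ01 : ℝ) : ℂ)
      - ((∫ t, trig false k t * g t ∂μ01 : ℝ) : ℂ) * Complex.I := by
  have hi : ∀ b, Integrable (fun t => ((trig b k t * g t : ℝ) : ℂ)) μ01 := fun b =>
    ((memLp_trig b k).integrable_mul hg).ofReal
  rw [← integral_complex_ofReal, ← integral_complex_ofReal, ← integral_mul_const,
    ← integral_sub (hi true) ((hi false).mul_const _), fourCoeff]
  refine integral_congr_ae (Eventually.of_forall fun t => ?_)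
  have h : Complex.exp (-(2 * π * k * Complex.I) * t)
      = (cos (2 * π * k * t) : ℂ) - (sin (2 * π * k * t) : ℂ) * Complex.I := by
    have e : (-(2 * π * k * Complex.I) * t : ℂ) = ((-(2 * π * k * t) : ℝ) : ℂ) * Complex.I := by
      push_cast
      ring
    rw [e, Complex.exp_mul_I, ← Complex.ofReal_cos, ← Complex.ofReal_sin, cos_neg, sin_neg]
    push_cast
    ring
  simp only [h, trig, if_true, Bool.false_eq_true, if_false]
  push_cast
  ring

theorem fourCoeff_eq_zero {a : ℝ} {f : Lp ℝ 2 μ01} {k : ℤ}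
    (h : ∀ b, trigFunctional a b |k| f = 0) : fourCoeff (fun t => rexp (a * t) * f t) k = 0 := by
  simp_rw [trigFunctional_apply] at h
  rw [fourCoeff_eq (memLp_exp_mul a (Lp.memLp f))]
  rcases abs_choice k with hk | hk
  · rw [hk] at h
    rw [h, h]
    simp
  · rw [hk] at h
    have h1 : ∀ t, trig true (-k) t = trig true k t := fun t => by simp [trig]
    have h2 : ∀ t, trig false (-k) t = -trig false k t := fun t => by simp [trig]
    have h3 := h true
    have h4 := h false
    simp_rw [h1] at h3
    simp_rw [h2, neg_mul] at h4
    rw [integral_neg, neg_eq_zero] at h4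
    rw [h3, h4]
    simp

/-- The span of the first weighted trigonometric functions. -/
theorem exists_trig_subspace (a : ℝ) (m : ℕ) :
    ∃ W : Submodule ℝ (Lp ℝ 2 μ01), FiniteDimensional ℝ W ∧ Module.finrank ℝ W = 2 * m ∧
      ∀ f ∈ W, ∀ k : ℤ, (m : ℝ) < |(k : ℝ)| →
        fourCoeff (fun t => rexp (a * t) * f t) k = 0 := by
  set e : Bool × Fin m → Lp ℝ 2 μ01 := fun i => trigVec a i.1 ((i.2 : ℕ) + 1) with he
  have hli : LinearIndependent ℝ e := by
    refine LinearIndependent.of_pairwise_dual_eq_zero_one e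
      (fun i => (2 : ℝ) • trigFunctional a i.1 ((i.2 : ℕ) + 1)) (fun i j hij => ?_) fun i => ?_
    · change ((2 : ℝ) • trigFunctional a i.1 ((i.2 : ℕ) + 1)) (e j) = 0
      rw [LinearMap.smul_apply, he, trigFunctional_trigVec a (by omega) (by omega), if_neg,
        smul_zero]
      rintro ⟨h1, h2⟩
      exact hij (Prod.ext h1 (Fin.ext (by omega)))
    · rw [LinearMap.smul_apply, he, trigFunctional_trigVec a (by omega) (by omega), if_pos (by simp)]
      norm_num
  refine ⟨Submodule.span ℝ (Set.range e), FiniteDimensional.span_of_finite ℝ (Set.finite_range e),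
    ?_, fun f hf k hk => ?_⟩
  · rw [finrank_span_eq_card hli]
    simp
  · refine fourCoeff_eq_zero fun b => ?_
    have hk' : (m : ℤ) < |k| := by exact_mod_cast hk
    induction hf using Submodule.span_induction with
    | mem x hx =>
      obtain ⟨i, rfl⟩ := hx
      have hi := i.2.isLt
      rw [he, trigFunctional_trigVec a (by omega) (by omega), if_neg]
      rintro ⟨-, h2⟩
      omega
    | zero => exact map_zero _
    | add x y _ _ hx hy => rw [map_add, hx, hy, add_zero]
    | smul c x _ hx => rw [map_smul, hx, smul_zero]

theorem exists_subspace_ker {H : Type*} [AddCommGroup H] [Module ℝ H] (W : Submodule ℝ H)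
    [FiniteDimensional ℝ W] (L : Finset (H →ₗ[ℝ] ℝ)) :
    ∃ V : Submodule ℝ H, V ≤ W ∧ FiniteDimensional ℝ V ∧
      Module.finrank ℝ W ≤ Module.finrank ℝ V + L.card ∧ ∀ f ∈ V, ∀ l ∈ L, l f = 0 := by
  set φ : W →ₗ[ℝ] (L → ℝ) := LinearMap.pi fun l => l.1 ∘ₗ W.subtype with hφ
  refine ⟨(LinearMap.ker φ).map W.subtype, ?_, inferInstance, ?_, ?_⟩
  · rintro _ ⟨x, -, rfl⟩
    exact x.2
  · have h1 := φ.finrank_range_add_finrank_ker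
    have h2 : Module.finrank ℝ (LinearMap.range φ) ≤ L.card := by
      refine (Submodule.finrank_le _).trans ?_
      simp
    rw [Submodule.finrank_map_subtype_eq]
    omega
  · rintro _ ⟨x, hx, rfl⟩ l hl
    exact congrFun (LinearMap.mem_ker.1 hx) ⟨l, hl⟩

theorem tendsto_natSqrt_div : Tendsto (fun j : ℕ => ((Nat.sqrt j + 1 : ℕ) : ℝ) / j) atTop (nhds 0) := by
  have h1 : Tendsto (fun j : ℕ => (√(j : ℝ))⁻¹ + (j : ℝ)⁻¹) atTop (nhds (0 + 0)) :=
    (tendsto_inv_atTop_zero.comp (Real.tendsto_sqrt_atTop.comp tendsto_natCast_atTop_atTop)).add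
      (tendsto_inv_atTop_zero.comp tendsto_natCast_atTop_atTop)
  rw [add_zero] at h1
  refine squeeze_zero' (Eventually.of_forall fun j => by positivity) ?_ h1
  filter_upwards [eventually_gt_atTop 0] with j hj
  have hj' : (0 : ℝ) < j := by exact_mod_cast hj
  have h2 : (Nat.sqrt j : ℝ) ≤ √j := Real.nat_sqrt_le_real_sqrt
  have h3 : (√(j : ℝ))⁻¹ = √j / j := by
    rw [inv_eq_one_div, div_eq_div_iff (by positivity) hj'.ne', one_mul, Real.mul_self_sqrt hj'.le]
  rw [h3, inv_eq_one_div, ← add_div]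
  push_cast
  gcongr

theorem tendsto_rpow_neg_mul {x : ℕ → ℝ} {l s : ℝ} (hx0 : ∀ j, 0 ≤ x j) (hl : 0 < l)
    (hx : Tendsto (fun j : ℕ => x j / j) atTop (nhds l)) :
    Tendsto (fun j : ℕ => x j ^ (-s) * (j : ℝ) ^ s) atTop (nhds (l ^ (-s))) := by
  refine (hx.rpow_const (p := -s) (Or.inl hl.ne')).congr fun j => ?_
  rw [Real.div_rpow (hx0 j) (Nat.cast_nonneg j), Real.rpow_neg (Nat.cast_nonneg j), div_inv_eq_mul]

theorem tendsto_remainder {D s : ℝ} (hD : 0 ≤ D) {n : ℕ} (hn : 2 * s < n + 1) :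
    Tendsto (fun j : ℕ => D / ((Nat.sqrt j + 1 : ℕ) : ℝ) ^ (n + 1) * (j : ℝ) ^ s) atTop
      (nhds 0) := by
  have h1 : Tendsto (fun j : ℕ => D * (j : ℝ) ^ (-((n + 1) / 2 - s))) atTop (nhds (D * 0)) :=
    ((tendsto_rpow_neg_atTop (by linarith)).comp tendsto_natCast_atTop_atTop).const_mul D
  rw [mul_zero] at h1
  refine squeeze_zero' (Eventually.of_forall fun j => by positivity) ?_ h1
  filter_upwards [eventually_gt_atTop 0] with j hj
  have hj' : (0 : ℝ) < j := by exact_mod_cast hj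
  have h2 : (j : ℝ) ^ (((n : ℝ) + 1) / 2) ≤ ((Nat.sqrt j + 1 : ℕ) : ℝ) ^ (n + 1) := by
    have h3 : √(j : ℝ) ≤ ((Nat.sqrt j + 1 : ℕ) : ℝ) := by
      push_cast
      exact Real.real_sqrt_le_nat_sqrt_succ
    calc (j : ℝ) ^ (((n : ℝ) + 1) / 2) = √(j : ℝ) ^ (n + 1) := by
          rw [Real.sqrt_eq_rpow, ← Real.rpow_natCast, ← Real.rpow_mul hj'.le]
          congr 1
          push_cast
          ring
      _ ≤ _ := by gcongr
  rw [div_mul_eq_mul_div, mul_div_assoc]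
  gcongr
  rw [neg_sub, Real.rpow_sub hj']
  gcongr

/-- Half of `j` lowered by a lower order term. -/
theorem tendsto_half_sub (n : ℕ) :
    Tendsto (fun j : ℕ => 2 * π * (((j - (Nat.sqrt j + 1) * (n + 1)) / 2 : ℕ) : ℝ) / j) atTop
      (nhds π) := by
  have h0 : Tendsto (fun j : ℕ => (j : ℝ)⁻¹) atTop (nhds 0) :=
    tendsto_inv_atTop_zero.comp tendsto_natCast_atTop_atTop
  have h1 : Tendsto (fun j : ℕ => π * (1 - ((Nat.sqrt j + 1 : ℕ) : ℝ) / j * (n + 1) - (j : ℝ)⁻¹))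
      atTop (nhds (π * (1 - 0 * (n + 1) - 0))) :=
    (((tendsto_natSqrt_div.mul_const _).const_sub 1).sub h0).const_mul π
  rw [zero_mul, sub_zero, sub_zero, mul_one] at h1
  refine tendsto_of_tendsto_of_tendsto_of_le_of_le' h1 tendsto_const_nhds ?_ ?_
  all_goals
    filter_upwards [eventually_gt_atTop 0] with j hj
    have hj' : (0 : ℝ) < j := by exact_mod_cast hj
  · have h2 : j ≤ 2 * ((j - (Nat.sqrt j + 1) * (n + 1)) / 2) + (Nat.sqrt j + 1) * (n + 1) + 1 := by
      omega
    have h3 : (j : ℝ) ≤ 2 * (((j - (Nat.sqrt j + 1) * (n + 1)) / 2 : ℕ) : ℝ)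
        + ((Nat.sqrt j + 1 : ℕ) : ℝ) * (n + 1) + 1 := by exact_mod_cast h2
    have h4 : (1 - ((Nat.sqrt j + 1 : ℕ) : ℝ) / j * (n + 1) - (j : ℝ)⁻¹)
        = (j - ((Nat.sqrt j + 1 : ℕ) : ℝ) * (n + 1) - 1) / j := by
      field_simp
    rw [h4, ← mul_div_assoc, mul_comm 2 π, mul_assoc]
    gcongr
    linarith
  · have h2 : 2 * ((j - (Nat.sqrt j + 1) * (n + 1)) / 2) ≤ j := by omega
    have h3 : 2 * (((j - (Nat.sqrt j + 1) * (n + 1)) / 2 : ℕ) : ℝ) ≤ j := by exact_mod_cast h2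
    rw [div_le_iff₀ hj', mul_comm 2 π, mul_assoc]
    gcongr

/-- Half of `j` raised by a lower order term. -/
theorem tendsto_half_add {a : ℝ} (ha : 0 < a) (n : ℕ) :
    Tendsto (fun j : ℕ => (a + 2 * π * (((j + (Nat.sqrt j + 1) * (n + 1)) / 2 + 1 : ℕ) : ℝ)) / j)
      atTop (nhds π) := by
  have h0 : Tendsto (fun j : ℕ => (j : ℝ)⁻¹) atTop (nhds 0) :=
    tendsto_inv_atTop_zero.comp tendsto_natCast_atTop_atTop
  have h1 : Tendsto (fun j : ℕ => a * (j : ℝ)⁻¹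
      + π * (1 + ((Nat.sqrt j + 1 : ℕ) : ℝ) / j * (n + 1) + 2 * (j : ℝ)⁻¹))
      atTop (nhds (a * 0 + π * (1 + 0 * (n + 1) + 2 * 0))) :=
    (h0.const_mul a).add
      ((((tendsto_natSqrt_div.mul_const _).const_add 1).add (h0.const_mul 2)).const_mul π)
  rw [zero_mul, mul_zero, mul_zero, add_zero, add_zero, mul_one, zero_add] at h1
  refine tendsto_of_tendsto_of_tendsto_of_le_of_le' tendsto_const_nhds h1 ?_ ?_
  all_goals
    filter_upwards [eventually_gt_atTop 0] with j hj
    have hj' : (0 : ℝ) < j := by exact_mod_cast hj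
  · have h2 : j ≤ 2 * ((j + (Nat.sqrt j + 1) * (n + 1)) / 2 + 1) := by omega
    have h3 : (j : ℝ) ≤ 2 * (((j + (Nat.sqrt j + 1) * (n + 1)) / 2 + 1 : ℕ) : ℝ) := by
      exact_mod_cast h2
    rw [le_div_iff₀ hj', mul_comm 2 π, mul_assoc]
    nlinarith [Real.pi_pos]
  · have h2 : 2 * ((j + (Nat.sqrt j + 1) * (n + 1)) / 2 + 1)
        ≤ j + (Nat.sqrt j + 1) * (n + 1) + 2 := by omega
    have h3 : 2 * (((j + (Nat.sqrt j + 1) * (n + 1)) / 2 + 1 : ℕ) : ℝ)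
        ≤ j + ((Nat.sqrt j + 1 : ℕ) : ℝ) * (n + 1) + 2 := by exact_mod_cast h2
    have h4 : a * (j : ℝ)⁻¹ + π * (1 + ((Nat.sqrt j + 1 : ℕ) : ℝ) / j * (n + 1) + 2 * (j : ℝ)⁻¹)
        = (a + π * (j + ((Nat.sqrt j + 1 : ℕ) : ℝ) * (n + 1) + 2)) / j := by
      field_simp
    rw [h4, mul_comm 2 π, mul_assoc]
    gcongr

/-- Upper bound for the Riemann–Liouville operator off finitely many functionals. -/
theorem exists_functionals_rlKer {a p : ℝ} (ha : 0 < a) (hp : -1 / 2 < p) (n : ℕ) :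
    ∃ D, 0 ≤ D ∧ ∀ N k : ℕ, 1 ≤ N → 1 ≤ k → ∃ L : Finset (Lp ℝ 2 μ01 →ₗ[ℝ] ℝ),
      L.card ≤ 2 * k + N * (n + 1) ∧ ∀ f, (∀ l ∈ L, l f = 0) →
        √(∫ r, kerOp (rlKer p) f r ^ 2 ∂μ01)
          ≤ (rexp a * Gamma (p + 1) * (2 * π * k) ^ (-(p + 1)) + D / (N : ℝ) ^ (n + 1)) * ‖f‖ := by
  classical
  obtain ⟨D, hD, h⟩ := exists_functionals_remKer ha hp n
  refine ⟨D, hD, fun N k hN hk => ?_⟩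
  obtain ⟨L, hLc, hL⟩ := h N hN
  refine ⟨(Finset.univ : Finset (Bool × Fin k)).image (fun i => trigFunctional a i.1 (i.2 : ℕ)) ∪ L,
    ?_, fun f hf => ?_⟩
  · refine (Finset.card_union_le _ _).trans (add_le_add (Finset.card_image_le.trans ?_) hLc)
    simp
  · have hfm := Lp.memLp f
    obtain ⟨M, hM⟩ := isRowKernel_perKer ha hp
    have hP := hM.memLp_kerOp hfm
    have hΓ := Real.Gamma_pos_of_pos (by linarith : 0 < p + 1)
    have h1 := (sqrt_integral_perKer_sub_le ha hp hfm).2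
    have h2 := hL f fun l hl => hf l (Finset.mem_union_right _ hl)
    have h3 := sqrt_integral_perKer_le ha hp hfm (memLp_exp_mul a hfm) (memLp_exp_mul a hP)
      (m := k) (by exact_mod_cast hk) fun i hi => fourCoeff_eq_zero fun b => by
        have hi' : |i| < k := by exact_mod_cast hi
        have e : ((i.natAbs : ℕ) : ℤ) = |i| := Int.natCast_natAbs i
        refine hf _ (Finset.mem_union_left _ (Finset.mem_image.2
          ⟨(b, ⟨i.natAbs, by omega⟩), Finset.mem_univ _, ?_⟩))
        simp
    have h4 := sqrt_integral_le_exp_mul ha hP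
    have h5 := sqrt_integral_exp_mul_le ha hfm
    rw [sqrt_integral_sq] at h5
    have h6 : Gamma (p + 1) * (2 * π * k) ^ (-(p + 1)) * √(∫ t, (rexp (a * t) * f t) ^ 2 ∂μ01)
        ≤ Gamma (p + 1) * (2 * π * k) ^ (-(p + 1)) * (rexp a * ‖f‖) := by gcongr
    linarith

/-- Lower bound for the Riemann–Liouville operator on a large subspace. -/
theorem exists_subspace_rlKer {a p : ℝ} (ha : 0 < a) (hp : -1 / 2 < p) (n : ℕ) :
    ∃ D, 0 ≤ D ∧ ∀ N k : ℕ, 1 ≤ N → 1 ≤ k → ∃ W : Submodule ℝ (Lp ℝ 2 μ01),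
      FiniteDimensional ℝ W ∧ 2 * k ≤ Module.finrank ℝ W + N * (n + 1) ∧ ∀ f ∈ W,
        (rexp (-a) * Gamma (p + 1) * (a + 2 * π * k) ^ (-(p + 1)) - D / (N : ℝ) ^ (n + 1)) * ‖f‖
          ≤ √(∫ r, kerOp (rlKer p) f r ^ 2 ∂μ01) := by
  obtain ⟨D, hD, h⟩ := exists_functionals_remKer ha hp n
  refine ⟨D, hD, fun N k hN hk => ?_⟩
  obtain ⟨L, hLc, hL⟩ := h N hN
  obtain ⟨W, hW, hWr, hWf⟩ := exists_trig_subspace a k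
  obtain ⟨V, hVW, hV, hVr, hVf⟩ := exists_subspace_ker W L
  refine ⟨V, hV, by omega, fun f hf => ?_⟩
  have hfm := Lp.memLp f
  obtain ⟨M, hM⟩ := isRowKernel_perKer ha hp
  have hP := hM.memLp_kerOp hfm
  have hΓ := Real.Gamma_pos_of_pos (by linarith : 0 < p + 1)
  have h1 := (sqrt_integral_perKer_sub_le ha hp hfm).1
  have h2 := hL f (hVf f hf)
  have h3 := le_sqrt_integral_perKer ha hp hfm (memLp_exp_mul a hfm) (memLp_exp_mul a hP)
    (m := k) (by exact_mod_cast hk) (hWf f (hVW hf))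
  have h4 := sqrt_integral_exp_mul_le ha hP
  have h5 := sqrt_integral_le_exp_mul ha hfm
  rw [sqrt_integral_sq] at h5
  have h6 : Gamma (p + 1) * (a + 2 * π * k) ^ (-(p + 1)) * ‖f‖
      ≤ rexp a * √(∫ r, kerOp (perKer a p) f r ^ 2 ∂μ01) := by
    refine le_trans ?_ (h3.trans h4)
    gcongr
  have h7 : rexp (-a) * (Gamma (p + 1) * (a + 2 * π * k) ^ (-(p + 1)) * ‖f‖)
      ≤ √(∫ r, kerOp (perKer a p) f r ^ 2 ∂μ01) := by
    have := mul_le_mul_of_nonneg_left h6 (Real.exp_pos (-a)).le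
    rwa [← mul_assoc (rexp (-a)) (rexp a), ← Real.exp_add, neg_add_cancel, Real.exp_zero,
      one_mul] at this
  linarith

theorem eventually_functionals_rlKer {p δ : ℝ} (hp : -1 / 2 < p) (hδ : 0 < δ) :
    ∀ᶠ j : ℕ in atTop, ∃ L : Finset (Lp ℝ 2 μ01 →ₗ[ℝ] ℝ), L.card ≤ j ∧
      ∀ f, (∀ l ∈ L, l f = 0) → ∫ r, kerOp (rlKer p) f r ^ 2 ∂μ01
        ≤ (1 + δ) * (Gamma (p + 1) * π ^ (-(p + 1))) ^ 2 * (j : ℝ) ^ (-(2 * (p + 1))) * ‖f‖ ^ 2 := by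
  obtain ⟨a, ha, haδ⟩ : ∃ a : ℝ, 0 < a ∧ rexp a ^ 2 < 1 + δ := by
    refine ⟨log (1 + δ) / 4, div_pos (Real.log_pos (by linarith)) (by norm_num), ?_⟩
    rw [← Real.exp_nat_mul, ← Real.lt_log_iff_exp_lt (by linarith)]
    have := Real.log_pos (by linarith : 1 < 1 + δ)
    push_cast
    linarith
  have hΓ := Real.Gamma_pos_of_pos (by linarith : 0 < p + 1)
  obtain ⟨n, hn⟩ := exists_nat_gt (2 * (p + 1))
  obtain ⟨D, hD, h⟩ := exists_functionals_rlKer ha hp n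
  have hk := tendsto_half_sub n
  have hlim : Tendsto (fun j : ℕ => ((rexp a * Gamma (p + 1)
      * (2 * π * (((j - (Nat.sqrt j + 1) * (n + 1)) / 2 : ℕ) : ℝ)) ^ (-(p + 1))
      + D / ((Nat.sqrt j + 1 : ℕ) : ℝ) ^ (n + 1)) * (j : ℝ) ^ (p + 1)) ^ 2) atTop
      (nhds ((rexp a * Gamma (p + 1) * π ^ (-(p + 1)) + 0) ^ 2)) := by
    refine ((((tendsto_rpow_neg_mul (s := p + 1) (fun j => by positivity) Real.pi_pos hk).const_mul
      (rexp a * Gamma (p + 1))).add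
      (tendsto_remainder hD (s := p + 1) (n := n) (by linarith))).pow 2).congr fun j => ?_
    ring
  have hlt : (rexp a * Gamma (p + 1) * π ^ (-(p + 1)) + 0) ^ 2
      < (1 + δ) * (Gamma (p + 1) * π ^ (-(p + 1))) ^ 2 := by
    rw [add_zero, mul_assoc, mul_pow]
    have := Real.rpow_pos_of_pos Real.pi_pos (-(p + 1))
    gcongr
  filter_upwards [hlim.eventually_lt_const hlt, hk.eventually_const_lt Real.pi_pos,
    eventually_gt_atTop 0] with j h1 h2 hj
  have hj' : (0 : ℝ) < j := by exact_mod_cast hj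
  have hk1 : 1 ≤ (j - (Nat.sqrt j + 1) * (n + 1)) / 2 := by
    by_contra hcon
    rw [not_le, Nat.lt_one_iff] at hcon
    rw [hcon] at h2
    simp at h2
  obtain ⟨L, hLc, hL⟩ := h (Nat.sqrt j + 1) _ (by omega) hk1
  refine ⟨L, by omega, fun f hf => ?_⟩
  have h3 := hL f hf
  rw [Real.sqrt_le_left (by positivity), mul_pow] at h3
  refine h3.trans ?_
  gcongr
  rw [mul_pow, ← Real.rpow_natCast ((j : ℝ) ^ (p + 1)), ← Real.rpow_mul hj'.le] at h1
  rw [Real.rpow_neg hj'.le, ← div_eq_mul_inv, le_div_iff₀ (by positivity)]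
  refine le_trans (le_of_eq ?_) h1.le
  congr 2
  push_cast
  ring

theorem eventually_subspace_rlKer {p δ : ℝ} (hp : -1 / 2 < p) (hδ : 0 < δ) (hδ1 : δ < 1) :
    ∀ᶠ j : ℕ in atTop, ∃ W : Submodule ℝ (Lp ℝ 2 μ01), FiniteDimensional ℝ W ∧
      j ≤ Module.finrank ℝ W ∧ ∀ f ∈ W,
        (1 - δ) * (Gamma (p + 1) * π ^ (-(p + 1))) ^ 2 * (j : ℝ) ^ (-(2 * (p + 1))) * ‖f‖ ^ 2
          ≤ ∫ r, kerOp (rlKer p) f r ^ 2 ∂μ01 := by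
  obtain ⟨a, ha, haδ⟩ : ∃ a : ℝ, 0 < a ∧ 1 - δ < rexp (-a) ^ 2 := by
    have := Real.log_neg (by linarith : 0 < 1 - δ) (by linarith)
    refine ⟨-log (1 - δ) / 4, div_pos (by linarith) (by norm_num), ?_⟩
    rw [← Real.exp_nat_mul, ← Real.log_lt_iff_lt_exp (by linarith)]
    push_cast
    linarith
  have hΓ := Real.Gamma_pos_of_pos (by linarith : 0 < p + 1)
  obtain ⟨n, hn⟩ := exists_nat_gt (2 * (p + 1))
  obtain ⟨D, hD, h⟩ := exists_subspace_rlKer ha hp n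
  have hlim : Tendsto (fun j : ℕ => (rexp (-a) * Gamma (p + 1)
      * (a + 2 * π * (((j + (Nat.sqrt j + 1) * (n + 1)) / 2 + 1 : ℕ) : ℝ)) ^ (-(p + 1))
      - D / ((Nat.sqrt j + 1 : ℕ) : ℝ) ^ (n + 1)) * (j : ℝ) ^ (p + 1)) atTop
      (nhds (rexp (-a) * Gamma (p + 1) * π ^ (-(p + 1)) - 0)) := by
    refine (((tendsto_rpow_neg_mul (s := p + 1) (fun j => by positivity) Real.pi_pos
      (tendsto_half_add ha n)).const_mul (rexp (-a) * Gamma (p + 1))).sub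
      (tendsto_remainder hD (s := p + 1) (n := n) (by linarith))).congr fun j => ?_
    ring
  have hπ := Real.rpow_pos_of_pos Real.pi_pos (-(p + 1))
  have hlt : (1 - δ) * (Gamma (p + 1) * π ^ (-(p + 1))) ^ 2
      < (rexp (-a) * Gamma (p + 1) * π ^ (-(p + 1)) - 0) ^ 2 := by
    rw [sub_zero, mul_assoc, mul_pow (rexp (-a))]
    gcongr
  filter_upwards [(hlim.pow 2).eventually_const_lt hlt,
    hlim.eventually_const_lt (by rw [sub_zero]; positivity : (0 : ℝ) < _),
    eventually_gt_atTop 0] with j h1 h2 hj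
  have hj' : (0 : ℝ) < j := by exact_mod_cast hj
  obtain ⟨W, hW, hWr, hWf⟩ := h (Nat.sqrt j + 1) ((j + (Nat.sqrt j + 1) * (n + 1)) / 2 + 1)
    (by omega) (by omega)
  refine ⟨W, hW, by omega, fun f hf => ?_⟩
  have h3 := hWf f hf
  have h4 := pos_of_mul_pos_left h2 (by positivity)
  rw [Real.le_sqrt (mul_nonneg h4.le (norm_nonneg f))
    (integral_nonneg fun r => sq_nonneg _), mul_pow] at h3
  refine le_trans ?_ h3
  gcongr
  rw [mul_pow _ ((j : ℝ) ^ (p + 1)), ← Real.rpow_natCast ((j : ℝ) ^ (p + 1)), ← Real.rpow_mul hj'.le] at h1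
  rw [Real.rpow_neg hj'.le, ← div_eq_mul_inv, div_le_iff₀ (by positivity)]
  refine h1.le.trans (le_of_eq ?_)
  congr 2
  push_cast
  ring

theorem quantErr_eq {H : Type*} [NormedAddCommGroup H] [InnerProductSpace ℝ H]
    {Ω : Type*} [MeasurableSpace Ω] (P : Measure Ω) (X : Ω → H) (n : ℕ) :
    quantErr P X n = sInf {r : ℝ | ∃ α : Finset H, α.Nonempty ∧ α.card ≤ n ∧
      r = distortion P X α ^ (1 / 2 : ℝ)} := rfl

theorem distortion_nonneg {H : Type*} [NormedAddCommGroup H] [InnerProductSpace ℝ H]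
    {Ω : Type*} [MeasurableSpace Ω] (P : Measure Ω) (X : Ω → H) (α : Finset H) :
    0 ≤ distortion P X α := by
  refine integral_nonneg fun ω => Real.sInf_nonneg ?_
  rintro _ ⟨a, -, rfl⟩
  positivity

/-- Two-sided bounds of the distortion give the sharp asymptotics of the quantization error. -/
theorem tendsto_quantErr_div {H : Type*} [NormedAddCommGroup H] [InnerProductSpace ℝ H]
    {Ω : Type*} [MeasurableSpace Ω] {P : Measure Ω} {X : Ω → H} {C ρ : ℝ} (hC : 0 < C)
    (hlow : ∀ K < C ^ 2, ∀ᶠ n : ℕ in atTop, ∀ α : Finset H, α.Nonempty → α.card ≤ n →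
      K * log n ^ (-(2 * ρ)) ≤ distortion P X α)
    (hupp : ∀ K, C ^ 2 < K → ∀ᶠ n : ℕ in atTop, ∃ α : Finset H, α.Nonempty ∧ α.card ≤ n ∧
      distortion P X α ≤ K * log n ^ (-(2 * ρ))) :
    Tendsto (fun n : ℕ => quantErr P X n / (C * log n ^ (-ρ))) atTop (nhds 1) := by
  have hroot : ∀ κ l : ℝ, 0 < κ → 0 < l →
      ((κ * C) ^ 2 * l ^ (-(2 * ρ))) ^ (1 / 2 : ℝ) = κ * (C * l ^ (-ρ)) := fun κ l hκ hl => by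
    have e : l ^ (-(2 * ρ)) = (l ^ (-ρ)) ^ 2 := by
      rw [← Real.rpow_natCast, ← Real.rpow_mul hl.le]
      congr 1
      push_cast
      ring
    rw [e, ← mul_pow, ← Real.sqrt_eq_rpow, Real.sqrt_sq (by positivity), mul_assoc]
  have hlog : ∀ᶠ n : ℕ in atTop, 0 < log (n : ℝ) := by
    filter_upwards [eventually_gt_atTop 1] with n hn
    exact Real.log_pos (by exact_mod_cast hn)
  refine tendsto_order.2 ⟨fun x hx => ?_, fun x hx => ?_⟩
  · obtain ⟨κ, hκ, hκ1⟩ := exists_between (max_lt hx one_pos)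
    rw [max_lt_iff] at hκ
    have hK : (κ * C) ^ 2 < C ^ 2 := by
      have : κ * C < C := by nlinarith
      have := mul_pos hκ.2 hC
      gcongr
    filter_upwards [hlow _ hK, hlog, eventually_ge_atTop 1] with n hn hl hn1
    have hB : 0 < C * log n ^ (-ρ) := by positivity
    rw [lt_div_iff₀ hB]
    refine (mul_lt_mul_of_pos_right hκ.1 hB).trans_le ?_
    rw [quantErr_eq]
    refine le_csInf ⟨_, {0}, Finset.singleton_nonempty 0, by simpa using hn1, rfl⟩ ?_
    rintro _ ⟨α, hα, hαn, rfl⟩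
    rw [← hroot κ _ hκ.2 hl]
    exact Real.rpow_le_rpow (by positivity) (hn α hα hαn) (by norm_num)
  · obtain ⟨κ, hκ1, hκ⟩ := exists_between hx
    have hκ0 : 0 < κ := one_pos.trans hκ1
    have hK : C ^ 2 < (κ * C) ^ 2 := by
      have : C < κ * C := by nlinarith
      gcongr
    filter_upwards [hupp _ hK, hlog] with n hn hl
    obtain ⟨α, hα, hαn, hle⟩ := hn
    have hB : 0 < C * log n ^ (-ρ) := by positivity
    rw [div_lt_iff₀ hB]
    refine lt_of_le_of_lt ?_ (mul_lt_mul_of_pos_right hκ hB)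
    rw [quantErr_eq]
    refine csInf_le_of_le (b := distortion P X α ^ (1 / 2 : ℝ)) ⟨0, ?_⟩ ⟨α, hα, hαn, rfl⟩ ?_
    · rintro _ ⟨β, -, -, rfl⟩
      exact Real.rpow_nonneg (distortion_nonneg P X β) _
    · rw [← hroot κ _ hκ0 hl]
      exact Real.rpow_le_rpow (distortion_nonneg P X α) hle (by norm_num)

/-- High-resolution quantization formula for the Riemann–Liouville process `X^ρ` in
`L²([0,1],dt)`:
`e_n(X^ρ) ~ π^{-(ρ+1/2)} (ρ+1/2)^ρ ((2ρ+1)/(2ρ))^{1/2} Γ(ρ+1/2) (log n)^{-ρ}`. -/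
theorem riemann_liouville_quantization
    (ρ : ℝ) (hρ : 0 < ρ)
    {Ω : Type*} [MeasurableSpace Ω] (P : Measure Ω) [IsProbabilityMeasure P]
    (X : Ω → Lp ℝ 2 μ01)
    (hXmeas : AEStronglyMeasurable X P)
    (hXint : Integrable (fun ω => ‖X ω‖ ^ 2) P)
    -- `X` is a centered Gaussian random vector in `L²([0,1],dt)` ...
    (hGauss : ∀ f : Lp ℝ 2 μ01, ∃ v : ℝ≥0,
      Measure.map (fun ω => ⟪f, X ω⟫) P = gaussianReal 0 v)
    -- ... whose covariance is given by the Riemann–Liouville kernel `K_ρ`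
    (hcov : ∀ f g : Lp ℝ 2 μ01,
      (∫ ω, ⟪f, X ω⟫ * ⟪g, X ω⟫ ∂P)
        = ∫ s in (0:ℝ)..1, (∫ t in (0:ℝ)..1, f s * rlKernel ρ s t * g t)) :
    Tendsto (fun n : ℕ =>
        quantErr P X n /
          (Real.pi ^ (-(ρ + 1/2)) * (ρ + 1/2) ^ ρ * ((2*ρ + 1)/(2*ρ)) ^ (1/2 : ℝ) *
            Real.Gamma (ρ + 1/2) * (Real.log n) ^ (-ρ)))
      atTop (nhds 1) := by
  have hX : IsGaussVec P X := ⟨hXmeas, hXint, hGauss⟩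
  have hp : -1 / 2 < ρ - 1 / 2 := by linarith
  have hpe : ρ - 1 / 2 + 1 = ρ + 1 / 2 := by ring
  have hbe : 2 * (ρ + 1 / 2) = 2 * ρ + 1 := by ring
  have hq : ∀ f : Lp ℝ 2 μ01,
      ∫ ω, ⟪f, X ω⟫ ^ 2 ∂P = ∫ r, kerOp (rlKer (ρ - 1 / 2)) f r ^ 2 ∂μ01 := fun f => by
    rw [← integral_rlKernel hρ (Lp.memLp f), ← hcov f f]
    simp only [sq]
  have hΓ : 0 < Gamma (ρ + 1 / 2) := Real.Gamma_pos_of_pos (by linarith)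
  have hc : 0 < (Gamma (ρ + 1 / 2) * π ^ (-(ρ + 1 / 2))) ^ 2 := by positivity
  have hlower : SpecLower P X (2 * ρ + 1) ((Gamma (ρ + 1 / 2) * π ^ (-(ρ + 1 / 2))) ^ 2) := by
    intro δ hδ hδ1
    have := eventually_subspace_rlKer hp hδ hδ1
    simp only [hpe, hbe] at this
    simpa only [hq] using this
  have hupper : SpecUpper P X (2 * ρ + 1) ((Gamma (ρ + 1 / 2) * π ^ (-(ρ + 1 / 2))) ^ 2) := by
    intro δ hδ
    have := eventually_functionals_rlKer hp hδ
    simp only [hpe, hbe] at this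
    simpa only [hq] using this
  have hC2 : (π ^ (-(ρ + 1 / 2)) * (ρ + 1 / 2) ^ ρ * ((2 * ρ + 1) / (2 * ρ)) ^ (1 / 2 : ℝ) *
      Gamma (ρ + 1 / 2)) ^ 2 = (Gamma (ρ + 1 / 2) * π ^ (-(ρ + 1 / 2))) ^ 2
        * ((2 * ρ + 1) / 2) ^ (2 * ρ + 1 - 1) * ((2 * ρ + 1) / (2 * ρ + 1 - 1)) := by
    have e1 : (((2 * ρ + 1) / (2 * ρ)) ^ (1 / 2 : ℝ)) ^ 2 = (2 * ρ + 1) / (2 * ρ) := by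
      rw [← Real.sqrt_eq_rpow, Real.sq_sqrt (by positivity)]
    have e2 : ((ρ + 1 / 2) ^ ρ) ^ 2 = ((2 * ρ + 1) / 2) ^ (2 * ρ) := by
      rw [← Real.rpow_natCast, ← Real.rpow_mul (by positivity)]
      congr 1 <;> push_cast <;> ring
    rw [add_sub_cancel_right, mul_pow, mul_pow, mul_pow, e1, e2]
    ring
  have hexp : 1 - (2 * ρ + 1) = -(2 * ρ) := by ring
  refine tendsto_quantErr_div (by positivity) (fun K hK => ?_) fun K hK => ?_
  · rw [hC2] at hK
    have := hX.eventually_le_distortion (by linarith) hc hlower hK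
    rwa [hexp] at this
  · rw [hC2] at hK
    have := hX.eventually_exists_distortion_le (by linarith) hc hupper hK
    rwa [hexp] at this
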